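/- Let K be a field, R = K[x_1,…,x_d] a polynomial ring in d > 0 indeterminates, and n ≥ 2 an integer. Let A be an n×n symmetric matrix over R such that I = I_{n−1}(A) is of generic symmetric height (that is, ht I = 3), and suppose ht I_j(A) ≥ binom(n−j+2, 2) for all 1 ≤ j ≤ n−2 (i.e. I satisfies G_∞). Then I is of linear type. -/

import Mathlib

open Matrix

/-- The ideal generated by the `t × t` minors of a matrix. -/
noncomputable def minorsIdeal {R : Type*} [CommRing R] {α β : Type*}
    (t : ℕ) (A : Matrix α β R) : Ideal R :=
  Ideal.span {d : R | ∃ (f : Fin t → α) (g : Fin t → β),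
    Function.Injective f ∧ Function.Injective g ∧ d = (A.submatrix f g).det}

/-- The height of an ideal: the infimum of the heights of primes containing it. -/
noncomputable def idealHeight {R : Type*} [CommRing R] (I : Ideal R) : ℕ∞ :=
  ⨅ p ∈ {p : PrimeSpectrum R | I ≤ p.asIdeal}, Order.height p

/-- The minimal number of generators of an ideal. -/
noncomputable def mu {R : Type*} [CommRing R] (I : Ideal R) : ℕ :=
  sInf {n : ℕ | ∃ s : Finset R, s.card = n ∧ Ideal.span (s : Set R) = I}

/-- The condition `G_s`. -/
def SatisfiesG {R : Type*} [CommRing R] (I : Ideal R) (s : ℕ) : Prop :=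
  ∀ (p : Ideal R) (hp : p.IsPrime), I ≤ p →
    haveI := hp
    ringKrullDim (Localization.AtPrime p) ≤ ((s - 1 : ℕ) : WithBot ℕ∞) →
    (mu (I.map (algebraMap R (Localization.AtPrime p))) : WithBot ℕ∞) ≤
      ringKrullDim (Localization.AtPrime p)

/-- The defining ideal of the Rees algebra of the ideal generated by the family `f`:
the kernel of the map `R[Tᵢ] → R[u]`, `Tᵢ ↦ fᵢ·u`. -/
noncomputable def reesDefIdeal {R : Type*} [CommRing R] {ι : Type*} (f : ι → R) :
    Ideal (MvPolynomial ι R) :=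
  RingHom.ker (MvPolynomial.aeval fun i => Polynomial.C (f i) * Polynomial.X :
    MvPolynomial ι R →ₐ[R] Polynomial R)

/-- An ideal, presented by a generating family `f`, is of linear type if the defining ideal
of its Rees algebra is generated by elements homogeneous of degree `1` in the variables `Tᵢ`. -/
def IsLinearType {R : Type*} [CommRing R] {ι : Type*} (f : ι → R) : Prop :=
  reesDefIdeal f = Ideal.span
    {p : MvPolynomial ι R | p ∈ reesDefIdeal f ∧ p.IsHomogeneous 1}

/-- An ideal of a `K`-algebra, presented by a generating family `f`, is of fiber type if the
defining ideal of its Rees algebra is generated by its elements homogeneous of degree `1` in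
the variables `Tᵢ` together with its elements lying in the subring `K[Tᵢ]`. -/
def IsFiberType (K : Type*) [CommSemiring K] {R : Type*} [CommRing R] [Algebra K R]
    {ι : Type*} (f : ι → R) : Prop :=
  reesDefIdeal f = Ideal.span
    ({p : MvPolynomial ι R | p ∈ reesDefIdeal f ∧ p.IsHomogeneous 1} ∪
     {p : MvPolynomial ι R | p ∈ reesDefIdeal f ∧
        ∃ q : MvPolynomial ι K, MvPolynomial.map (algebraMap K R) q = p})

section FrobeniusTrace

open MvPolynomial

variable {V : Type*} {p : ℕ} [Fact p.Prime]

/-- The trace of Frobenius on a polynomial ring over `ZMod p`: the monomial `x ^ m` is sent to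
`x ^ e` if `m = p • e + (p - 1)` and to zero if `m` is not of this form. -/
noncomputable def frobTrace (V : Type*) (p : ℕ) :
    MvPolynomial V (ZMod p) →ₗ[ZMod p] MvPolynomial V (ZMod p) :=
  open Classical in
  (basisMonomials V (ZMod p)).constr (ZMod p) fun m =>
    if ∀ v, m v % p = p - 1 then monomial (m.mapRange (· / p) (Nat.zero_div p)) 1 else 0

open Classical in
lemma frobTrace_monomial (m : V →₀ ℕ) (a : ZMod p) :
    frobTrace V p (monomial m a) = if ∀ v, m v % p = p - 1 then
      monomial (m.mapRange (· / p) (Nat.zero_div p)) a else 0 := by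
  have h : monomial m a = a • basisMonomials V (ZMod p) m := by
    simp [smul_monomial]
  rw [h, map_smul, frobTrace, Module.Basis.constr_basis]
  split_ifs <;> simp [smul_monomial]

lemma frobTrace_pow_mul (g h : MvPolynomial V (ZMod p)) :
    frobTrace V p (g ^ p * h) = g * frobTrace V p h := by
  classical
  have hp : 0 < p := (Fact.out : p.Prime).pos
  induction g using MvPolynomial.induction_on' with
  | monomial e a =>
    induction h using MvPolynomial.induction_on' with
    | monomial m b =>
      rw [monomial_pow, ZMod.pow_card, monomial_mul, frobTrace_monomial, frobTrace_monomial]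
      have h1 : ∀ v, (p • e + m) v % p = m v % p := fun v => by simp
      simp only [h1]
      split_ifs with hm
      · have h2 : (p • e + m).mapRange (· / p) (Nat.zero_div p) =
            e + m.mapRange (· / p) (Nat.zero_div p) := by
          ext v
          simp [Nat.mul_add_div hp]
        rw [monomial_mul, h2]
      · simp
    | add f₁ f₂ h₁ h₂ => rw [mul_add, map_add, h₁, h₂, map_add, mul_add]
  | add f₁ f₂ h₁ h₂ => rw [add_pow_char, add_mul, map_add, h₁, h₂, add_mul]

lemma Ideal.span_range_pow_le_span_pow {R ι : Type*} [CommRing R] [Fintype ι] (g : ι → R)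
    {p : ℕ} (hp : 0 < p) :
    Ideal.span (Set.range g) ^ (Fintype.card ι * (p - 1) + 1) ≤
      Ideal.span (Set.range fun i => g i ^ p) := by
  classical
  intro x hx
  obtain ⟨F, hF, rfl⟩ := (Ideal.mem_span_pow_iff_exists_isHomogeneous _ _).1 hx
  rw [MvPolynomial.eval_eq]
  refine Ideal.sum_mem _ fun e he => Ideal.mul_mem_left _ _ ?_
  have hdeg : Fintype.card ι * (p - 1) + 1 = ∑ i, e i := by
    have := hF (mem_support_iff.1 he)
    rw [← this, Finsupp.weight_apply, Finsupp.sum_fintype] <;> simp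
  obtain ⟨i, hi⟩ : ∃ i, p ≤ e i := by
    by_contra! hcon
    have : ∑ i, e i ≤ ∑ _i : ι, (p - 1) := Finset.sum_le_sum fun i _ => by
      have := hcon i; omega
    simp at this
    omega
  have hie : i ∈ e.support := Finsupp.mem_support_iff.2 (by omega)
  rw [← Finset.mul_prod_erase _ _ hie]
  refine Ideal.mul_mem_right _ _ ?_
  rw [← Nat.sub_add_cancel hi, pow_add]
  exact Ideal.mul_mem_left _ _ (Ideal.subset_span ⟨i, rfl⟩)

/-- `I` is compatible with the near-splitting `h ↦ frobTrace (s ^ (p - 1) * h)`. -/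
def FrobCompatible (s : MvPolynomial V (ZMod p)) (I : Ideal (MvPolynomial V (ZMod p))) : Prop :=
  ∀ h ∈ I, frobTrace V p (s ^ (p - 1) * h) ∈ I

lemma FrobCompatible.of_mem_pow {ι : Type*} [Fintype ι] {g : ι → MvPolynomial V (ZMod p)}
    {s : MvPolynomial V (ZMod p)} (hs : s ∈ Ideal.span (Set.range g) ^ Fintype.card ι) :
    FrobCompatible s (Ideal.span (Set.range g)) := by
  intro h hh
  have hp : 0 < p := (Fact.out : p.Prime).pos
  have h1 : s ^ (p - 1) * h ∈ Ideal.span (Set.range fun i => g i ^ p) := by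
    apply Ideal.span_range_pow_le_span_pow g hp
    rw [pow_succ, pow_mul]
    exact Ideal.mul_mem_mul (Ideal.pow_mem_pow hs _) hh
  obtain ⟨c, hc⟩ := (Ideal.mem_span_range_iff_exists_fun).1 h1
  rw [← hc, map_sum]
  refine Ideal.sum_mem _ fun i _ => ?_
  rw [mul_comm, frobTrace_pow_mul]
  exact Ideal.mul_mem_right _ _ (Ideal.subset_span ⟨i, rfl⟩)

lemma FrobCompatible.iSup {ι : Sort*} {s : MvPolynomial V (ZMod p)}
    {I : ι → Ideal (MvPolynomial V (ZMod p))} (hI : ∀ i, FrobCompatible s (I i)) :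
    FrobCompatible s (⨆ i, I i) := by
  intro h hh
  induction hh using Submodule.iSup_induction' with
  | mem i x hx => exact Submodule.mem_iSup_of_mem i (hI i x hx)
  | zero => simp
  | add x y _ _ hx hy => rw [mul_add, map_add]; exact add_mem hx hy

lemma FrobCompatible.sup {s : MvPolynomial V (ZMod p)}
    {I J : Ideal (MvPolynomial V (ZMod p))} (hI : FrobCompatible s I) (hJ : FrobCompatible s J) :
    FrobCompatible s (I ⊔ J) := by
  intro h hh
  obtain ⟨x, hx, y, hy, rfl⟩ := Submodule.mem_sup.1 hh
  rw [mul_add, map_add]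
  exact add_mem (Submodule.mem_sup_left (hI x hx)) (Submodule.mem_sup_right (hJ y hy))

lemma FrobCompatible.isRadical {s : MvPolynomial V (ZMod p)}
    {I : Ideal (MvPolynomial V (ZMod p))} (hI : FrobCompatible s I)
    (hs : IsUnit (frobTrace V p (s ^ (p - 1)))) : I.IsRadical := by
  have key : ∀ f : MvPolynomial V (ZMod p), f ^ p ∈ I → f ∈ I := by
    intro f hf
    have := hI _ hf
    rw [mul_comm, frobTrace_pow_mul] at this
    exact (Ideal.mul_unit_mem_iff_mem I hs).1 this
  have key2 : ∀ (k : ℕ) (f : MvPolynomial V (ZMod p)), f ^ p ^ k ∈ I → f ∈ I := by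
    intro k
    induction k with
    | zero => intro f hf; simpa using hf
    | succ k ih => intro f hf; exact key f (ih _ (by rwa [← pow_mul, ← pow_succ']))
  rintro f ⟨k, hk⟩
  refine key2 k f (Ideal.pow_mem_of_pow_mem _ hk ?_)
  exact (Nat.lt_pow_self (Fact.out : p.Prime).one_lt).le

end FrobeniusTrace

section TopCoefficient

/-- `c` is the coefficient of `X ^ D` in `P`, and the degree of `P` is at most `D`. -/
def Polynomial.HasTop {S : Type*} [CommRing S] (D : ℕ) (c : S) (P : Polynomial S) : Prop :=
  P.natDegree ≤ D ∧ P.coeff D = c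

lemma Polynomial.HasTop.mul {S : Type*} [CommRing S] {D E : ℕ} {c e : S} {P Q : Polynomial S}
    (hP : P.HasTop D c) (hQ : Q.HasTop E e) : (P * Q).HasTop (D + E) (c * e) :=
  ⟨natDegree_mul_le_of_le hP.1 hQ.1,
    by rw [coeff_mul_add_eq_of_natDegree_le hP.1 hQ.1, hP.2, hQ.2]⟩

lemma Polynomial.HasTop.one {S : Type*} [CommRing S] :
    (1 : Polynomial S).HasTop 0 1 := ⟨by simp, by simp⟩

lemma Polynomial.HasTop.pow {S : Type*} [CommRing S] {D : ℕ} {c : S} {P : Polynomial S}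
    (hP : P.HasTop D c) (k : ℕ) : (P ^ k).HasTop (k * D) (c ^ k) := by
  induction k with
  | zero => simpa using Polynomial.HasTop.one
  | succ k ih => simpa [pow_succ, Nat.succ_mul] using ih.mul hP

lemma Polynomial.HasTop.prod {S ι : Type*} [CommRing S] {s : Finset ι} {D : ι → ℕ} {c : ι → S}
    {P : ι → Polynomial S} (hP : ∀ i ∈ s, (P i).HasTop (D i) (c i)) :
    (∏ i ∈ s, P i).HasTop (∑ i ∈ s, D i) (∏ i ∈ s, c i) := by
  classical
  induction s using Finset.induction_on with
  | empty => simpa using Polynomial.HasTop.one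
  | insert a s ha ih =>
    rw [Finset.prod_insert ha, Finset.sum_insert ha, Finset.prod_insert ha]
    exact (hP a (by simp)).mul (ih fun i hi => hP i (by simp [hi]))

/-- The top coefficient of the determinant of a matrix of monomials, when the exponents are
bounded by `r x + s y` with equality (away from zero entries) exactly along a permutation. -/
lemma Matrix.det_hasTop {S m : Type*} [CommRing S] [Fintype m] [DecidableEq m]
    (c : m → m → S) (e : m → m → ℕ) (r s : m → ℤ) (τ : Equiv.Perm m)
    (hlt : ∀ x y, c x y ≠ 0 → y ≠ τ x → (e x y : ℤ) < r x + s y)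
    (heq : ∀ x, (e x (τ x) : ℤ) = r x + s (τ x)) :
    (Matrix.det (Matrix.of fun x y => Polynomial.C (c x y) * Polynomial.X ^ e x y)).HasTop
      (∑ x, e x (τ x)) (Equiv.Perm.sign τ * ∏ x, c x (τ x)) := by
  have hprod : ∀ π : Equiv.Perm m,
      (∏ x, (Polynomial.C (c x (π x)) * Polynomial.X ^ e x (π x) : Polynomial S)) =
        Polynomial.C (∏ x, c x (π x)) * Polynomial.X ^ (∑ x, e x (π x)) := by
    intro π
    rw [Finset.prod_mul_distrib, Finset.prod_pow_eq_pow_sum, map_prod]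
  have hD : ((∑ x, e x (τ x) : ℕ) : ℤ) = ∑ x, r x + ∑ x, s x := by
    push_cast
    rw [Finset.sum_congr rfl fun x _ => heq x, Finset.sum_add_distrib, Equiv.sum_comp τ s]
  have hlt' : ∀ π : Equiv.Perm m, π ≠ τ → ∏ x, c x (π x) ≠ 0 →
      ∑ x, e x (π x) < ∑ x, e x (τ x) := by
    intro π hπ hne
    have hne' : ∀ x, c x (π x) ≠ 0 := fun x hx =>
      hne (Finset.prod_eq_zero (Finset.mem_univ x) hx)
    have hle : ∀ x, (e x (π x) : ℤ) ≤ r x + s (π x) := by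
      intro x
      by_cases hx : π x = τ x
      · rw [hx, heq]
      · exact (hlt x _ (hne' x) hx).le
    obtain ⟨x₀, hx₀⟩ : ∃ x, π x ≠ τ x := by
      by_contra! hcon
      exact hπ (Equiv.ext hcon)
    have : ∑ x, (e x (π x) : ℤ) < ∑ x, (r x + s (π x)) :=
      Finset.sum_lt_sum (fun x _ => hle x) ⟨x₀, Finset.mem_univ _, hlt x₀ _ (hne' x₀) hx₀⟩
    rw [Finset.sum_add_distrib, Equiv.sum_comp π s, ← hD] at this
    exact_mod_cast this
  rw [← Matrix.det_transpose, Matrix.det_apply']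
  simp only [Matrix.transpose_apply, Matrix.of_apply, hprod]
  constructor
  · refine Polynomial.natDegree_sum_le_of_forall_le _ _ fun π _ => ?_
    rw [← Polynomial.C_eq_intCast, ← mul_assoc, ← Polynomial.C_mul]
    by_cases hπ : π = τ
    · subst hπ; exact Polynomial.natDegree_C_mul_X_pow_le _ _
    by_cases h0 : ∏ x, c x (π x) = 0
    · simp [h0]
    · exact (Polynomial.natDegree_C_mul_X_pow_le _ _).trans (hlt' π hπ h0).le
  · rw [Polynomial.finsetSum_coeff, Finset.sum_eq_single τ]
    · rw [← Polynomial.C_eq_intCast, ← mul_assoc, ← Polynomial.C_mul,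
        Polynomial.coeff_C_mul_X_pow, if_pos rfl]
    · intro π _ hπ
      rw [← Polynomial.C_eq_intCast, ← mul_assoc, ← Polynomial.C_mul]
      by_cases h0 : ∏ x, c x (π x) = 0
      · simp [h0]
      · rw [Polynomial.coeff_C_mul_X_pow, if_neg (hlt' π hπ h0).ne']
    · simp

/-- A matrix with a large block of entries in `I` has determinant in a power of `I`. -/
lemma Matrix.det_mem_pow {S m : Type*} [CommRing S] [Fintype m] [DecidableEq m]
    (M : Matrix m m S) (I : Ideal S) (ρ κ : Finset m)
    (h : ∀ i ∈ ρ, ∀ j ∉ κ, M i j ∈ I) : M.det ∈ I ^ (ρ.card - κ.card) := by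
  rw [← Matrix.det_transpose, Matrix.det_apply']
  refine Ideal.sum_mem _ fun π _ => Ideal.mul_mem_left _ _ ?_
  set t := ρ.filter fun i => π i ∉ κ with ht
  have hcard : ρ.card - κ.card ≤ t.card := by
    have h1 : (ρ.filter fun i => π i ∈ κ).card ≤ κ.card :=
      Finset.card_le_card_of_injOn π (fun i hi => (Finset.mem_filter.1 hi).2) π.injective.injOn
    have h2 := Finset.card_filter_add_card_filter_not (s := ρ) (fun i => π i ∈ κ)
    rw [← ht] at h2
    omega
  rw [← Finset.prod_mul_prod_compl t]
  refine Ideal.mul_mem_right _ _ (Ideal.pow_le_pow_right hcard ?_)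
  have : ∏ i ∈ t, Mᵀ (π i) i ∈ ∏ _i ∈ t, I := Ideal.prod_mem_prod fun i hi => by
    rw [ht, Finset.mem_filter] at hi
    exact h i hi.1 _ hi.2
  simpa using this

end TopCoefficient

section WeightedScaling

open MvPolynomial

variable {V : Type*} {k : Type*} [CommRing k]

/-- The substitution `x_v ↦ x_v * X ^ (w v)`. -/
noncomputable def weightScale (w : V → ℕ) : MvPolynomial V k →ₐ[k] Polynomial (MvPolynomial V k) :=
  aeval fun v => Polynomial.C (X v) * Polynomial.X ^ w v

lemma weightScale_X (w : V → ℕ) (v : V) :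
    weightScale (k := k) w (X v) = Polynomial.C (X v) * Polynomial.X ^ w v := by
  simp [weightScale]

lemma weightScale_monomial (w : V → ℕ) (m : V →₀ ℕ) (a : k) :
    weightScale w (monomial m a) =
      Polynomial.C (monomial m a) * Polynomial.X ^ Finsupp.weight w m := by
  rw [weightScale, aeval_monomial, Finsupp.prod]
  simp only [mul_pow, Finset.prod_mul_distrib, ← pow_mul, Finset.prod_pow_eq_pow_sum]
  rw [← mul_assoc, Finsupp.weight_apply, Finsupp.sum]
  congr 2
  · rw [monomial_eq, map_mul, Finsupp.prod, map_prod]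
    simp [Polynomial.algebraMap_apply, algebraMap_eq]
  · exact Finset.sum_congr rfl fun i _ => by simp [mul_comm]

lemma coeff_coeff_weightScale (w : V → ℕ) (f : MvPolynomial V k) (m : V →₀ ℕ) (D : ℕ) :
    coeff m ((weightScale w f).coeff D) = if Finsupp.weight w m = D then coeff m f else 0 := by
  classical
  induction f using MvPolynomial.induction_on' with
  | monomial e a =>
    rw [weightScale_monomial, Polynomial.coeff_C_mul_X_pow]
    by_cases hem : e = m
    · subst hem
      by_cases h : Finsupp.weight w e = D
      · simp [h]
      · simp [h, Ne.symm h]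
    · by_cases h : D = Finsupp.weight w e <;> simp [h, hem, coeff_monomial]
  | add f g hf hg =>
    rw [map_add, Polynomial.coeff_add, coeff_add, hf, hg, coeff_add]
    split_ifs <;> simp

lemma isUnit_frobTrace_of_hasTop {V : Type*} [Fintype V] {p : ℕ} [Fact p.Prime]
    (w : V → ℕ) (hw : ∀ v, 0 < w v) (s : MvPolynomial V (ZMod p)) (ε : ℤˣ)
    (hs : (weightScale w s).HasTop (∑ v, w v)
      (((ε : ℤ) : MvPolynomial V (ZMod p)) * ∏ v, X v)) :
    IsUnit (frobTrace V p (s ^ (p - 1))) := by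
  classical
  have hp : 0 < p := (Fact.out : p.Prime).pos
  set g := s ^ (p - 1) with hg
  set N := (p - 1) * ∑ v, w v with hN
  let m₀ : V →₀ ℕ := Finsupp.equivFunOnFinite.symm fun _ => p - 1
  have hwt : ∀ m : V →₀ ℕ, Finsupp.weight w m = ∑ v, m v * w v := fun m => by
    rw [Finsupp.weight_apply, Finsupp.sum_fintype] <;> simp
  have htop : (weightScale w g).HasTop N
      (C ((ε : ℤ) ^ (p - 1) : ZMod p) * monomial m₀ 1) := by
    have h := hs.pow (p - 1)
    rw [← map_pow] at h
    convert h using 1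
    rw [mul_pow, monomial_eq, Finsupp.prod_fintype _ _ (by simp)]
    simp [m₀, Finset.prod_pow]
  have hsupp : ∀ m ∈ g.support, (∀ v, m v % p = p - 1) → m = m₀ := by
    intro m hm hmod
    have hle : ∀ v, p - 1 ≤ m v := fun v => (hmod v) ▸ Nat.mod_le _ _
    have h1 : Finsupp.weight w m ≤ N := by
      by_contra! hcon
      have := coeff_coeff_weightScale w g m (Finsupp.weight w m)
      rw [Polynomial.coeff_eq_zero_of_natDegree_lt (htop.1.trans_lt hcon)] at this
      simp at this
      exact (mem_support_iff.1 hm) this.symm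
    rw [hwt, hN, Finset.mul_sum] at h1
    have h2 : ∀ v ∈ Finset.univ, (p - 1) * w v ≤ m v * w v := fun v _ =>
      Nat.mul_le_mul_right _ (hle v)
    have h3 := (Finset.sum_eq_sum_iff_of_le h2).1 (le_antisymm (Finset.sum_le_sum h2) h1)
    ext v
    exact (Nat.eq_of_mul_eq_mul_right (hw v) (h3 v (Finset.mem_univ v))).symm
  have hco : coeff m₀ g = ((ε : ℤ) ^ (p - 1) : ZMod p) := by
    have h := coeff_coeff_weightScale w g m₀ N
    rw [htop.2, if_pos (by rw [hwt, hN, Finset.mul_sum]; rfl)] at h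
    rw [← h, coeff_C_mul, coeff_monomial, if_pos rfl, mul_one]
  have htr : frobTrace V p g = C ((ε : ℤ) ^ (p - 1) : ZMod p) := by
    have hmod₀ : ∀ v, m₀ v % p = p - 1 := fun v => Nat.mod_eq_of_lt (by simp [m₀]; omega)
    have hdiv₀ : m₀.mapRange (· / p) (Nat.zero_div p) = 0 := by
      ext v
      simp [m₀, Nat.div_eq_of_lt (show p - 1 < p by omega)]
    rw [g.as_sum, map_sum]
    rw [Finset.sum_eq_single m₀]
    · rw [frobTrace_monomial, if_pos hmod₀, hdiv₀, hco]; rfl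
    · intro m hm hne
      rw [frobTrace_monomial, if_neg fun h => hne (hsupp m hm h)]
    · intro h
      rw [notMem_support_iff.1 h]; simp
  rw [htr]
  refine IsUnit.map _ (IsUnit.pow _ ?_)
  exact (ε.isUnit.map (Int.castRingHom (ZMod p)))

end WeightedScaling

section BorderedMatrices

open MvPolynomial

/-- Names for the entries of three generic square matrices `A`, `B`, `C`. -/
abbrev TripleVar (n : ℕ) : Type := (Fin n × Fin n) ⊕ (Fin n × Fin n) ⊕ (Fin n × Fin n)

variable {n : ℕ}

/-- The entry `(i, l)` of the first matrix. -/
abbrev TripleVar.a (i l : Fin n) : TripleVar n := Sum.inl (i, l)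
/-- The entry `(l, j)` of the second matrix. -/
abbrev TripleVar.b (l j : Fin n) : TripleVar n := Sum.inr (Sum.inl (l, j))
/-- The entry `(i, j)` of the third matrix. -/
abbrev TripleVar.c (i j : Fin n) : TripleVar n := Sum.inr (Sum.inr (i, j))

/-- The variable at a given position of the bordered matrix, if there is one. -/
def borderLabel (I L : Finset (Fin n)) : Fin n ⊕ Fin n → Fin n ⊕ Fin n → Option (TripleVar n)
  | Sum.inl i, Sum.inl j => if i ∈ I ∧ j ∈ I then some (TripleVar.c i j) else none
  | Sum.inl i, Sum.inr l => if i ∈ I ∧ l ∈ L then some (TripleVar.a i l) else none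
  | Sum.inr l, Sum.inl j => if l ∈ L ∧ j ∈ I then some (TripleVar.b l j) else none
  | Sum.inr _, Sum.inr _ => none

/-- The row of the bordered matrix in which a variable occurs. -/
def borderRow : TripleVar n → Fin n ⊕ Fin n
  | Sum.inl v => Sum.inl v.1
  | Sum.inr (Sum.inl v) => Sum.inr v.1
  | Sum.inr (Sum.inr v) => Sum.inl v.1

lemma borderRow_of_label {I L : Finset (Fin n)} {x y : Fin n ⊕ Fin n} {v : TripleVar n}
    (h : borderLabel I L x y = some v) : borderRow v = x := by
  rcases x with i | l <;> rcases y with j | l' <;> simp only [borderLabel] at h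
  · split_ifs at h; cases h; rfl
  · split_ifs at h; cases h; rfl
  · split_ifs at h; cases h; rfl
  · cases h

/-- The square matrix `[[C, A], [B, 1]]` on the index set `I ∪ L`, extended by an identity
matrix to have fixed size. -/
def border {S : Type*} [CommRing S] (I L : Finset (Fin n)) (val : TripleVar n → S) :
    Matrix (Fin n ⊕ Fin n) (Fin n ⊕ Fin n) S :=
  Matrix.of fun x y => (borderLabel I L x y).elim (if x = y then 1 else 0) val

lemma prod_label_elim {M : Type*} [CommMonoid M] (I L : Finset (Fin n))
    (τ : Fin n ⊕ Fin n → Fin n ⊕ Fin n) (F : TripleVar n → M) :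
    ∏ x, (borderLabel I L x (τ x)).elim 1 F =
      ∏ v, if borderLabel I L (borderRow v) (τ (borderRow v)) = some v then F v else 1 := by
  rw [← Finset.prod_fiberwise (s := Finset.univ) (g := borderRow)]
  refine Finset.prod_congr rfl fun x _ => ?_
  rcases hl : borderLabel I L x (τ x) with _ | v
  · symm
    refine Finset.prod_eq_one fun v hv => ?_
    rw [Finset.mem_filter] at hv
    rw [hv.2, hl, if_neg (by simp)]
  · rw [Finset.prod_eq_single v]
    · rw [borderRow_of_label hl, hl]; simp
    · intro u hu hne
      rw [Finset.mem_filter] at hu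
      rw [hu.2, hl, if_neg]
      intro h; exact hne (Option.some.inj h).symm
    · intro h
      exact absurd (Finset.mem_filter.2 ⟨Finset.mem_univ v, borderRow_of_label hl⟩) h

lemma border_det_hasTop {k : Type*} [CommRing k] (I L : Finset (Fin n))
    (w : TripleVar n → ℕ) (r s : Fin n ⊕ Fin n → ℤ)
    (τ : Equiv.Perm (Fin n ⊕ Fin n))
    (hlt : ∀ x y v, borderLabel I L x y = some v → y ≠ τ x → (w v : ℤ) < r x + s y)
    (hpos : ∀ x, borderLabel I L x x = none → x ≠ τ x → 0 < r x + s x)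
    (heq : ∀ x, (((borderLabel I L x (τ x)).elim 0 w : ℕ) : ℤ) = r x + s (τ x))
    (hfix : ∀ x, borderLabel I L x (τ x) = none → τ x = x) :
    (weightScale w (border I L (X : TripleVar n → MvPolynomial (TripleVar n) k)).det).HasTop
      (∑ v, if borderLabel I L (borderRow v) (τ (borderRow v)) = some v then w v else 0)
      (((Equiv.Perm.sign τ : ℤ) : MvPolynomial (TripleVar n) k) *
        ∏ v, if borderLabel I L (borderRow v) (τ (borderRow v)) = some v then X v else 1) := by
  have h := Matrix.det_hasTop (S := MvPolynomial (TripleVar n) k)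
    (fun x y => (borderLabel I L x y).elim (if x = y then 1 else 0) X)
    (fun x y => (borderLabel I L x y).elim 0 w) r s τ ?_ ?_
  · have hM : (border I L (X : TripleVar n → MvPolynomial (TripleVar n) k)).map (weightScale w) =
        Matrix.of fun x y => Polynomial.C ((borderLabel I L x y).elim (if x = y then 1 else 0) X) *
          Polynomial.X ^ ((borderLabel I L x y).elim 0 w) := by
      ext1 x y
      simp only [border, Matrix.map_apply, Matrix.of_apply]
      rcases borderLabel I L x y with _ | v
      · simp only [Option.elim]; split_ifs <;> simp
      · simp [weightScale_X]
    have hdet : weightScale w (border I L (X : TripleVar n → MvPolynomial (TripleVar n) k)).det =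
        ((border I L (X : TripleVar n → MvPolynomial (TripleVar n) k)).map (weightScale w)).det :=
      AlgHom.map_det _ _
    rw [hdet, hM]
    convert h using 1
    · exact (prod_label_elim (M := Multiplicative ℕ) I L τ w).symm
    · rw [← prod_label_elim I L τ X]
      congr 1
      refine Finset.prod_congr rfl fun x _ => ?_
      rcases hl : borderLabel I L x (τ x) with _ | v
      · simp [hfix x hl]
      · simp
  · intro x y hne hy
    rcases hl : borderLabel I L x y with _ | v
    · simp only [hl, Option.elim] at hne ⊢
      have hxy : x = y := by
        by_contra hcon
        simp [hcon] at hne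
      subst hxy
      exact_mod_cast hpos x hl hy
    · exact hlt x y v hl hy
  · intro x
    exact heq x

lemma border_eq_fromBlocks {S : Type*} [CommRing S] (I L : Finset (Fin n))
    (val : TripleVar n → S) :
    border I L val = Matrix.fromBlocks
      (Matrix.of fun i j => if i ∈ I ∧ j ∈ I then val (TripleVar.c i j) else
        if i = j then 1 else 0)
      (Matrix.of fun i l => if i ∈ I ∧ l ∈ L then val (TripleVar.a i l) else 0)
      (Matrix.of fun l j => if l ∈ L ∧ j ∈ I then val (TripleVar.b l j) else 0) 1 := by
  ext x y
  rcases x with i | l <;> rcases y with j | l'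
  · simp only [border, borderLabel, of_apply, fromBlocks_apply₁₁]
    split_ifs <;> simp_all
  · simp only [border, borderLabel, of_apply, fromBlocks_apply₁₂]
    split_ifs <;> simp_all
  · simp only [border, borderLabel, of_apply, fromBlocks_apply₂₁]
    split_ifs <;> simp_all
  · simp [border, borderLabel, Matrix.one_apply]

/-- Replacing `C` by `C - A * B` and `L` by its complement does not change the determinant of
the bordered matrix, up to the sign of `A`. -/
lemma border_det_compl {S : Type*} [CommRing S] (I L : Finset (Fin n)) (val : TripleVar n → S) :
    (border I L val).det = (border I Lᶜ (Sum.elim (fun v => - val (Sum.inl v))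
      (Sum.elim (fun v => val (Sum.inr (Sum.inl v))) fun v => val (TripleVar.c v.1 v.2) -
        ∑ l, val (TripleVar.a v.1 l) * val (TripleVar.b l v.2)))).det := by
  rw [border_eq_fromBlocks, border_eq_fromBlocks, Matrix.det_fromBlocks_one₂₂,
    Matrix.det_fromBlocks_one₂₂]
  congr 1
  ext i j
  simp only [Matrix.sub_apply, Matrix.of_apply, Matrix.mul_apply, Sum.elim_inl, Sum.elim_inr]
  by_cases hij : i ∈ I ∧ j ∈ I
  · simp only [hij.1, hij.2, true_and, and_true, and_self, if_true]
    have h := Finset.sum_add_sum_compl L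
      fun l => val (TripleVar.a i l) * val (TripleVar.b l j)
    rw [← h]
    have h1 : ∀ K : Finset (Fin n), ∑ l, (if l ∈ K then val (TripleVar.a i l) else 0) *
        (if l ∈ K then val (TripleVar.b l j) else 0) =
        ∑ l ∈ K, val (TripleVar.a i l) * val (TripleVar.b l j) := by
      intro K
      rw [← Finset.univ_inter K, ← Finset.sum_ite_mem]
      refine Finset.sum_congr rfl fun l _ => ?_
      by_cases hl : l ∈ K <;> simp [hl]
    have h2 : ∑ l, (if l ∈ Lᶜ then - val (TripleVar.a i l) else 0) *
        (if l ∈ Lᶜ then val (TripleVar.b l j) else 0) =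
        - ∑ l ∈ Lᶜ, val (TripleVar.a i l) * val (TripleVar.b l j) := by
      rw [← h1, ← Finset.sum_neg_distrib]
      refine Finset.sum_congr rfl fun l _ => ?_
      split_ifs <;> simp
    rw [h1, h2]
    ring
  · have h1 : ∀ (K : Finset (Fin n)) (l : Fin n) (x y : S),
        (if i ∈ I ∧ l ∈ K then x else 0) * (if l ∈ K ∧ j ∈ I then y else 0) = 0 := by
      intro K l x y
      by_cases h1 : i ∈ I ∧ l ∈ K
      · rw [if_neg (c := l ∈ K ∧ j ∈ I) (fun h2 => hij ⟨h1.1, h2.2⟩), mul_zero]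
      · rw [if_neg h1, zero_mul]
    simp only [h1, hij, if_false, Finset.sum_const_zero]

end BorderedMatrices

section SplittingFamily

open MvPolynomial

variable {n : ℕ}

/-- Index set for the determinants whose product induces the Frobenius splitting. -/
abbrev SplitIndex (n : ℕ) : Type := Fin n ⊕ Fin n ⊕ Fin (n - 1)

/-- Rows of `C` used in a determinant of the splitting family. -/
def SplitIndex.rows : SplitIndex n → Finset (Fin n)
  | Sum.inl a => Finset.univ.filter (a ≤ ·)
  | Sum.inr (Sum.inl a) => Finset.univ.filter (· ≤ a)
  | Sum.inr (Sum.inr _) => Finset.univ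

/-- Columns of `A` used in a determinant of the splitting family. -/
def SplitIndex.cols : SplitIndex n → Finset (Fin n)
  | Sum.inl _ => ∅
  | Sum.inr (Sum.inl _) => Finset.univ
  | Sum.inr (Sum.inr t) => Finset.univ.filter (·.val ≤ t.val)

/-- The permutation giving the leading term of a determinant of the splitting family. -/
def SplitIndex.leadFun : SplitIndex n → Fin n ⊕ Fin n → Fin n ⊕ Fin n
  | Sum.inl a, Sum.inl i => if h : a ≤ i then Sum.inl ⟨n - 1 + a - i, by omega⟩ else Sum.inl i
  | Sum.inl _, Sum.inr l => Sum.inr l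
  | Sum.inr (Sum.inl a), Sum.inl i =>
      if h : i ≤ a then Sum.inr ⟨n - 1 - a + i, by omega⟩ else Sum.inl i
  | Sum.inr (Sum.inl a), Sum.inr l =>
      if h : n - 1 - a ≤ l.val then Sum.inl ⟨l - (n - 1 - a), by omega⟩ else Sum.inr l
  | Sum.inr (Sum.inr t), Sum.inl i =>
      if h : i.val + t + 2 ≤ n then Sum.inl ⟨n - (t + 2) - i, by omega⟩
      else Sum.inr ⟨i - (n - (t + 1)), by omega⟩
  | Sum.inr (Sum.inr t), Sum.inr l =>
      if h : l.val ≤ t then Sum.inl ⟨n - (t + 1) + l, by omega⟩ else Sum.inr l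

lemma SplitIndex.leadFun_involutive (f : SplitIndex n) : Function.Involutive f.leadFun := by
  intro x
  rcases f with a | a | t <;> rcases x with i | l <;> simp only [SplitIndex.leadFun] <;>
    (try split_ifs) <;> (try simp only [Fin.le_def] at *) <;>
    (try split_ifs) <;> (try simp_all [Fin.ext_iff]) <;> omega

/-- The leading permutation as an equivalence. -/
def SplitIndex.lead (f : SplitIndex n) : Equiv.Perm (Fin n ⊕ Fin n) :=
  f.leadFun_involutive.toPerm

lemma SplitIndex.lead_apply (f : SplitIndex n) (x : Fin n ⊕ Fin n) : f.lead x = f.leadFun x := rfl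

/-- The weights of the variables for which the leading terms are computed. -/
def splitWeight (n : ℕ) : TripleVar n → ℕ
  | Sum.inl (i, l) => 3 * n ^ 2 + 1 + 2 * (i + 1) * (l + 1)
  | Sum.inr (Sum.inl (l, j)) => 3 * n ^ 2 + 1 + 2 * (l + 1) * (j + 1)
  | Sum.inr (Sum.inr (i, j)) => 2 * n ^ 2 + 1 - 2 * (i * j)

lemma splitWeight_c (i j : Fin n) :
    (splitWeight n (TripleVar.c i j) : ℤ) = 2 * n ^ 2 + 1 - 2 * (i * j) := by
  have : (i : ℕ) * j ≤ n ^ 2 := by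
    rw [pow_two]; exact Nat.mul_le_mul i.2.le j.2.le
  simp only [splitWeight]
  rw [Nat.cast_sub (by omega)]
  push_cast; ring

lemma splitWeight_pos (v : TripleVar n) : 0 < splitWeight n v := by
  rcases v with ⟨i, l⟩ | ⟨l, j⟩ | ⟨i, j⟩
  · simp [splitWeight]
  · simp [splitWeight]
  · have : (i : ℕ) * j ≤ n ^ 2 := by
      rw [pow_two]; exact Nat.mul_le_mul i.2.le j.2.le
    simp only [splitWeight]; omega

/-- The determinant of the splitting family in which a given variable is part of the leading
term. -/
def TripleVar.splitIndex : TripleVar n → SplitIndex n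
  | Sum.inl (i, l) => if h : i ≤ l then Sum.inr (Sum.inl ⟨n - 1 - l + i, by omega⟩)
      else Sum.inr (Sum.inr ⟨n - 1 - (i - l), by omega⟩)
  | Sum.inr (Sum.inl (l, j)) => if h : j ≤ l then Sum.inr (Sum.inl ⟨n - 1 - l + j, by omega⟩)
      else Sum.inr (Sum.inr ⟨n - 1 - (j - l), by omega⟩)
  | Sum.inr (Sum.inr (i, j)) => if h : n - 1 ≤ i + j.val then Sum.inl ⟨i + j - (n - 1), by omega⟩
      else Sum.inr (Sum.inr ⟨n - 2 - (i + j), by omega⟩)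

lemma SplitIndex.label_lead_iff (f : SplitIndex n) (v : TripleVar n) :
    borderLabel f.rows f.cols (borderRow v) (f.lead (borderRow v)) = some v ↔
      v.splitIndex = f := by
  rcases f with a | a | t <;> rcases v with ⟨i, l⟩ | ⟨l, j⟩ | ⟨i, j⟩ <;>
    simp only [SplitIndex.lead_apply, borderRow, SplitIndex.leadFun, TripleVar.splitIndex] <;>
    split_ifs <;>
    simp only [borderLabel, SplitIndex.rows, SplitIndex.cols, Finset.mem_filter, Finset.mem_univ,
      true_and, Fin.le_def, and_self, if_true,
      and_true, reduceCtorEq, Sum.inl.injEq, Sum.inr.injEq, Fin.ext_iff] at * <;>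
    (try split_ifs) <;> simp_all [Fin.ext_iff] <;> omega

/-- Row potentials for the leading terms. -/
def SplitIndex.rowPot : SplitIndex n → Fin n ⊕ Fin n → ℤ
  | Sum.inl a, Sum.inl i => if a ≤ i then
      2 * n ^ 2 + 1 + i ^ 2 - 2 * i * (n - 1 + a) else 0
  | Sum.inl _, Sum.inr _ => 0
  | Sum.inr (Sum.inl a), Sum.inl i => if i ≤ a then
      3 * n ^ 2 + 1 + 2 * (i + 1) * (n - a) + (i + 1) ^ 2 - 2 * (i + 1) else 0
  | Sum.inr (Sum.inl a), Sum.inr l => if n - 1 - a ≤ l.val then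
      ((l : ℤ) + a + 2 - n) ^ 2 else 0
  | Sum.inr (Sum.inr t), Sum.inl i => 2 * n ^ 2 + 1 + i ^ 2 - 2 * i * (n - t - 2)
  | Sum.inr (Sum.inr t), Sum.inr l => if l.val ≤ t then
      3 * n ^ 2 + 1 - (n - t - 2) ^ 2 + (n - t - 1 + l) ^ 2 + 2 * (l + 1) else 0

/-- Column potentials for the leading terms. -/
def SplitIndex.colPot : SplitIndex n → Fin n ⊕ Fin n → ℤ
  | Sum.inl a, Sum.inl j => if a ≤ j then ((n : ℤ) - 1 + a - j) ^ 2 else 0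
  | Sum.inl _, Sum.inr _ => 0
  | Sum.inr (Sum.inl a), Sum.inl i => if i ≤ a then
      3 * n ^ 2 + 1 + 2 * (i + 1) * (n - a) + (i + 1) ^ 2 - 2 * (i + 1) else 0
  | Sum.inr (Sum.inl a), Sum.inr l => if n - 1 - a ≤ l.val then
      ((l : ℤ) + a + 2 - n) ^ 2 else 0
  | Sum.inr (Sum.inr t), Sum.inl j => ((n : ℤ) - t - 2 - j) ^ 2
  | Sum.inr (Sum.inr t), Sum.inr l => if l.val ≤ t then
      n ^ 2 + (n - t - 1 + l) ^ 2 + 2 * (l + 1) else 0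

lemma SplitIndex.weight_lt_pot (f : SplitIndex n) (x y : Fin n ⊕ Fin n) (v : TripleVar n)
    (h : borderLabel f.rows f.cols x y = some v) (hy : y ≠ f.lead x) :
    (splitWeight n v : ℤ) < f.rowPot x + f.colPot y := by
  rw [SplitIndex.lead_apply] at hy
  rcases f with a | a | t <;> rcases x with i | l <;> rcases y with j | l' <;>
    simp only [borderLabel, SplitIndex.rows, SplitIndex.cols, Finset.mem_filter, Finset.mem_univ,
      true_and, and_true, Finset.notMem_empty, and_false, false_and, if_false, if_true,
      and_self, reduceCtorEq] at h
  · split_ifs at h with hij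
    cases h
    simp only [SplitIndex.leadFun, hij.1, dif_pos, ne_eq, Sum.inl.injEq, Fin.ext_iff] at hy
    simp only [SplitIndex.rowPot, SplitIndex.colPot, hij.1, hij.2, if_true, splitWeight_c]
    have h1 : (i : ℤ) + j - (n - 1 + a) ≠ 0 := by omega
    have h2 := sq_pos_of_ne_zero h1
    linarith
  · split_ifs at h with hij
    cases h
    simp only [SplitIndex.rowPot, SplitIndex.colPot, hij.1, hij.2, if_true, splitWeight_c]
    have h1 : (a : ℤ) + 1 ≤ n := by omega
    have h2 : (0 : ℤ) ≤ i := by omega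
    have h3 : (0 : ℤ) ≤ j := by omega
    nlinarith [mul_nonneg h2 h3, mul_nonneg (add_nonneg h2 zero_le_one) (sub_nonneg.2 h1),
      mul_nonneg (add_nonneg h3 zero_le_one) (sub_nonneg.2 h1), sq_nonneg (i : ℤ),
      sq_nonneg (j : ℤ)]
  · split_ifs at h with hij
    cases h
    simp only [SplitIndex.leadFun, hij, dif_pos, ne_eq, Sum.inr.injEq, Fin.ext_iff] at hy
    simp only [SplitIndex.rowPot, SplitIndex.colPot, hij, if_true, splitWeight]
    push_cast
    have h2 : (0 : ℤ) ≤ i := by omega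
    split_ifs with hl
    · have h1 : (i : ℤ) + 1 - (l' + a + 2 - n) ≠ 0 := by omega
      have h3 := sq_pos_of_ne_zero h1
      linarith
    · have h1 : (0 : ℤ) ≤ n - a - 1 - (l' + 1) := by omega
      nlinarith [mul_nonneg (add_nonneg h2 zero_le_one) h1]
  · split_ifs at h with hij
    cases h
    simp only [SplitIndex.rowPot, SplitIndex.colPot, hij, if_true, splitWeight]
    push_cast
    have h2 : (0 : ℤ) ≤ j := by omega
    by_cases hl : n - 1 - a.val ≤ l.val
    · simp only [SplitIndex.leadFun, hl, dif_pos, ne_eq, Sum.inl.injEq, Fin.ext_iff] at hy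
      have h1 : (j : ℤ) + 1 - (l + a + 2 - n) ≠ 0 := by omega
      have h3 := sq_pos_of_ne_zero h1
      simp only [hl, if_true]
      linarith
    · have h1 : (0 : ℤ) ≤ n - a - 1 - (l + 1) := by omega
      simp only [hl, if_false]
      nlinarith [mul_nonneg (add_nonneg h2 zero_le_one) h1]
  · cases h
    simp only [SplitIndex.rowPot, SplitIndex.colPot, splitWeight_c]
    have h1 : (i : ℤ) + j - (n - t - 2) ≠ 0 := by
      simp only [SplitIndex.leadFun] at hy
      split_ifs at hy with hi
      · simp only [ne_eq, Sum.inl.injEq, Fin.ext_iff] at hy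
        omega
      · omega
    have h2 := sq_pos_of_ne_zero h1
    linarith
  · split_ifs at h with hij
    cases h
    simp only [SplitIndex.rowPot, SplitIndex.colPot, hij, if_true, splitWeight]
    push_cast
    have h1 : (i : ℤ) - (n - t - 1 + l') ≠ 0 := by
      simp only [SplitIndex.leadFun] at hy
      split_ifs at hy with hi
      · omega
      · simp only [ne_eq, Sum.inr.injEq, Fin.ext_iff] at hy
        omega
    have h2 := sq_pos_of_ne_zero h1
    linarith
  · split_ifs at h with hij
    cases h
    simp only [SplitIndex.rowPot, SplitIndex.colPot, hij, if_true, splitWeight]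
    push_cast
    have h1 : (j : ℤ) - (n - t - 1 + l) ≠ 0 := by
      simp only [SplitIndex.leadFun, hij, dif_pos, ne_eq, Sum.inl.injEq, Fin.ext_iff] at hy
      omega
    have h2 := sq_pos_of_ne_zero h1
    linarith

lemma SplitIndex.pot_pos (f : SplitIndex n) (x : Fin n ⊕ Fin n)
    (h : borderLabel f.rows f.cols x x = none) (hx : x ≠ f.lead x) :
    0 < f.rowPot x + f.colPot x := by
  rw [SplitIndex.lead_apply] at hx
  rcases f with a | a | t <;> rcases x with i | l <;>
    simp only [borderLabel, SplitIndex.rows, Finset.mem_filter, Finset.mem_univ,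
      true_and, ite_eq_right_iff, reduceCtorEq, imp_false, and_self, if_true] at h
  · simp [SplitIndex.leadFun, h] at hx
  · simp [SplitIndex.leadFun] at hx
  · simp [SplitIndex.leadFun, h] at hx
  · by_cases hl : n - 1 - a.val ≤ l.val
    · simp only [SplitIndex.rowPot, SplitIndex.colPot, hl, if_true]
      have h1 : (l : ℤ) + a + 2 - n ≠ 0 := by omega
      have h2 := sq_pos_of_ne_zero h1
      linarith
    · simp [SplitIndex.leadFun, hl] at hx
  · by_cases hl : l.val ≤ t.val
    · simp only [SplitIndex.rowPot, SplitIndex.colPot, hl, if_true]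
      have h1 : (0 : ℤ) ≤ n - t - 2 := by omega
      have h2 : (0 : ℤ) ≤ t := by omega
      have h3 : (0 : ℤ) ≤ l := by omega
      nlinarith [sq_nonneg ((n : ℤ) - t - 1 + l), mul_nonneg h1 h2]
    · simp [SplitIndex.leadFun, hl] at hx

lemma SplitIndex.weight_lead (f : SplitIndex n) (x : Fin n ⊕ Fin n) :
    (((borderLabel f.rows f.cols x (f.lead x)).elim 0 (splitWeight n) : ℕ) : ℤ) =
      f.rowPot x + f.colPot (f.lead x) := by
  rw [SplitIndex.lead_apply]
  rcases f with a | a | t <;> rcases x with i | l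
  · by_cases hi : a ≤ i
    · have h2 : n - 1 + a.val - i.val < n := by omega
      have h3 : a ≤ ⟨n - 1 + a.val - i.val, h2⟩ := by rw [Fin.le_def]; simp only; omega
      have h4 : ((n - 1 + a.val - i.val : ℕ) : ℤ) = n - 1 + a - i := by omega
      simp only [SplitIndex.leadFun, hi, dif_pos, borderLabel, SplitIndex.rows, Finset.mem_filter,
        Finset.mem_univ, h3, and_self, if_true, Option.elim_some, splitWeight_c,
        SplitIndex.rowPot, SplitIndex.colPot, h4]
      ring
    · simp [SplitIndex.leadFun, hi, borderLabel, SplitIndex.rows, SplitIndex.rowPot,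
        SplitIndex.colPot]
  · simp [SplitIndex.leadFun, borderLabel, SplitIndex.rowPot, SplitIndex.colPot]
  · by_cases hi : i ≤ a
    · have h4 : ((n - 1 - a.val + i.val : ℕ) : ℤ) = n - 1 - a + i := by omega
      simp only [SplitIndex.leadFun, hi, dif_pos, borderLabel, SplitIndex.rows, SplitIndex.cols,
        Finset.mem_filter, Finset.mem_univ, and_self, if_true, Option.elim_some,
        splitWeight, SplitIndex.rowPot, SplitIndex.colPot, Nat.le_add_right]
      push_cast [h4]
      ring
    · simp [SplitIndex.leadFun, hi, borderLabel, SplitIndex.rows, SplitIndex.rowPot,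
        SplitIndex.colPot]
  · by_cases hl : n - 1 - a.val ≤ l.val
    · have h2 : l.val - (n - 1 - a.val) < n := by omega
      have h3 : (⟨l.val - (n - 1 - a.val), h2⟩ : Fin n) ≤ a := by rw [Fin.le_def]; simp only; omega
      have h4 : ((l.val - (n - 1 - a.val) : ℕ) : ℤ) = l - (n - 1 - a) := by omega
      simp only [SplitIndex.leadFun, hl, dif_pos, borderLabel, SplitIndex.rows, SplitIndex.cols,
        Finset.mem_filter, Finset.mem_univ, true_and, h3, if_true, Option.elim_some,
        splitWeight, SplitIndex.rowPot, SplitIndex.colPot]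
      push_cast [h4]
      ring
    · simp [SplitIndex.leadFun, hl, borderLabel, SplitIndex.rowPot, SplitIndex.colPot]
  · by_cases hi : i.val + t.val + 2 ≤ n
    · have h4 : ((n - (t.val + 2) - i.val : ℕ) : ℤ) = n - (t + 2) - i := by omega
      simp only [SplitIndex.leadFun, hi, dif_pos, borderLabel, SplitIndex.rows,
        Finset.mem_univ, and_self, if_true, Option.elim_some, splitWeight_c,
        SplitIndex.rowPot, SplitIndex.colPot, h4]
      ring
    · have h3 : i.val - (n - (t.val + 1)) ≤ t := by omega
      have h4 : ((i.val - (n - (t.val + 1)) : ℕ) : ℤ) = i - (n - (t + 1)) := by omega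
      simp only [SplitIndex.leadFun, hi, dif_neg, not_false_eq_true, borderLabel, SplitIndex.rows,
        SplitIndex.cols, Finset.mem_filter, Finset.mem_univ, true_and, h3, if_true,
        Option.elim_some, splitWeight, SplitIndex.rowPot, SplitIndex.colPot]
      push_cast [h4]
      ring
  · by_cases hl : l.val ≤ t.val
    · have h4 : ((n - (t.val + 1) + l.val : ℕ) : ℤ) = n - (t + 1) + l := by omega
      simp only [SplitIndex.leadFun, hl, dif_pos, borderLabel, SplitIndex.rows, SplitIndex.cols,
        Finset.mem_filter, Finset.mem_univ, and_self, if_true, Option.elim_some,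
        splitWeight, SplitIndex.rowPot, SplitIndex.colPot]
      push_cast [h4]
      ring
    · simp [SplitIndex.leadFun, hl, borderLabel, SplitIndex.rowPot, SplitIndex.colPot]

lemma SplitIndex.lead_fixed (f : SplitIndex n) (x : Fin n ⊕ Fin n)
    (h : borderLabel f.rows f.cols x (f.lead x) = none) : f.lead x = x := by
  rw [SplitIndex.lead_apply] at *
  rcases f with a | a | t <;> rcases x with i | l <;>
    simp only [SplitIndex.leadFun] at h ⊢ <;> (try split_ifs at h ⊢ with h1) <;>
    simp only [borderLabel, SplitIndex.rows, SplitIndex.cols, Finset.mem_filter, Finset.mem_univ,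
      true_and, and_true, ite_eq_right_iff, reduceCtorEq, imp_false, not_and, not_le,
      Fin.le_def, if_true] at * <;>
    omega

/-- The polynomial inducing the Frobenius splitting. -/
noncomputable def splitPoly (n : ℕ) (k : Type*) [CommRing k] : MvPolynomial (TripleVar n) k :=
  ∏ f : SplitIndex n, (border f.rows f.cols X).det

lemma splitPoly_hasTop (k : Type*) [CommRing k] :
    ∃ ε : ℤˣ, (weightScale (splitWeight n) (splitPoly n k)).HasTop (∑ v, splitWeight n v)
      (((ε : ℤ) : MvPolynomial (TripleVar n) k) * ∏ v, X v) := by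
  refine ⟨∏ f : SplitIndex n, Equiv.Perm.sign f.lead, ?_⟩
  have h := Polynomial.HasTop.prod (s := Finset.univ) fun (f : SplitIndex n) _ =>
    border_det_hasTop (k := k) f.rows f.cols (splitWeight n) f.rowPot f.colPot f.lead
      f.weight_lt_pot f.pot_pos f.weight_lead f.lead_fixed
  rw [← map_prod] at h
  simp only [SplitIndex.label_lead_iff] at h
  rw [Finset.sum_comm, Finset.prod_mul_distrib,
    Finset.prod_comm (f := fun (f : SplitIndex n) v => if _ = f then _ else _)] at h
  simp only [Finset.sum_ite_eq, Finset.prod_ite_eq, Finset.mem_univ, if_true] at h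
  convert h using 2
  · push_cast
    rfl
  · rfl

lemma isUnit_frobTrace_splitPoly (p : ℕ) [Fact p.Prime] :
    IsUnit (frobTrace (TripleVar n) p (splitPoly n (ZMod p) ^ (p - 1))) := by
  obtain ⟨ε, hε⟩ := splitPoly_hasTop (n := n) (ZMod p)
  exact isUnit_frobTrace_of_hasTop _ splitWeight_pos _ ε hε

end SplittingFamily

section CompatibleIdeals

open MvPolynomial

variable {n : ℕ}

lemma Fin.card_filter_val_Ico {lo hi : ℕ} (h : hi ≤ n) (P : Fin n → Prop) [DecidablePred P]
    (hP : ∀ i : Fin n, P i ↔ lo ≤ i.val ∧ i.val < hi) :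
    (Finset.univ.filter P).card = hi - lo := by
  rw [← Nat.card_Ico, ← Finset.card_map Fin.valEmbedding]
  congr 1
  ext k
  simp only [Finset.mem_map, Finset.mem_filter, Finset.mem_univ, true_and, Fin.valEmbedding_apply,
    Finset.mem_Ico, hP]
  exact ⟨fun ⟨i, hi, hik⟩ => hik ▸ hi, fun hk => ⟨⟨k, by omega⟩, hk, rfl⟩⟩

variable {S : Type*} [CommRing S]

lemma border_det_mem_pow_rows (K : Ideal S) (I L I' L' : Finset (Fin n))
    (val : TripleVar n → S) (hI : I' ⊆ I) (hc : ∀ i ∈ I', ∀ j ∈ I, val (TripleVar.c i j) ∈ K)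
    (ha : ∀ i ∈ I', ∀ l ∈ L, l ∉ L' → val (TripleVar.a i l) ∈ K) :
    (border I L val).det ∈ K ^ (I'.card - L'.card) := by
  have h := Matrix.det_mem_pow (border I L val) K (I'.map ⟨Sum.inl, Sum.inl_injective⟩)
    (L'.map ⟨Sum.inr, Sum.inr_injective⟩) ?_
  · simpa using h
  · intro x hx y hy
    simp only [Finset.mem_map, Function.Embedding.coeFn_mk] at hx hy
    obtain ⟨i, hi, rfl⟩ := hx
    rcases y with j | l
    · simp only [border, of_apply, borderLabel]
      by_cases hj : j ∈ I
      · simp [hI hi, hj, hc i hi j hj]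
      · have : i ≠ j := fun h => hj (h ▸ hI hi)
        simp [hj, this]
    · have hl : l ∉ L' := fun h => hy ⟨l, h, rfl⟩
      simp only [border, of_apply, borderLabel]
      by_cases hj : l ∈ L
      · simp [hI hi, hj, ha i hi l hj hl]
      · simp [hj]

lemma border_det_mem_pow_cols (K : Ideal S) (I L I' L' : Finset (Fin n))
    (val : TripleVar n → S) (hI : I' ⊆ I) (hc : ∀ j ∈ I', ∀ i ∈ I, val (TripleVar.c i j) ∈ K)
    (hb : ∀ j ∈ I', ∀ l ∈ L, l ∉ L' → val (TripleVar.b l j) ∈ K) :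
    (border I L val).det ∈ K ^ (I'.card - L'.card) := by
  have h := Matrix.det_mem_pow (border I L val)ᵀ K (I'.map ⟨Sum.inl, Sum.inl_injective⟩)
    (L'.map ⟨Sum.inr, Sum.inr_injective⟩) ?_
  · simpa using h
  · intro x hx y hy
    simp only [Finset.mem_map, Function.Embedding.coeFn_mk] at hx hy
    obtain ⟨j, hj, rfl⟩ := hx
    rcases y with i | l
    · simp only [transpose_apply, border, of_apply, borderLabel]
      by_cases hi : i ∈ I
      · simp [hI hj, hi, hc j hj i hi]
      · have : i ≠ j := fun h => hi (h ▸ hI hj)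
        simp [hi, this]
    · have hl : l ∉ L' := fun h => hy ⟨l, h, rfl⟩
      simp only [transpose_apply, border, of_apply, borderLabel]
      by_cases hi : l ∈ L
      · simp [hI hj, hi, hb j hj l hi hl]
      · simp [hi]

lemma prod_mem_pow_of_le {ι : Type*} [Fintype ι] (K : Ideal S) (d : ι → S) (e : ι → ℕ)
    (hd : ∀ i, d i ∈ K ^ e i) {N : ℕ} (hN : N ≤ ∑ i, e i) : ∏ i, d i ∈ K ^ N := by
  apply Ideal.pow_le_pow_right hN
  rw [← Finset.prod_pow_eq_pow_sum]
  exact Ideal.prod_mem_prod fun i _ => hd i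

/-- The entries of `C - A * B`. -/
noncomputable def graphGen (n : ℕ) (k : Type*) [CommRing k] (q : Fin n × Fin n) :
    MvPolynomial (TripleVar n) k :=
  X (TripleVar.c q.1 q.2) - ∑ l, X (TripleVar.a q.1 l) * X (TripleVar.b l q.2)

/-- The entries of the rows of `C` from `i₀` on, and those of the part of `A` in these rows
and the columns before `i₀`. -/
noncomputable def rowGen (k : Type*) [CommRing k] (i₀ : Fin n)
    (q : {i : Fin n // i₀ ≤ i} × (Fin n ⊕ {l : Fin n // l < i₀})) :
    MvPolynomial (TripleVar n) k :=
  Sum.elim (fun j => X (TripleVar.c q.1.1 j)) (fun l => X (TripleVar.a q.1.1 l.1)) q.2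

/-- The entries of the columns of `C` from `j₀` on, and those of the part of `B` in these columns
and the rows before `j₀`. -/
noncomputable def colGen (k : Type*) [CommRing k] (j₀ : Fin n)
    (q : {i : Fin n // j₀ ≤ i} × (Fin n ⊕ {l : Fin n // l < j₀})) :
    MvPolynomial (TripleVar n) k :=
  Sum.elim (fun i => X (TripleVar.c i q.1.1)) (fun l => X (TripleVar.b l.1 q.1.1)) q.2

lemma splitPoly_mem_graph_pow (k : Type*) [CommRing k] :
    splitPoly n k ∈ Ideal.span (Set.range (graphGen n k)) ^ Fintype.card (Fin n × Fin n) := by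
  refine prod_mem_pow_of_le _ _ (fun f : SplitIndex n => f.rows.card - (f.colsᶜ).card)
    (fun f => ?_) ?_
  · rw [border_det_compl]
    refine border_det_mem_pow_rows _ _ _ _ _ _ (le_refl _) ?_ ?_
    · intro i _ j _
      exact Ideal.subset_span ⟨(i, j), rfl⟩
    · intro i _ l hl hl'
      exact absurd hl hl'
  · have h1 : ∀ a : Fin n, (SplitIndex.rows (Sum.inr (Sum.inl a) : SplitIndex n)).card -
        ((SplitIndex.cols (Sum.inr (Sum.inl a) : SplitIndex n))ᶜ).card = a.val + 1 := by
      intro a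
      simp only [SplitIndex.rows, SplitIndex.cols]
      rw [Fin.card_filter_val_Ico (lo := 0) (hi := a.val + 1) (by omega) _
        (fun i => by rw [Fin.le_def]; omega)]
      simp
    have h2 : ∀ t : Fin (n - 1), (SplitIndex.rows (Sum.inr (Sum.inr t) : SplitIndex n)).card -
        ((SplitIndex.cols (Sum.inr (Sum.inr t) : SplitIndex n))ᶜ).card = t.val + 1 := by
      intro t
      simp only [SplitIndex.rows, SplitIndex.cols, Finset.compl_filter]
      rw [Fin.card_filter_val_Ico (lo := t.val + 1) (hi := n) (by omega) _
        (fun i => by omega)]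
      simp
      omega
    rw [Fintype.sum_sum_type, Fintype.sum_sum_type]
    simp only [h1, h2]
    have h3 : ∀ m, (∑ a : Fin m, (a.val + 1)) * 2 = m * (m + 1) := by
      intro m
      rw [Fin.sum_univ_eq_sum_range (fun a => a + 1) m]
      induction m with
      | zero => simp
      | succ m ih => rw [Finset.sum_range_succ, add_mul, ih]; ring
    have h4 := h3 n
    have h5 := h3 (n - 1)
    rw [Fintype.card_prod, Fintype.card_fin]
    rcases n with _ | n
    · simp
    · simp only [Nat.add_sub_cancel] at *
      have : (n + 1) * (n + 1) * 2 = (n + 1) * (n + 1 + 1) + n * (n + 1) := by ring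
      omega

lemma sum_split_orders {i₀ : ℕ} (h : i₀ < n) :
    (n - i₀) * (n + i₀) ≤ ∑ a : Fin n, (n - max a.val i₀) +
      ∑ t : Fin (n - 1), (n - i₀ - (t.val + 1 - i₀)) := by
  rw [Fin.sum_univ_eq_sum_range (fun a => n - max a i₀) n,
    Fin.sum_univ_eq_sum_range (fun t => n - i₀ - (t + 1 - i₀)) (n - 1)]
  obtain ⟨m, rfl⟩ : ∃ m, n = m + 1 := ⟨n - 1, by omega⟩
  rw [Finset.sum_range_succ', Nat.add_sub_cancel, add_right_comm _ (m + 1 - max 0 i₀),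
    ← Finset.sum_add_distrib]
  obtain ⟨r, rfl⟩ : ∃ r, m = i₀ + r := ⟨m - i₀, by omega⟩
  have h1 : ∀ a ∈ Finset.range (i₀ + r), (i₀ + r + 1 - max (a + 1) i₀) +
      (i₀ + r + 1 - i₀ - (a + 1 - i₀)) = 2 * (i₀ + r + 1 - max (a + 1) i₀) := by
    intro a ha
    rw [Finset.mem_range] at ha
    omega
  rw [Finset.sum_congr rfl h1, ← Finset.mul_sum, Finset.sum_range_add]
  have h2 : ∑ a ∈ Finset.range i₀, (i₀ + r + 1 - max (a + 1) i₀) = i₀ * (r + 1) := by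
    rw [Finset.sum_congr rfl (g := fun _ => r + 1)]
    · simp
    · intro a ha
      rw [Finset.mem_range] at ha
      omega
  have h3 : ∀ c d, ∑ a ∈ Finset.range d, (c + d + 1 - max (c + a + 1) c) =
      ∑ a ∈ Finset.range d, (d - a) := fun c d =>
    Finset.sum_congr rfl fun a _ => by omega
  have h4 : ∀ d, 2 * ∑ a ∈ Finset.range d, (d - a) = d * (d + 1) := by
    intro d
    induction d with
    | zero => simp
    | succ d ih =>
      rw [Finset.sum_range_succ']
      simp only [Nat.add_sub_add_right, mul_add, ih]
      simp; ring
  rw [h2, h3, mul_add 2, h4]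
  have h5 : i₀ + r + 1 - i₀ = r + 1 := by omega
  have h6 : i₀ + r + 1 - max 0 i₀ = r + 1 := by omega
  rw [h5, h6]
  apply le_of_eq
  ring

lemma card_block_index (i₀ : Fin n) :
    Fintype.card ({i : Fin n // i₀ ≤ i} × (Fin n ⊕ {l : Fin n // l < i₀})) =
      (n - i₀) * (n + i₀) := by
  rw [Fintype.card_prod, Fintype.card_sum, Fintype.card_fin, Fintype.card_subtype,
    Fintype.card_subtype,
    Fin.card_filter_val_Ico (lo := i₀.val) (hi := n) le_rfl _ (fun i => by rw [Fin.le_def]; omega),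
    Fin.card_filter_val_Ico (lo := 0) (hi := i₀.val) i₀.2.le _
      (fun i => by rw [Fin.lt_def]; omega), Nat.sub_zero]

lemma le_sum_split_orders (i₀ : Fin n) :
    (n - i₀) * (n + i₀) ≤ ∑ f : SplitIndex n,
      ((f.rows.filter (i₀ ≤ ·)).card - (f.cols.filter (i₀ ≤ ·)).card) := by
  refine (sum_split_orders i₀.2).trans ?_
  rw [Fintype.sum_sum_type, Fintype.sum_sum_type]
  refine add_le_add (Finset.sum_le_sum fun a _ => ?_)
    (le_trans (Finset.sum_le_sum fun t _ => ?_) (Nat.le_add_left _ _))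
  · simp only [SplitIndex.rows, SplitIndex.cols, Finset.filter_filter, Finset.filter_empty,
      Finset.card_empty]
    rw [Fin.card_filter_val_Ico (lo := max a.val i₀.val) (hi := n) le_rfl _
      (fun i => by simp only [Fin.le_def]; omega), Nat.sub_zero]
  · simp only [SplitIndex.rows, SplitIndex.cols, Finset.filter_filter]
    rw [Fin.card_filter_val_Ico (lo := i₀.val) (hi := n) le_rfl _
      (fun i => by simp only [Fin.le_def]; omega),
      Fin.card_filter_val_Ico (lo := i₀.val) (hi := t.val + 1) (by omega) _
      (fun i => by simp only [Fin.le_def]; omega)]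

lemma splitPoly_mem_row_pow (k : Type*) [CommRing k] (i₀ : Fin n) :
    splitPoly n k ∈ Ideal.span (Set.range (rowGen k i₀)) ^
      Fintype.card ({i : Fin n // i₀ ≤ i} × (Fin n ⊕ {l : Fin n // l < i₀})) := by
  refine prod_mem_pow_of_le _ _
    (fun f : SplitIndex n => (f.rows.filter (i₀ ≤ ·)).card - (f.cols.filter (i₀ ≤ ·)).card)
    (fun f => ?_) (by rw [card_block_index]; exact le_sum_split_orders i₀)
  refine border_det_mem_pow_rows _ _ _ _ _ _ (Finset.filter_subset _ _) ?_ ?_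
  · intro i hi j _
    exact Ideal.subset_span ⟨(⟨i, (Finset.mem_filter.1 hi).2⟩, Sum.inl j), rfl⟩
  · intro i hi l hl hl'
    refine Ideal.subset_span ⟨(⟨i, (Finset.mem_filter.1 hi).2⟩, Sum.inr ⟨l, ?_⟩), rfl⟩
    by_contra hcon
    exact hl' (Finset.mem_filter.2 ⟨hl, not_lt.1 hcon⟩)

lemma splitPoly_mem_col_pow (k : Type*) [CommRing k] (i₀ : Fin n) :
    splitPoly n k ∈ Ideal.span (Set.range (colGen k i₀)) ^
      Fintype.card ({i : Fin n // i₀ ≤ i} × (Fin n ⊕ {l : Fin n // l < i₀})) := by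
  refine prod_mem_pow_of_le _ _
    (fun f : SplitIndex n => (f.rows.filter (i₀ ≤ ·)).card - (f.cols.filter (i₀ ≤ ·)).card)
    (fun f => ?_) (by rw [card_block_index]; exact le_sum_split_orders i₀)
  refine border_det_mem_pow_cols _ _ _ _ _ _ (Finset.filter_subset _ _) ?_ ?_
  · intro i hi j _
    exact Ideal.subset_span ⟨(⟨i, (Finset.mem_filter.1 hi).2⟩, Sum.inl j), rfl⟩
  · intro i hi l hl hl'
    refine Ideal.subset_span ⟨(⟨i, (Finset.mem_filter.1 hi).2⟩, Sum.inr ⟨l, ?_⟩), rfl⟩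
    by_contra hcon
    exact hl' (Finset.mem_filter.2 ⟨hl, not_lt.1 hcon⟩)

/-- The ideal expressing `C = 0 = A * B` with `A` upper and `B` lower triangular. -/
noncomputable def tripleIdeal (n : ℕ) (k : Type*) [CommRing k] :
    Ideal (MvPolynomial (TripleVar n) k) :=
  Ideal.span (Set.range (graphGen n k)) ⊔
    ((⨆ i, Ideal.span (Set.range (rowGen k i))) ⊔ ⨆ j, Ideal.span (Set.range (colGen k j)))

lemma tripleIdeal_isRadical (p : ℕ) [Fact p.Prime] : (tripleIdeal n (ZMod p)).IsRadical := by
  refine FrobCompatible.isRadical (s := splitPoly n (ZMod p)) ?_ (isUnit_frobTrace_splitPoly p)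
  exact (FrobCompatible.of_mem_pow (splitPoly_mem_graph_pow _)).sup
    ((FrobCompatible.iSup fun i => FrobCompatible.of_mem_pow (splitPoly_mem_row_pow _ i)).sup
      (FrobCompatible.iSup fun i => FrobCompatible.of_mem_pow (splitPoly_mem_col_pow _ i)))

end CompatibleIdeals

section TriangularProduct

open MvPolynomial

variable {n : ℕ}

/-- The symmetric matrix with entries given by a function on unordered pairs. -/
def symMat {ι R : Type*} (v : Sym2 ι → R) : Matrix ι ι R := Matrix.of fun i j => v s(i, j)

/-- The upper triangular matrix with entries given by a function on unordered pairs. -/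
def upperMat {R : Type*} [Zero R] (v : Sym2 (Fin n) → R) : Matrix (Fin n) (Fin n) R :=
  Matrix.of fun i j => if i ≤ j then v s(i, j) else 0

/-- The lower triangular matrix with entries given by a function on unordered pairs. -/
def lowerMat {R : Type*} [Zero R] (v : Sym2 (Fin n) → R) : Matrix (Fin n) (Fin n) R :=
  Matrix.of fun i j => if j ≤ i then v s(i, j) else 0

/-- The ideal generated by the entries of a matrix. -/
def entryIdeal {m R : Type*} [CommRing R] (M : Matrix m m R) : Ideal R :=
  Ideal.span (Set.range fun q : m × m => M q.1 q.2)

lemma mem_entryIdeal {m R : Type*} [CommRing R] (M : Matrix m m R) (i j : m) :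
    M i j ∈ entryIdeal M := Ideal.subset_span ⟨(i, j), rfl⟩

/-- The ideal of entries of the product of a generic upper triangular matrix (in the variables
`Sum.inr`) and a generic lower triangular matrix (in the variables `Sum.inl`). -/
noncomputable def triangularIdeal (n : ℕ) (k : Type*) [CommRing k] :
    Ideal (MvPolynomial (Sym2 (Fin n) ⊕ Sym2 (Fin n)) k) :=
  entryIdeal (upperMat (fun s => X (Sum.inr s)) * lowerMat fun s => X (Sum.inl s))

theorem triangularIdeal_isRadical (p : ℕ) [Fact p.Prime] :
    (triangularIdeal n (ZMod p)).IsRadical := by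
  set k := ZMod p
  let ψ : MvPolynomial (Sym2 (Fin n) ⊕ Sym2 (Fin n)) k →ₐ[k] MvPolynomial (TripleVar n) k :=
    aeval (Sum.elim (fun s => X (TripleVar.b s.sup s.inf)) fun s => X (TripleVar.a s.inf s.sup))
  let π : MvPolynomial (TripleVar n) k →ₐ[k] MvPolynomial (Sym2 (Fin n) ⊕ Sym2 (Fin n)) k :=
    aeval (Sum.elim (fun q => upperMat (fun s => X (Sum.inr s)) q.1 q.2)
      (Sum.elim (fun q => lowerMat (fun s => X (Sum.inl s)) q.1 q.2) fun _ => 0))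
  have hπψ : ∀ f, π (ψ f) = f := by
    intro f
    have : π.comp ψ = AlgHom.id k _ := by
      apply MvPolynomial.algHom_ext
      rintro (s | s) <;> induction s using Sym2.ind with | _ i j => ?_
      · rcases le_total i j with h | h <;>
          simp [ψ, π, lowerMat, h, Sym2.eq_swap]
      · rcases le_total i j with h | h <;>
          simp [ψ, π, upperMat, h, Sym2.eq_swap]
    exact DFunLike.congr_fun this f
  have hc : ∀ i j, (X (TripleVar.c i j) : MvPolynomial (TripleVar n) k) ∈ tripleIdeal n k := by
    intro i j
    refine Submodule.mem_sup_right (Submodule.mem_sup_left (Submodule.mem_iSup_of_mem i ?_))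
    exact Ideal.subset_span ⟨(⟨i, le_rfl⟩, Sum.inl j), rfl⟩
  have ha : ∀ i l, l < i → (X (TripleVar.a i l) : MvPolynomial (TripleVar n) k) ∈
      tripleIdeal n k := by
    intro i l hl
    refine Submodule.mem_sup_right (Submodule.mem_sup_left (Submodule.mem_iSup_of_mem i ?_))
    exact Ideal.subset_span ⟨(⟨i, le_rfl⟩, Sum.inr ⟨l, hl⟩), rfl⟩
  have hb : ∀ j l, l < j → (X (TripleVar.b l j) : MvPolynomial (TripleVar n) k) ∈
      tripleIdeal n k := by
    intro j l hl
    refine Submodule.mem_sup_right (Submodule.mem_sup_right (Submodule.mem_iSup_of_mem j ?_))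
    exact Ideal.subset_span ⟨(⟨j, le_rfl⟩, Sum.inr ⟨l, hl⟩), rfl⟩
  have hψ : ∀ f ∈ triangularIdeal n k, ψ f ∈ tripleIdeal n k := by
    intro f hf
    suffices triangularIdeal n k ≤ (tripleIdeal n k).comap ψ from this hf
    refine Ideal.span_le.2 ?_
    rintro _ ⟨⟨i, j⟩, rfl⟩
    rw [SetLike.mem_coe, Ideal.mem_comap]
    have h1 : X (TripleVar.c i j) - graphGen n k (i, j) ∈ tripleIdeal n k :=
      sub_mem (hc i j) (Submodule.mem_sup_left (Ideal.subset_span ⟨(i, j), rfl⟩))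
    rw [graphGen, sub_sub_cancel] at h1
    have h2 : ψ ((upperMat (fun s => X (Sum.inr s)) * lowerMat fun s => X (Sum.inl s) :
          Matrix (Fin n) (Fin n) (MvPolynomial (Sym2 (Fin n) ⊕ Sym2 (Fin n)) k)) i j) -
        ∑ l, X (TripleVar.a i l) * X (TripleVar.b l j) ∈ tripleIdeal n k := by
      rw [Matrix.mul_apply, map_sum, ← Finset.sum_sub_distrib]
      refine Ideal.sum_mem _ fun l _ => ?_
      simp only [upperMat, lowerMat, of_apply]
      by_cases hi : i ≤ l
      · by_cases hj : j ≤ l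
        · simp [ψ, hi, hj]
        · simp only [hj, if_false, mul_zero, map_zero, zero_sub]
          exact neg_mem (Ideal.mul_mem_left _ _ (hb j l (not_le.1 hj)))
      · simp only [hi, if_false, zero_mul, map_zero, zero_sub]
        exact neg_mem (Ideal.mul_mem_right _ _ (ha i l (not_le.1 hi)))
    have h3 := add_mem h2 h1
    rwa [sub_add_cancel] at h3
  have hπ : ∀ f ∈ tripleIdeal n k, π f ∈ triangularIdeal n k := by
    intro f hf
    suffices tripleIdeal n k ≤ (triangularIdeal n k).comap π from this hf
    refine sup_le (Ideal.span_le.2 ?_) (sup_le (iSup_le fun i₀ => Ideal.span_le.2 ?_)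
      (iSup_le fun i₀ => Ideal.span_le.2 ?_))
    · rintro _ ⟨⟨i, j⟩, rfl⟩
      rw [SetLike.mem_coe, Ideal.mem_comap]
      simp only [graphGen, map_sub, map_sum, map_mul, π, aeval_X, Sum.elim_inl, Sum.elim_inr,
        zero_sub]
      rw [← Matrix.mul_apply]
      exact neg_mem (mem_entryIdeal _ i j)
    · rintro _ ⟨⟨⟨i, hi⟩, j | ⟨l, hl⟩⟩, rfl⟩ <;> rw [SetLike.mem_coe, Ideal.mem_comap]
      · simp [π, rowGen]
      · simp [π, rowGen, upperMat, (hl.trans_le hi).not_ge]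
    · rintro _ ⟨⟨⟨i, hi⟩, j | ⟨l, hl⟩⟩, rfl⟩ <;> rw [SetLike.mem_coe, Ideal.mem_comap]
      · simp [π, colGen]
      · simp [π, colGen, lowerMat, (hl.trans_le hi).not_ge]
  rintro f ⟨m, hm⟩
  rw [← hπψ f]
  refine hπ _ (tripleIdeal_isRadical p ⟨m, ?_⟩)
  rw [← map_pow]
  exact hψ _ hm

end TriangularProduct

section Degeneration

open MvPolynomial

variable {n : ℕ} {k : Type*} {L : Type} [CommRing k] [Field L] [Algebra k L]

lemma Polynomial.eval_zero_of_eval_ne_zero [Infinite L] (F : Polynomial L)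
    (h : ∀ z, z ≠ 0 → F.eval z = 0) : F.eval 0 = 0 := by
  have : F = 0 := F.eq_zero_of_infinite_isRoot
    ((Set.finite_singleton (0 : L)).infinite_compl.mono fun z hz => h z hz)
  simp [this]

/-- The names of the entries of a pair of symmetric matrices. -/
abbrev PairVar (n : ℕ) : Type := Sym2 (Fin n) ⊕ Sym2 (Fin n)

/-- The point with coordinates the upper entries of `U` and the lower entries of `E`. -/
def pairPoint {R : Type*} (U E : Matrix (Fin n) (Fin n) R) : PairVar n → R :=
  Sum.elim (fun s => E s.sup s.inf) fun s => U s.inf s.sup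

lemma eval_aeval_pairPoint (g : MvPolynomial (PairVar n) k)
    (U E : Matrix (Fin n) (Fin n) (Polynomial L)) (z : L) :
    (aeval (pairPoint U E) g).eval z =
      aeval (pairPoint (U.map (Polynomial.eval z)) (E.map (Polynomial.eval z))) g := by
  have h := MvPolynomial.comp_aeval_apply (R := k) (f := pairPoint U E)
    ((Polynomial.aeval z : Polynomial L →ₐ[L] L).restrictScalars k) g
  simp only [AlgHom.coe_restrictScalars', Polynomial.coe_aeval_eq_eval] at h
  rw [h]
  congr 2
  ext (s | s) <;> rfl

/-- The weight of an entry of a symmetric matrix: the smaller of its two indices. -/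
def minWeight (n : ℕ) : PairVar n → ℕ := Sum.elim (fun s => s.inf) fun s => s.inf

lemma aeval_scaled_point {V : Type*} (w : V → ℕ) (f : MvPolynomial V k) (D : ℕ)
    (hD : (weightScale w f).natDegree ≤ D) (y : V → L) (c : L) :
    aeval (fun s => c ^ w s * y s) f =
      ∑ j ∈ Finset.range (D + 1), aeval y ((weightScale w f).coeff j) * c ^ j := by
  have h1 : aeval (fun s => c ^ w s * y s) f =
      Polynomial.eval₂ (aeval y : MvPolynomial V k →ₐ[k] L).toRingHom c (weightScale w f) := by
    let φ : MvPolynomial V k →ₐ[k] L :=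
      { (Polynomial.eval₂RingHom (aeval y : MvPolynomial V k →ₐ[k] L).toRingHom c).comp
          (weightScale w).toRingHom with
        commutes' := fun r => by
          simp [weightScale, Polynomial.algebraMap_apply] }
    have : aeval (fun s => c ^ w s * y s) = φ := by
      apply MvPolynomial.algHom_ext
      intro s
      change _ = Polynomial.eval₂ (aeval y : MvPolynomial V k →ₐ[k] L).toRingHom c
        (weightScale w (X s))
      rw [weightScale_X, aeval_X, mul_comm]
      simp
    rw [this]
    rfl
  rw [h1, Polynomial.eval₂_eq_sum_range' _ (Nat.lt_succ_of_le hD)]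
  rfl

/-- A pair of symmetric matrices that are simultaneously diagonal for a pair of dual bases, with
product zero. -/
def DiagPair (X T : Matrix (Fin n) (Fin n) L) : Prop :=
  ∃ (ι : Type) (_ : Fintype ι) (_ : DecidableEq ι) (P : Matrix ι (Fin n) L)
    (Q : Matrix (Fin n) ι L) (D D' : ι → L), P * Q = 1 ∧ Q * P = 1 ∧ (∀ i, D i * D' i = 0) ∧
      X = Pᵀ * diagonal D * P ∧ T = Q * diagonal D' * Qᵀ

lemma DiagPair.isSymm_left {X T : Matrix (Fin n) (Fin n) L} (h : DiagPair X T) :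
    Xᵀ = X := by
  obtain ⟨ι, _, _, P, Q, D, D', -, -, -, rfl, -⟩ := h
  simp [Matrix.mul_assoc]

lemma DiagPair.isSymm_right {X T : Matrix (Fin n) (Fin n) L} (h : DiagPair X T) :
    Tᵀ = T := by
  obtain ⟨ι, _, _, P, Q, D, D', -, -, -, -, rfl⟩ := h
  simp [Matrix.mul_assoc]

lemma DiagPair.swap {X T : Matrix (Fin n) (Fin n) L} (h : DiagPair X T) :
    DiagPair T X := by
  obtain ⟨ι, _, _, P, Q, D, D', hPQ, hQP, hD, rfl, rfl⟩ := h
  refine ⟨ι, ‹_›, ‹_›, Qᵀ, Pᵀ, D', D, ?_, ?_, fun i => by rw [mul_comm, hD], ?_, ?_⟩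
  · rw [← transpose_mul, hPQ, transpose_one]
  · rw [← transpose_mul, hQP, transpose_one]
  · simp
  · simp

lemma DiagPair.congr {X T : Matrix (Fin n) (Fin n) L} (h : DiagPair X T)
    {g g' : Matrix (Fin n) (Fin n) L} (hg : g * g' = 1) :
    DiagPair (g * X * gᵀ) (g'ᵀ * T * g') := by
  obtain ⟨ι, _, _, P, Q, D, D', hPQ, hQP, hD, rfl, rfl⟩ := h
  have hg' : g' * g = 1 := mul_eq_one_comm.1 hg
  refine ⟨ι, ‹_›, ‹_›, P * gᵀ, g'ᵀ * Q, D, D', ?_, ?_, hD, ?_, ?_⟩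
  · rw [Matrix.mul_assoc, ← Matrix.mul_assoc gᵀ, ← transpose_mul, hg', transpose_one,
      Matrix.one_mul, hPQ]
  · rw [Matrix.mul_assoc, ← Matrix.mul_assoc Q, hQP, Matrix.one_mul, ← transpose_mul, hg,
      transpose_one]
  · simp [Matrix.mul_assoc]
  · simp [Matrix.mul_assoc]

/-- The diagonal matrix with entries `1, c, c ^ 2, …`. -/
def powDiag (n : ℕ) (c : L) : Matrix (Fin n) (Fin n) L := diagonal fun i => c ^ (i : ℕ)

/-- The pairs `(U, E)` obtained from pairs of symmetric matrices with product zero by successive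
one-parameter degenerations. -/
inductive Reach : Matrix (Fin n) (Fin n) L → Matrix (Fin n) (Fin n) L → Prop
  | curve (U E : Matrix (Fin n) (Fin n) (Polynomial L))
      (h : ∀ c : L, c ≠ 0 → DiagPair (powDiag n c * U.map (Polynomial.eval c⁻¹))
        (E.map (Polynomial.eval c⁻¹) * powDiag n c)) :
      Reach (U.map (Polynomial.eval 0)) (E.map (Polynomial.eval 0))
  | limit (U E : Matrix (Fin n) (Fin n) (Polynomial L))
      (h : ∀ z : L, z ≠ 0 → Reach (U.map (Polynomial.eval z)) (E.map (Polynomial.eval z))) :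
      Reach (U.map (Polynomial.eval 0)) (E.map (Polynomial.eval 0))

/-- The upper triangular part of a matrix, with the entry in place `(i, j)` multiplied by the power
`X ^ (e * (j - i))` of an indeterminate. -/
noncomputable def scaleMat (e : ℕ) (m : Matrix (Fin n) (Fin n) L) :
    Matrix (Fin n) (Fin n) (Polynomial L) :=
  Matrix.of fun i j => Polynomial.C (m i j) * Polynomial.X ^ (e * ((j : ℕ) - i))

lemma scaleMat_map_eval_inv (e : ℕ) {m : Matrix (Fin n) (Fin n) L}
    (hm : m.BlockTriangular id) {c : L} (hc : c ≠ 0) :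
    (scaleMat e m).map (Polynomial.eval c⁻¹) =
      powDiag n (c ^ e) * m * powDiag n (c⁻¹ ^ e) := by
  ext i j
  simp only [scaleMat, powDiag, diagonal_mul, mul_diagonal, map_apply, of_apply,
    Polynomial.eval_mul, Polynomial.eval_C, Polynomial.eval_pow, Polynomial.eval_X]
  by_cases h : i ≤ j
  · obtain ⟨r, hr⟩ := Nat.exists_eq_add_of_le (show (i : ℕ) ≤ j from h)
    rw [hr, Nat.add_sub_cancel_left, pow_add (c⁻¹ ^ e), ← pow_mul, ← pow_mul, ← pow_mul]
    have h1 : c ^ (e * (i : ℕ)) * c⁻¹ ^ (e * (i : ℕ)) = 1 := by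
      rw [← mul_pow, mul_inv_cancel₀ hc, one_pow]
    linear_combination (-m i j * c⁻¹ ^ (e * r)) * h1
  · rw [hm (not_le.1 h)]
    simp

lemma scaleMat_map_eval_zero {e : ℕ} (he : e ≠ 0) {m : Matrix (Fin n) (Fin n) L}
    (hm : m.BlockTriangular id) :
    (scaleMat e m).map (Polynomial.eval 0) = diagonal m.diag := by
  ext i j
  simp only [scaleMat, map_apply, of_apply,
    Polynomial.eval_mul, Polynomial.eval_C, Polynomial.eval_pow, Polynomial.eval_X]
  rcases lt_trichotomy i j with h | h | h
  · rw [diagonal_apply_ne _ h.ne, zero_pow, mul_zero]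
    have : (i : ℕ) < j := h
    exact Nat.mul_ne_zero he (by omega)
  · subst h
    simp
  · rw [diagonal_apply_ne _ h.ne', hm h, zero_mul]

lemma powDiag_mul (c d : L) : powDiag n c * powDiag n d = powDiag n (c * d) := by
  simp [powDiag, mul_pow]

lemma powDiag_one : powDiag n (1 : L) = 1 := by
  simp [powDiag]

lemma map_eval_mul (z : L) (M N : Matrix (Fin n) (Fin n) (Polynomial L)) :
    (M * N).map (Polynomial.eval z) = M.map (Polynomial.eval z) * N.map (Polynomial.eval z) :=
  Matrix.map_mul (f := Polynomial.evalRingHom z)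

lemma Reach.swap {U E : Matrix (Fin n) (Fin n) L} (h : Reach U E) : Reach Eᵀ Uᵀ := by
  induction h with
  | curve U E h =>
    refine Reach.curve Eᵀ Uᵀ fun c hc => ?_
    have h1 := (h c hc).isSymm_left
    have h2 := (h c hc).isSymm_right
    have h3 := (h c hc).swap
    rw [← h1, ← h2] at h3
    simpa [transpose_mul, powDiag, transpose_map] using h3
  | limit U E h ih => exact Reach.limit Eᵀ Uᵀ fun c hc => ih c hc

lemma Reach.unitriangular_mul {U E a b : Matrix (Fin n) (Fin n) L} (h : Reach U E)
    (ha : a.BlockTriangular id) (hb : b.BlockTriangular id) (ha' : a.diag = 1) (hb' : b.diag = 1)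
    (hab : a * b = 1) : Reach (a * U) E := by
  induction h with
  | curve U E h =>
    have := Reach.curve (a.map Polynomial.C * U * (scaleMat 1 a)ᵀ)
      ((scaleMat 1 b)ᵀ * E * scaleMat 2 b) fun c hc => by
        have hcc : c * c⁻¹ = 1 := mul_inv_cancel₀ hc
        have hg : (powDiag n c * a * powDiag n c⁻¹) * (powDiag n c * b * powDiag n c⁻¹) = 1 := by
          calc _ = powDiag n c * (a * (powDiag n c⁻¹ * powDiag n c) * b) * powDiag n c⁻¹ := by
                simp only [Matrix.mul_assoc]
            _ = 1 := by
              rw [powDiag_mul, mul_comm c⁻¹, hcc, powDiag_one, Matrix.mul_one, hab,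
                Matrix.mul_one, powDiag_mul, hcc, powDiag_one]
        have h1 := (h c hc).congr hg
        convert h1 using 1
        · rw [map_eval_mul, map_eval_mul, transpose_map, scaleMat_map_eval_inv 1 ha hc]
          have : (a.map Polynomial.C).map (Polynomial.eval c⁻¹) = a := by ext; simp
          rw [this, pow_one, pow_one]
          calc _ = powDiag n c * a * 1 * (U.map (Polynomial.eval c⁻¹) *
                (powDiag n c * a * powDiag n c⁻¹)ᵀ) := by
                  simp only [Matrix.mul_assoc, Matrix.one_mul]
            _ = _ := by
              rw [← powDiag_one, ← mul_inv_cancel₀ hc, mul_comm c, ← powDiag_mul]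
              simp only [Matrix.mul_assoc]
        · rw [map_eval_mul, map_eval_mul, transpose_map, scaleMat_map_eval_inv 1 hb hc,
            scaleMat_map_eval_inv 2 hb hc]
          simp only [pow_one, pow_two, ← powDiag_mul]
          simp only [Matrix.mul_assoc]
          rw [powDiag_mul c⁻¹ c, mul_comm c⁻¹, hcc, powDiag_one, Matrix.mul_one]
    convert this using 1
    · rw [map_eval_mul, map_eval_mul, transpose_map, scaleMat_map_eval_zero one_ne_zero ha, ha']
      have : (a.map Polynomial.C).map (Polynomial.eval 0) = a := by ext; simp
      rw [this]
      simp
    · rw [map_eval_mul, map_eval_mul, transpose_map, scaleMat_map_eval_zero one_ne_zero hb,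
        scaleMat_map_eval_zero two_ne_zero hb, hb']
      simp
  | limit U E h ih =>
    have := Reach.limit (a.map Polynomial.C * U) E fun z hz => by
      convert ih z hz using 1
      rw [map_eval_mul]
      congr 1
      ext; simp
    convert this using 1
    rw [map_eval_mul]
    congr 1
    ext; simp

/-- The ideal of polynomials vanishing at all pairs `(X, T)` of dually diagonal symmetric matrices
with product zero. -/
def VanishesOnDiagPairs (L : Type) [Field L] [Algebra k L] (f : MvPolynomial (PairVar n) k) :
    Prop := ∀ X T : Matrix (Fin n) (Fin n) L, DiagPair X T → aeval (pairPoint X T) f = 0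

lemma VanishesOnDiagPairs.aeval_coeff_eq_zero [Infinite L] {f : MvPolynomial (PairVar n) k}
    (hf : VanishesOnDiagPairs L f) {D : ℕ} (hD : (weightScale (minWeight n) f).natDegree ≤ D)
    {U E : Matrix (Fin n) (Fin n) L} (h : Reach U E) :
    aeval (pairPoint U E) ((weightScale (minWeight n) f).coeff D) = 0 := by
  induction h with
  | curve U E h =>
    let F : Polynomial L := ∑ j ∈ Finset.range (D + 1),
      aeval (pairPoint U E) ((weightScale (minWeight n) f).coeff j) * Polynomial.X ^ (D - j)
    have hF : ∀ z, F.eval z = ∑ j ∈ Finset.range (D + 1),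
        aeval (pairPoint (U.map (Polynomial.eval z)) (E.map (Polynomial.eval z)))
          ((weightScale (minWeight n) f).coeff j) * z ^ (D - j) := by
      intro z
      simp [F, Polynomial.eval_finsetSum, eval_aeval_pairPoint]
    have h0 := F.eval_zero_of_eval_ne_zero fun z hz => by
      have h1 := hf _ _ (h z⁻¹ (inv_ne_zero hz))
      rw [inv_inv] at h1
      have h2 : pairPoint (powDiag n z⁻¹ * U.map (Polynomial.eval z))
          (E.map (Polynomial.eval z) * powDiag n z⁻¹) = fun s => z⁻¹ ^ minWeight n s *
            pairPoint (U.map (Polynomial.eval z)) (E.map (Polynomial.eval z)) s := by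
        ext (s | s)
        · simp [pairPoint, minWeight, powDiag, mul_comm]
        · simp [pairPoint, minWeight, powDiag]
      rw [h2, aeval_scaled_point _ _ D hD] at h1
      rw [hF]
      have h3 := congrArg (fun x => z ^ D * x) h1
      simp only [mul_zero, Finset.mul_sum] at h3
      rw [← h3]
      refine Finset.sum_congr rfl fun j hj => ?_
      have hj' : j ≤ D := Nat.lt_succ_iff.1 (Finset.mem_range.1 hj)
      have h4 : z ^ D * z⁻¹ ^ j = z ^ (D - j) := by
        rw [inv_pow, pow_sub₀ _ hz hj']
      rw [← h4]
      ring
    rw [hF, Finset.sum_range_succ, Finset.sum_eq_zero] at h0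
    · simpa using h0
    · intro j hj
      rw [zero_pow, mul_zero]
      have := Finset.mem_range.1 hj
      omega
  | limit U E h ih =>
    rw [← eval_aeval_pairPoint]
    refine Polynomial.eval_zero_of_eval_ne_zero _ fun z hz => ?_
    rw [eval_aeval_pairPoint]
    exact ih z hz

lemma exists_dual_bases {ι₁ ι₂ : Type} [Fintype ι₁] [Fintype ι₂] [DecidableEq ι₁]
    [DecidableEq ι₂]
    (u : ι₁ → Fin n → L) (e : ι₂ → Fin n → L) (hu : LinearIndependent L u)
    (he : LinearIndependent L e) (hue : ∀ i j, u i ⬝ᵥ e j = 0) (D : ι₁ → L) (D' : ι₂ → L) :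
    DiagPair ((Matrix.of u)ᵀ * diagonal D * Matrix.of u)
      ((Matrix.of e)ᵀ * diagonal D' * Matrix.of e) := by
  classical
  let φ : (Fin n → L) →ₗ[L] (ι₁ → L) := (Matrix.of u).mulVecLin
  have hφ : Function.Surjective φ := by
    have h1 : (Matrix.of u).rank = Fintype.card ι₁ := LinearIndependent.rank_matrix hu
    rw [← LinearMap.range_eq_top]
    apply Submodule.eq_top_of_finrank_eq
    rw [Module.finrank_fintype_fun_eq_card]
    exact h1
  obtain ⟨σ, hσ⟩ := φ.exists_rightInverse_of_surjective (LinearMap.range_eq_top.2 hφ)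
  have hσ' : ∀ x, φ (σ x) = x := fun x => DFunLike.congr_fun hσ x
  let ψ : (Fin n → L) ≃ₗ[L] (ι₁ → L) × LinearMap.ker φ :=
    LinearEquiv.ofLinearMap (φ.prod ((LinearMap.id - σ.comp φ).codRestrict _ fun x => by
        simp [hσ']))
      (LinearMap.coprod σ (LinearMap.ker φ).subtype) (by
        ext x <;> simp [hσ']) (by
        ext x; simp)
  let e' : ι₂ → LinearMap.ker φ := fun j => ⟨e j, by
    ext i; exact hue i j⟩
  have he' : LinearIndependent L e' :=
    LinearIndependent.of_comp (LinearMap.ker φ).subtype he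
  let b := Module.Basis.sumExtend he'
  have hfin : Finite (ι₂ ⊕ Module.Basis.sumExtendIndex he') := Module.Finite.finite_basis b
  have hfin' : Finite (Module.Basis.sumExtendIndex he') := Finite.sum_right ι₂
  let hfin'' : Fintype (Module.Basis.sumExtendIndex he') := Fintype.ofFinite _
  have hb : ∀ j, b (Sum.inl j) = e' j := fun j => by
    simp [b, Module.Basis.sumExtend]
    rfl
  let B := ((Pi.basisFun L ι₁).prod b).map ψ.symm
  refine ⟨ι₁ ⊕ (ι₂ ⊕ Module.Basis.sumExtendIndex he'), inferInstance, inferInstance,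
    B.toMatrix (Pi.basisFun L (Fin n)), (Pi.basisFun L (Fin n)).toMatrix B,
    Sum.elim D fun _ => 0, Sum.elim (fun _ => 0) (Sum.elim D' fun _ => 0),
    B.toMatrix_mul_toMatrix_flip _, Module.Basis.toMatrix_mul_toMatrix_flip _ _, ?_, ?_, ?_⟩
  · rintro (i | i) <;> simp
  · have h1 : ∀ i j, B.toMatrix (Pi.basisFun L (Fin n)) (Sum.inl i) j = u i j := by
      intro i j
      simp [B, ψ, φ, Module.Basis.toMatrix_apply]
    ext i j
    rw [Matrix.mul_apply, Matrix.mul_apply]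
    simp [Matrix.mul_diagonal, Fintype.sum_sum_type, h1]
  · have h1 : ∀ i j, (Pi.basisFun L (Fin n)).toMatrix B i (Sum.inr (Sum.inl j)) = e j i := by
      intro i j
      simp [B, ψ, Module.Basis.toMatrix_apply, hb, e']
    ext i j
    rw [Matrix.mul_apply, Matrix.mul_apply]
    simp [Matrix.mul_diagonal, Fintype.sum_sum_type, h1]

end Degeneration

section TriangularPairs

open MvPolynomial

variable {n : ℕ} {k : Type*} {L : Type} [CommRing k] [Field L] [Algebra k L]

lemma Matrix.BlockTriangular.linearIndependent_rows_subtype {U : Matrix (Fin n) (Fin n) L}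
    (hU : U.BlockTriangular id) : LinearIndependent L fun i : {i // U i i ≠ 0} => U i := by
  classical
  let U' : Matrix (Fin n) (Fin n) L :=
    Matrix.of fun i => if U i i ≠ 0 then U i else Pi.single i 1
  have hU' : U'.BlockTriangular id := by
    intro i j hij
    have hij' : j < i := hij
    by_cases h : U i i = 0
    · simp [U', h, hij'.ne]
    · simp only [U', of_apply, ne_eq, h, not_false_eq_true, if_true]
      exact hU hij
  have hdet : U'.det ≠ 0 := by
    rw [det_of_isUpperTriangular hU', Finset.prod_ne_zero_iff]
    intro i _
    by_cases h : U i i = 0 <;> simp [U', h]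
  have h1 := (linearIndependent_rows_of_det_ne_zero hdet).comp
    (Subtype.val : {i // U i i ≠ 0} → Fin n) Subtype.val_injective
  have h2 : (fun i : {i // U i i ≠ 0} => U i) = (fun i => U' i) ∘ Subtype.val := by
    funext i
    exact (if_pos i.2).symm
  rw [h2]
  exact h1

lemma sum_diagonal_subtype {U : Matrix (Fin n) (Fin n) L} {p : Fin n → Prop} [DecidablePred p]
    (D : Fin n → L) (hD : ∀ i, ¬ p i → D i = 0) :
    Uᵀ * diagonal D * U = (Matrix.of fun i : {i // p i} => U i)ᵀ *
      diagonal (fun i : {i // p i} => D i) * Matrix.of fun i : {i // p i} => U i := by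
  ext a b
  rw [Matrix.mul_apply, Matrix.mul_apply]
  simp only [mul_diagonal, transpose_apply, of_apply]
  rw [← Fintype.sum_subtype_add_sum_subtype p fun i => U i a * D i * U i b]
  rw [add_eq_left]
  exact Finset.sum_eq_zero fun i _ => by simp [hD i i.2]

lemma map_C_map_eval (M : Matrix (Fin n) (Fin n) L) (z : L) :
    (M.map Polynomial.C).map (Polynomial.eval z) = M := by
  ext
  exact Polynomial.eval_C

lemma reach_of_rows_columns {U E : Matrix (Fin n) (Fin n) L} (hU : U.BlockTriangular id)
    (hE : Eᵀ.BlockTriangular id) (hUE : U * E = 0) (hU0 : ∀ i, U i i = 0 → U i = 0)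
    (hE0 : ∀ i, E i i = 0 → Eᵀ i = 0) : Reach U E := by
  classical
  let δ : Fin n → L := fun i => (U i i)⁻¹
  let δ' : Fin n → L := fun i => (E i i)⁻¹
  have := Reach.curve ((scaleMat 1 U)ᵀ * (diagonal δ).map Polynomial.C * U.map Polynomial.C)
    (E.map Polynomial.C * (diagonal δ').map Polynomial.C * scaleMat 1 Eᵀ) fun c hc => by
      have hcc : c * c⁻¹ = 1 := mul_inv_cancel₀ hc
      have key := exists_dual_bases (fun i : {i // U i i ≠ 0} => U i)
        (fun i : {i // Eᵀ i i ≠ 0} => Eᵀ i) hU.linearIndependent_rows_subtype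
        hE.linearIndependent_rows_subtype (fun i j => congrFun (congrFun hUE i) j)
        (fun i => c ^ (i : ℕ) * δ i) fun i => δ' i * c ^ (i : ℕ)
      rw [← sum_diagonal_subtype (fun i => c ^ (i : ℕ) * δ i) fun i hi => by
          simp [δ, not_not.1 hi],
        ← sum_diagonal_subtype (fun i => δ' i * c ^ (i : ℕ)) fun i hi => by
          have : E i i = 0 := not_not.1 hi
          simp [δ', this]] at key
      convert key using 1
      · rw [map_eval_mul, map_eval_mul, transpose_map, scaleMat_map_eval_inv 1 hU hc,
          map_C_map_eval, map_C_map_eval,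
          pow_one, pow_one, ← diagonal_mul_diagonal, transpose_mul, transpose_mul]
        have h3 : (powDiag n c⁻¹)ᵀ = powDiag n c⁻¹ := diagonal_transpose _
        have h4 : (powDiag n c)ᵀ = powDiag n c := diagonal_transpose _
        rw [h3, h4, ← Matrix.mul_assoc, ← Matrix.mul_assoc, ← Matrix.mul_assoc, powDiag_mul, hcc,
          powDiag_one, Matrix.one_mul]
        simp only [Matrix.mul_assoc]
        rfl
      · rw [map_eval_mul, map_eval_mul, scaleMat_map_eval_inv 1 hE hc, map_C_map_eval,
          map_C_map_eval,
          pow_one, pow_one, ← diagonal_mul_diagonal, transpose_transpose]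
        simp only [Matrix.mul_assoc]
        rw [powDiag_mul, mul_comm c⁻¹, hcc, powDiag_one, Matrix.mul_one]
        rfl
  convert this using 1
  · rw [map_eval_mul, map_eval_mul, transpose_map, scaleMat_map_eval_zero one_ne_zero hU,
      map_C_map_eval, map_C_map_eval]
    ext i j
    by_cases h : U i i = 0
    · simp [hU0 i h]
    · simp [δ, h]
  · rw [map_eval_mul, map_eval_mul, scaleMat_map_eval_zero one_ne_zero hE, map_C_map_eval,
      map_C_map_eval]
    ext i j
    by_cases h : E j j = 0
    · have : E i j = 0 := congrFun (hE0 j h) i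
      simp [this]
    · simp [δ', h]

lemma one_add_vecMulVec_mul_one_sub {i : Fin n} {η : Fin n → L} (hη : η i = 0) :
    (1 + vecMulVec η (Pi.single i 1)) * (1 - vecMulVec η (Pi.single i 1)) =
      (1 : Matrix (Fin n) (Fin n) L) := by
  have : vecMulVec η (Pi.single i (1 : L)) * vecMulVec η (Pi.single i 1) = 0 := by
    rw [vecMulVec_mul_vecMulVec]
    simp [hη]
  rw [add_mul, mul_sub, mul_sub, this]
  simp

lemma exists_dotProduct_eq_one {U : Matrix (Fin n) (Fin n) L} (hU : U.BlockTriangular id)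
    {i : Fin n} (h0 : U i i = 0) (h : U i ∉ Submodule.span L (U '' Set.Ioi i)) :
    ∃ η : Fin n → L, (∀ l ≤ i, η l = 0) ∧ U i ⬝ᵥ η = 1 ∧ ∀ l, i < l → U l ⬝ᵥ η = 0 := by
  obtain ⟨f, hf, hf'⟩ := Submodule.exists_le_ker_of_notMem h
  let η : Fin n → L := fun l => if l ≤ i then 0 else (f (U i))⁻¹ * f (Pi.single l 1)
  have hη : ∀ v : Fin n → L, (∀ l ≤ i, v l = 0) → v ⬝ᵥ η = (f (U i))⁻¹ * f v := by
    intro v hv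
    have h1 : f v = ∑ l, v l * f (Pi.single l 1) := by
      conv_lhs => rw [← Finset.univ_sum_single v]
      rw [map_sum]
      refine Finset.sum_congr rfl fun l _ => ?_
      rw [← smul_eq_mul, ← map_smul, ← Pi.single_smul, smul_eq_mul, mul_one]
    rw [h1, dotProduct, Finset.mul_sum]
    refine Finset.sum_congr rfl fun l _ => ?_
    by_cases hl : l ≤ i
    · simp [hv l hl]
    · simp [η, hl]
      ring
  have hrow : ∀ l, i < l → ∀ j ≤ i, U l j = 0 := fun l hl j hj => hU (hj.trans_lt hl)
  refine ⟨η, fun l hl => by simp [η, hl], ?_, fun l hl => ?_⟩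
  · rw [hη, inv_mul_cancel₀ hf]
    intro l hl
    rcases hl.lt_or_eq with h' | rfl
    · exact hU h'
    · exact h0
  · rw [hη _ (hrow l hl)]
    have : f (U l) = 0 := hf' (Submodule.subset_span ⟨l, hl, rfl⟩)
    rw [this, mul_zero]

/-- The row with index `i` of `U` vanishes or has nonzero diagonal entry. -/
def RowDone (U : Matrix (Fin n) (Fin n) L) (i : Fin n) : Prop := U i i ≠ 0 ∨ U i = 0

lemma reach_of_row_step {U E : Matrix (Fin n) (Fin n) L} (hU : U.BlockTriangular id)
    (hE : Eᵀ.BlockTriangular id) (hUE : U * E = 0) {i : Fin n} (hi : ¬ RowDone U i)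
    (ih : ∀ U' E' : Matrix (Fin n) (Fin n) L, U'.BlockTriangular id → E'ᵀ.BlockTriangular id →
      U' * E' = 0 → RowDone U' i → (∀ l, RowDone U l → RowDone U' l) →
      (∀ l, RowDone Eᵀ l → RowDone E'ᵀ l) → Reach U' E') : Reach U E := by
  classical
  have h0 : U i i = 0 := by
    by_contra h
    exact hi (Or.inl h)
  by_cases h : U i ∈ Submodule.span L (U '' Set.Ioi i)
  · obtain ⟨c, hc, hcU⟩ := (Finsupp.mem_span_image_iff_linearCombination L).1 h
    have hc0 : ∀ l ≤ i, c l = 0 := fun l hl => by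
      by_contra h1
      exact absurd (hc (Finsupp.mem_support_iff.2 h1)) (not_lt.2 hl)
    have hcU' : ⇑c ᵥ* U = U i := by
      have hcU' : (Finsupp.linearCombination L fun l => U l) c = U i := hcU
      rw [Finsupp.linearCombination_apply, Finsupp.sum_fintype _ _ (by simp)] at hcU'
      ext j
      rw [← hcU']
      simp [vecMul, dotProduct]
    let m : Matrix (Fin n) (Fin n) L := vecMulVec (Pi.single i 1) c
    have hm : ∀ a b, b ≤ a → m a b = 0 := by
      intro a b hab
      by_cases ha : a = i
      · simp [m, vecMulVec_apply, hc0 b (ha ▸ hab)]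
      · simp [m, vecMulVec_apply, ha]
    have hmm : m * m = 0 := by
      rw [vecMulVec_mul_vecMulVec]
      simp [hc0 i le_rfl]
    have hmU : ∀ a, (m * U) a = if a = i then U i else 0 := by
      intro a
      rw [vecMulVec_mul, hcU']
      ext b
      by_cases ha : a = i <;> simp [vecMulVec_apply, ha]
    have hab : (1 + m) * (1 - m) = 1 := by
      rw [add_mul, mul_sub, mul_sub, hmm]
      simp
    have hU' : ∀ a, ((1 - m) * U) a = if a = i then 0 else U a := by
      intro a
      rw [sub_mul, Matrix.one_mul]
      ext b
      rw [Matrix.sub_apply, hmU]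
      by_cases ha : a = i
      · simp [ha]
      · simp [ha]
    have key := (ih ((1 - m) * U) E ?_ hE ?_ ?_ ?_ fun _ h => h).unitriangular_mul
      (a := 1 + m) (b := 1 - m) ?_ ?_ ?_ ?_ hab
    · rwa [← Matrix.mul_assoc, hab, Matrix.one_mul] at key
    · intro a b hba
      rw [hU']
      split_ifs
      · rfl
      · exact hU hba
    · rw [Matrix.mul_assoc, hUE, Matrix.mul_zero]
    · right
      rw [hU', if_pos rfl]
    · intro l hl
      by_cases hli : l = i
      · right
        rw [hU', if_pos hli]
      · unfold RowDone
        rwa [hU', if_neg hli]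
    · exact blockTriangular_one.add fun a b hab => hm a b (le_of_lt hab)
    · exact blockTriangular_one.sub fun a b hab => hm a b (le_of_lt hab)
    · ext a
      simp [hm a a le_rfl]
    · ext a
      simp [hm a a le_rfl]
  · obtain ⟨η, hη, hηi, hηl⟩ := exists_dotProduct_eq_one hU h0 h
    have hηi0 : η i = 0 := hη i le_rfl
    have hU' : ∀ z : L, U * (1 + vecMulVec (z • η) (Pi.single i 1)) =
        U + vecMulVec (U *ᵥ (z • η)) (Pi.single i 1) := fun z => by
      rw [mul_add, Matrix.mul_one, mul_vecMulVec]
    have hE' : ∀ z : L, (1 - vecMulVec (z • η) (Pi.single i 1)) * E =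
        E - vecMulVec (z • η) (E i) := fun z => by
      rw [sub_mul, Matrix.one_mul, vecMulVec_mul, single_one_vecMul]
      rfl
    let Uz : Matrix (Fin n) (Fin n) (Polynomial L) := U.map Polynomial.C +
      vecMulVec ((Polynomial.X : Polynomial L) • (fun l => Polynomial.C ((U *ᵥ η) l)))
        (Pi.single i 1)
    let Ez : Matrix (Fin n) (Fin n) (Polynomial L) := E.map Polynomial.C -
      vecMulVec ((Polynomial.X : Polynomial L) • (fun l => Polynomial.C (η l)))
        (fun l => Polynomial.C (E i l))
    have h1 : ∀ z : L, Uz.map (Polynomial.eval z) =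
        U * (1 + vecMulVec (z • η) (Pi.single i 1)) := fun z => by
      rw [hU', mulVec_smul]
      ext a b
      by_cases hb : b = i
      · simp only [Uz, vecMulVec_apply, hb, map_apply, Matrix.add_apply, Pi.smul_apply,
          smul_eq_mul, Pi.single_eq_same, mul_one, Polynomial.eval_add, Polynomial.eval_mul,
          Polynomial.eval_X, Polynomial.eval_C]
      · simp [Uz, vecMulVec_apply, hb]
    have h2 : ∀ z : L, Ez.map (Polynomial.eval z) =
        (1 - vecMulVec (z • η) (Pi.single i 1)) * E := fun z => by
      rw [hE']
      ext a b
      simp [Ez, vecMulVec_apply]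
    have := Reach.limit Uz Ez fun z hz => by
        rw [h1, h2]
        have hUz : ∀ a b, (U * (1 + vecMulVec (z • η) (Pi.single i 1))) a b =
            U a b + (if b = i then z * (U a ⬝ᵥ η) else 0) := by
          intro a b
          rw [hU', mulVec_smul]
          by_cases hb : b = i <;> simp [vecMulVec_apply, hb, mulVec]
        have hEz : ∀ a b, ((1 - vecMulVec (z • η) (Pi.single i 1)) * E) a b =
            E a b - z * η a * E i b := by
          intro a b
          rw [hE']
          simp [vecMulVec_apply, mul_assoc]
        refine ih _ _ ?_ ?_ ?_ ?_ ?_ ?_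
        · intro a b hab
          have hab' : b < a := hab
          rw [hUz, hU hab, zero_add]
          split_ifs with hb
          · rw [hηl a (hb ▸ hab'), mul_zero]
          · rfl
        · intro a b hab
          have hab' : b < a := hab
          rw [transpose_apply, hEz]
          have h3 : E b a = 0 := hE hab
          rw [h3]
          by_cases hb : b ≤ i
          · rw [hη b hb]
            ring
          · have h4 : E i a = 0 := hE ((not_le.1 hb).trans hab')
            rw [h4]
            ring
        · calc _ = U * ((1 + vecMulVec (z • η) (Pi.single i 1)) *
              (1 - vecMulVec (z • η) (Pi.single i 1))) * E := by simp only [Matrix.mul_assoc]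
            _ = 0 := by
              rw [one_add_vecMulVec_mul_one_sub (by simp [hηi0]), Matrix.mul_one, hUE]
        · left
          rw [hUz, h0]
          simp [hηi, hz]
        · rintro l (hl | hl)
          · left
            rw [hUz]
            by_cases hli : l = i
            · subst hli
              exact absurd h0 hl
            · simpa [hli] using hl
          · right
            ext b
            rw [hUz, hl]
            simp
        · rintro l (hl | hl)
          · left
            rw [transpose_apply, hEz]
            by_cases hli : l ≤ i
            · rw [hη l hli]
              simpa using hl
            · have h4 : E i l = 0 := hE (not_le.1 hli)
              rw [h4]
              simpa using hl
          · right
            ext b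
            have h5 : ∀ a, E a l = 0 := fun a => congrFun hl a
            rw [transpose_apply, hEz, h5, h5]
            simp
    rw [h1, h2] at this
    simpa using this

theorem reach_of_triangular {U E : Matrix (Fin n) (Fin n) L} (hU : U.BlockTriangular id)
    (hE : Eᵀ.BlockTriangular id) (hUE : U * E = 0) : Reach U E := by
  classical
  induction hN : (Finset.univ.filter fun i => ¬ RowDone U i).card +
    (Finset.univ.filter fun i => ¬ RowDone Eᵀ i).card using Nat.strong_induction_on
    generalizing U E with
  | _ N ih =>
    by_cases h : ∀ i, RowDone U i
    · by_cases h' : ∀ i, RowDone Eᵀ i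
      · exact reach_of_rows_columns hU hE hUE (fun i hi => (h i).resolve_left (not_not.2 hi))
          fun i hi => (h' i).resolve_left (not_not.2 hi)
      · push Not at h'
        obtain ⟨i, hi⟩ := h'
        refine (reach_of_row_step (U := Eᵀ) (E := Uᵀ) hE hU
          (by rw [← transpose_mul, hUE, transpose_zero]) hi ?_).swap
        intro U' E' hU' hE' hUE' hi' hl hl'
        refine ih _ ?_ hU' hE' hUE' rfl
        rw [← hN, add_comm]
        refine add_lt_add_of_le_of_lt (Finset.card_le_card ?_) (Finset.card_lt_card ?_)
        · exact Finset.monotone_filter_right _ fun l _ h2 h3 => h2 (hl' l h3)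
        · refine ⟨Finset.monotone_filter_right _ fun l _ h2 h3 => h2 (hl l h3), fun hs => ?_⟩
          exact (Finset.mem_filter.1 (hs (Finset.mem_filter.2 ⟨Finset.mem_univ i, hi⟩))).2 hi'
    · push Not at h
      obtain ⟨i, hi⟩ := h
      refine reach_of_row_step hU hE hUE hi ?_
      intro U' E' hU' hE' hUE' hi' hl hl'
      refine ih _ ?_ hU' hE' hUE' rfl
      rw [← hN]
      refine add_lt_add_of_lt_of_le (Finset.card_lt_card ?_) (Finset.card_le_card ?_)
      · refine ⟨Finset.monotone_filter_right _ fun l _ h2 h3 => h2 (hl l h3), fun hs => ?_⟩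
        exact (Finset.mem_filter.1 (hs (Finset.mem_filter.2 ⟨Finset.mem_univ i, hi⟩))).2 hi'
      · exact Finset.monotone_filter_right _ fun l _ h2 h3 => h2 (hl' l h3)

end TriangularPairs

section SymmetricProduct

open MvPolynomial

variable {n : ℕ} {k : Type*} [CommRing k]

/-- The generic symmetric matrix in the variables `Sum.inr`. -/
noncomputable def genX (n : ℕ) (k : Type*) [CommRing k] :
    Matrix (Fin n) (Fin n) (MvPolynomial (PairVar n) k) := symMat fun s => X (Sum.inr s)

/-- The generic symmetric matrix in the variables `Sum.inl`. -/
noncomputable def genT (n : ℕ) (k : Type*) [CommRing k] :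
    Matrix (Fin n) (Fin n) (MvPolynomial (PairVar n) k) := symMat fun s => X (Sum.inl s)

lemma weightScale_minWeight_mul_X (i l j : Fin n) :
    weightScale (minWeight n) (X (Sum.inr s(i, l)) * X (Sum.inl s(l, j)) :
      MvPolynomial (PairVar n) k) =
    Polynomial.C (X (Sum.inr s(i, l)) * X (Sum.inl s(l, j))) *
      Polynomial.X ^ ((i ⊓ l : Fin n) + (l ⊓ j : Fin n) : ℕ) := by
  rw [map_mul, weightScale_X, weightScale_X, map_mul, pow_add]
  simp only [minWeight, Sum.elim_inl, Sum.elim_inr, Sym2.inf_mk]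
  ring

lemma hasTop_weightScale_mul_apply (i j : Fin n) :
    Polynomial.HasTop ((i : ℕ) + j) ((upperMat (fun s => X (Sum.inr s)) *
        lowerMat fun s => X (Sum.inl s) : Matrix _ _ (MvPolynomial (PairVar n) k)) i j)
      (weightScale (minWeight n) ((genX n k * genT n k) i j)) := by
  constructor
  · rw [Matrix.mul_apply, map_sum]
    refine Polynomial.natDegree_sum_le_of_forall_le _ _ fun l _ => ?_
    rw [genX, genT, symMat, symMat, of_apply, of_apply, weightScale_minWeight_mul_X]
    refine (Polynomial.natDegree_C_mul_X_pow_le _ _).trans ?_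
    have h1 : ((i ⊓ l : Fin n) : ℕ) ≤ i := inf_le_left (a := i)
    have h2 : ((l ⊓ j : Fin n) : ℕ) ≤ j := inf_le_right (b := j)
    omega
  · rw [Matrix.mul_apply, map_sum, Matrix.mul_apply, Polynomial.finsetSum_coeff]
    refine Finset.sum_congr rfl fun l _ => ?_
    rw [genX, genT, symMat, symMat, of_apply, of_apply, weightScale_minWeight_mul_X,
      Polynomial.coeff_C_mul_X_pow, upperMat, lowerMat, of_apply, of_apply]
    have h1 : ((i ⊓ l : Fin n) : ℕ) ≤ i := inf_le_left (a := i)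
    have h2 : ((l ⊓ j : Fin n) : ℕ) ≤ j := inf_le_right (b := j)
    by_cases hi : i ≤ l
    · by_cases hj : j ≤ l
      · simp [hi, hj]
      · have h3 : ((l ⊓ j : Fin n) : ℕ) < j := by
          rw [inf_eq_left.2 (not_le.1 hj).le]
          exact not_le.1 hj
        rw [if_neg (by omega), if_neg hj, mul_zero]
    · have h3 : ((i ⊓ l : Fin n) : ℕ) < i := by
        rw [inf_eq_right.2 (not_le.1 hi).le]
        exact not_le.1 hi
      rw [if_neg (by omega), if_neg hi, zero_mul]

lemma weightScale_upper_mul_lower (i j : Fin n) :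
    weightScale (minWeight n) ((upperMat (fun s => X (Sum.inr s)) *
        lowerMat fun s => X (Sum.inl s) : Matrix _ _ (MvPolynomial (PairVar n) k)) i j) =
      Polynomial.C ((upperMat (fun s => X (Sum.inr s)) *
        lowerMat fun s => X (Sum.inl s) : Matrix _ _ (MvPolynomial (PairVar n) k)) i j) *
      Polynomial.X ^ ((i : ℕ) + j) := by
  rw [Matrix.mul_apply, map_sum, map_sum, Finset.sum_mul]
  refine Finset.sum_congr rfl fun l _ => ?_
  rw [upperMat, lowerMat, of_apply, of_apply]
  by_cases hi : i ≤ l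
  · by_cases hj : j ≤ l
    · rw [if_pos hi, if_pos hj, weightScale_minWeight_mul_X, inf_eq_left.2 hi, inf_eq_right.2 hj]
    · simp [hj]
  · simp [hi]

lemma weightScale_coeff {V : Type*} (w : V → ℕ) (f : MvPolynomial V k) (D : ℕ) :
    weightScale w ((weightScale w f).coeff D) =
      Polynomial.C ((weightScale w f).coeff D) * Polynomial.X ^ D := by
  ext e m
  rw [coeff_coeff_weightScale, Polynomial.coeff_C_mul_X_pow, coeff_coeff_weightScale]
  split_ifs with h1 h2 h2 h2 <;> simp_all [coeff_coeff_weightScale]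

lemma pairPoint_eq {R : Type*} [Zero R] (x : PairVar n → R) :
    pairPoint (upperMat fun s => x (Sum.inr s)) (lowerMat fun s => x (Sum.inl s)) = x := by
  ext (s | s) <;> induction s using Sym2.ind with | _ i j => ?_ <;>
    rcases le_total i j with h | h <;> simp [pairPoint, upperMat, lowerMat, h, Sym2.eq_swap]

lemma DiagPair.mul_eq_zero {L : Type} [Field L] {X T : Matrix (Fin n) (Fin n) L}
    (h : DiagPair X T) : X * T = 0 := by
  obtain ⟨ι, _, _, P, Q, D, D', hPQ, hQP, hD, rfl, rfl⟩ := h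
  have : diagonal D * diagonal D' = 0 := by
    rw [diagonal_mul_diagonal]
    ext i j
    by_cases hij : i = j <;> simp [hij, hD]
  calc _ = Pᵀ * (diagonal D * (P * Q) * diagonal D') * Qᵀ := by simp only [Matrix.mul_assoc]
    _ = 0 := by rw [hPQ, Matrix.mul_one, this]; simp

lemma aeval_pairPoint_genX_mul_genT {L : Type} [Field L] [Algebra k L]
    {X T : Matrix (Fin n) (Fin n) L} (hX : Xᵀ = X) (hT : Tᵀ = T) (i j : Fin n) :
    aeval (pairPoint X T) ((genX n k * genT n k) i j) = (X * T) i j := by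
  have hX' : ∀ a b, X (s(a, b)).inf (s(a, b)).sup = X a b := fun a b => by
    rcases le_total a b with h | h
    · simp [h]
    · simp only [Sym2.inf_mk, Sym2.sup_mk, inf_eq_right.2 h, sup_eq_left.2 h]
      exact congrFun (congrFun hX a) b
  have hT' : ∀ a b, T (s(a, b)).sup (s(a, b)).inf = T a b := fun a b => by
    rcases le_total a b with h | h
    · simp only [Sym2.inf_mk, Sym2.sup_mk, inf_eq_left.2 h, sup_eq_right.2 h]
      exact congrFun (congrFun hT a) b
    · simp [h]
  simp only [Matrix.mul_apply, map_sum, map_mul, genX, genT, symMat, of_apply, aeval_X, pairPoint,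
    Sum.elim_inl, Sum.elim_inr, hX', hT']

theorem mem_entryIdeal_of_vanishesOnDiagPairs (p : ℕ) [Fact p.Prime]
    {f : MvPolynomial (PairVar n) (ZMod p)}
    (hf : VanishesOnDiagPairs (AlgebraicClosure (ZMod p)) f) :
    f ∈ entryIdeal (genX n (ZMod p) * genT n (ZMod p)) := by
  suffices ∀ D : ℕ, ∀ f : MvPolynomial (PairVar n) (ZMod p),
      (∀ j, D ≤ j → (weightScale (minWeight n) f).coeff j = 0) →
      VanishesOnDiagPairs (AlgebraicClosure (ZMod p)) f →
      f ∈ entryIdeal (genX n (ZMod p) * genT n (ZMod p)) by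
    refine this ((weightScale (minWeight n) f).natDegree + 1) f (fun j hj => ?_) hf
    exact Polynomial.coeff_eq_zero_of_natDegree_lt hj
  clear f hf
  intro D
  induction D with
  | zero =>
    intro f hf _
    have : f = 0 := by
      ext m
      have h1 := coeff_coeff_weightScale (minWeight n) f m (Finsupp.weight (minWeight n) m)
      rw [if_pos rfl, hf _ (Nat.zero_le _)] at h1
      rw [← h1]
    rw [this]
    exact zero_mem _
  | succ D ih =>
    intro f hD hf
    have hdeg : (weightScale (minWeight n) f).natDegree ≤ D :=
      Polynomial.natDegree_le_iff_coeff_eq_zero.2 fun N hN => hD N hN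
    set g := (weightScale (minWeight n) f).coeff D with hg
    have hgI : g ∈ triangularIdeal n (ZMod p) := by
      rw [← (triangularIdeal_isRadical (n := n) p).radical,
        ← vanishingIdeal_zeroLocus_eq_radical (K := AlgebraicClosure (ZMod p)),
        mem_vanishingIdeal_iff]
      intro x hx
      have h1 : (upperMat fun s => x (Sum.inr s)) * (lowerMat fun s => x (Sum.inl s)) = 0 := by
        ext i j
        have h2 := hx _ (mem_entryIdeal _ i j)
        rw [Matrix.mul_apply, map_sum] at h2
        rw [Matrix.mul_apply, Matrix.zero_apply, ← h2]
        refine Finset.sum_congr rfl fun l _ => ?_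
        simp only [upperMat, lowerMat, of_apply, map_mul]
        congr 1 <;> split_ifs <;> simp
      have h2 := hf.aeval_coeff_eq_zero hdeg (reach_of_triangular (fun i j hij => ?_)
        (fun i j hij => ?_) h1)
      · rwa [pairPoint_eq] at h2
      · exact if_neg (not_le.2 hij)
      · exact if_neg (not_le.2 hij)
    obtain ⟨h, hh⟩ := (Ideal.mem_span_range_iff_exists_fun).1 hgI
    let h' : Fin n × Fin n → MvPolynomial (PairVar n) (ZMod p) := fun q =>
      if (q.1 : ℕ) + q.2 ≤ D then (weightScale (minWeight n) (h q)).coeff (D - (q.1 + q.2)) else 0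
    have hH : ∀ q, Polynomial.HasTop D (h' q * (upperMat (fun s => X (Sum.inr s)) *
        lowerMat fun s => X (Sum.inl s) : Matrix _ _ (MvPolynomial (PairVar n) (ZMod p))) q.1 q.2)
        (weightScale (minWeight n) (h' q * (genX n (ZMod p) * genT n (ZMod p)) q.1 q.2)) := by
      intro q
      by_cases hq : (q.1 : ℕ) + q.2 ≤ D
      · have e1 : h' q = (weightScale (minWeight n) (h q)).coeff (D - (q.1 + q.2)) := if_pos hq
        have e2 : Polynomial.HasTop (D - (q.1 + q.2)) (h' q)
            (weightScale (minWeight n) (h' q)) := by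
          rw [e1, weightScale_coeff]
          exact ⟨Polynomial.natDegree_C_mul_X_pow_le _ _, by simp⟩
        have e3 := e2.mul (hasTop_weightScale_mul_apply (k := ZMod p) q.1 q.2)
        rwa [Nat.sub_add_cancel hq, ← map_mul] at e3
      · have e1 : h' q = 0 := if_neg hq
        rw [e1]
        simp [Polynomial.HasTop]
    have hgg : g = ∑ q, h' q * (upperMat (fun s => X (Sum.inr s)) *
        lowerMat fun s => X (Sum.inl s) : Matrix _ _ (MvPolynomial (PairVar n) (ZMod p)))
          q.1 q.2 := by
      have e1 : g = (weightScale (minWeight n) g).coeff D := by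
        rw [hg, weightScale_coeff]
        simp
      rw [e1, ← hh, map_sum, Polynomial.finsetSum_coeff]
      refine Finset.sum_congr rfl fun q _ => ?_
      rw [map_mul, weightScale_upper_mul_lower, ← mul_assoc, Polynomial.coeff_mul_X_pow']
      by_cases hq : (q.1 : ℕ) + q.2 ≤ D
      · simp [h', hq]
      · simp [h', hq]
    have hmem : ∑ q, h' q * (genX n (ZMod p) * genT n (ZMod p)) q.1 q.2 ∈
        entryIdeal (genX n (ZMod p) * genT n (ZMod p)) :=
      Ideal.sum_mem _ fun q _ => Ideal.mul_mem_left _ _ (mem_entryIdeal _ _ _)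
    have hsub : f - ∑ q, h' q * (genX n (ZMod p) * genT n (ZMod p)) q.1 q.2 ∈
        entryIdeal (genX n (ZMod p) * genT n (ZMod p)) := by
      refine ih _ (fun j hj => ?_) fun Y T hYT => ?_
      · rw [map_sub, Polynomial.coeff_sub, map_sum, Polynomial.finsetSum_coeff]
        rcases hj.lt_or_eq with hj | rfl
        · rw [hD j hj, Finset.sum_eq_zero, sub_zero]
          intro q _
          exact Polynomial.coeff_eq_zero_of_natDegree_lt ((hH q).1.trans_lt hj)
        · rw [← hg, hgg, sub_eq_zero]
          exact Finset.sum_congr rfl fun q _ => (hH q).2.symm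
      · rw [map_sub, hf Y T hYT, map_sum, Finset.sum_eq_zero, sub_zero]
        intro q _
        rw [map_mul, aeval_pairPoint_genX_mul_genT hYT.isSymm_left hYT.isSymm_right,
          hYT.mul_eq_zero, Matrix.zero_apply, mul_zero]
    have := add_mem hsub hmem
    rwa [sub_add_cancel] at this

end SymmetricProduct

section HomogeneousIdeals

open MvPolynomial

variable {k V : Type*} [CommRing k] {w : V → ℕ}

/-- `f` is homogeneous of weight `e`. -/
def IsScaled (w : V → ℕ) (e : ℕ) (f : MvPolynomial V k) : Prop :=
  weightScale w f = Polynomial.C f * Polynomial.X ^ e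

lemma IsScaled.mul {e e' : ℕ} {f g : MvPolynomial V k} (hf : IsScaled w e f)
    (hg : IsScaled w e' g) : IsScaled w (e + e') (f * g) := by
  rw [IsScaled, map_mul, hf, hg, map_mul, pow_add]
  ring

lemma IsScaled.pow {e : ℕ} {f : MvPolynomial V k} (hf : IsScaled w e f) (N : ℕ) :
    IsScaled w (e * N) (f ^ N) := by
  rw [IsScaled, map_pow, hf, mul_pow, ← pow_mul, map_pow]

lemma IsScaled.sub {e : ℕ} {f g : MvPolynomial V k} (hf : IsScaled w e f)
    (hg : IsScaled w e g) : IsScaled w e (f - g) := by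
  rw [IsScaled, map_sub, hf, hg, map_sub, sub_mul]

lemma IsScaled.sum {ι : Type*} {s : Finset ι} {e : ℕ} {f : ι → MvPolynomial V k}
    (hf : ∀ i ∈ s, IsScaled w e (f i)) : IsScaled w e (∑ i ∈ s, f i) := by
  rw [IsScaled, map_sum, map_sum, Finset.sum_mul]
  exact Finset.sum_congr rfl hf

lemma isScaled_X (v : V) : IsScaled w (w v) (X v : MvPolynomial V k) := weightScale_X _ _

lemma weightScale_coeff_mem_span {S : Set (MvPolynomial V k)} (hS : ∀ a ∈ S, ∃ e, IsScaled w e a)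
    {f : MvPolynomial V k} (hf : f ∈ Ideal.span S) (d : ℕ) :
    (weightScale w f).coeff d ∈ Ideal.span S := by
  induction hf using Submodule.span_induction generalizing d with
  | mem a ha =>
    obtain ⟨e, he⟩ := hS a ha
    rw [he, Polynomial.coeff_C_mul_X_pow]
    split_ifs
    · exact Ideal.subset_span ha
    · exact zero_mem _
  | zero => simp
  | add x y _ _ hx hy =>
    rw [map_add, Polynomial.coeff_add]
    exact add_mem (hx d) (hy d)
  | smul a x _ hx =>
    rw [smul_eq_mul, map_mul, Polynomial.coeff_mul]
    exact Ideal.sum_mem _ fun q _ => Ideal.mul_mem_left _ _ (hx _)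

lemma eval_one_weightScale (f : MvPolynomial V k) : (weightScale w f).eval 1 = f := by
  have : ((Polynomial.aeval (1 : MvPolynomial V k)).restrictScalars k).comp (weightScale w) =
      AlgHom.id k _ := by
    apply MvPolynomial.algHom_ext
    intro v
    simp [weightScale_X]
  have h := DFunLike.congr_fun this f
  simpa [Polynomial.coe_aeval_eq_eval] using h

lemma mem_of_weightScale_coeff_mem {I : Ideal (MvPolynomial V k)} {f : MvPolynomial V k}
    (h : ∀ d, (weightScale w f).coeff d ∈ I) : f ∈ I := by
  rw [← eval_one_weightScale (w := w) f, Polynomial.eval_eq_sum_range]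
  refine Ideal.sum_mem _ fun d _ => ?_
  rw [one_pow, mul_one]
  exact h d

/-- A homogeneous ideal is closed in the topology of powers of a homogeneous element of positive
weight. -/
lemma mem_of_forall_mem_sup_span_pow {S : Set (MvPolynomial V k)}
    (hS : ∀ a ∈ S, ∃ e, IsScaled w e a) {s : MvPolynomial V k} {e : ℕ} (hs : IsScaled w e s)
    (he : 0 < e) {f : MvPolynomial V k}
    (hf : ∀ N : ℕ, ∃ g, f - s ^ N * g ∈ Ideal.span S) : f ∈ Ideal.span S := by
  refine mem_of_weightScale_coeff_mem (w := w) fun d => ?_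
  obtain ⟨g, hg⟩ := hf (d + 1)
  have h1 := weightScale_coeff_mem_span hS hg d
  have h2 : (weightScale w (s ^ (d + 1) * g)).coeff d = 0 := by
    rw [map_mul, hs.pow, mul_assoc, Polynomial.coeff_C_mul, Polynomial.coeff_X_pow_mul', if_neg,
      mul_zero]
    nlinarith
  rwa [map_sub, Polynomial.coeff_sub, h2, sub_zero] at h1

/-- A polynomial whose term of weight zero is a unit is a nonzerodivisor modulo any homogeneous
ideal. -/
lemma mem_of_mul_mem_of_isUnit_coeff_zero {S : Set (MvPolynomial V k)}
    (hS : ∀ a ∈ S, ∃ e, IsScaled w e a) {r f : MvPolynomial V k}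
    (hr : IsUnit ((weightScale w r).coeff 0)) (hf : r * f ∈ Ideal.span S) :
    f ∈ Ideal.span S := by
  refine mem_of_weightScale_coeff_mem (w := w) fun d => ?_
  induction d using Nat.strong_induction_on with
  | _ d ih =>
    have h1 := weightScale_coeff_mem_span hS hf d
    rw [map_mul, Polynomial.coeff_mul, ← Finset.add_sum_erase _ _
      (Finset.HasAntidiagonal.mem_antidiagonal.2 (zero_add d) :
        (0, d) ∈ Finset.HasAntidiagonal.antidiagonal d)] at h1
    have h2 := (Ideal.add_mem_iff_left _ (Ideal.sum_mem _ fun q hq => ?_)).1 h1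
    · exact (Ideal.unit_mul_mem_iff_mem _ hr).1 h2
    · refine Ideal.mul_mem_left _ _ (ih _ ?_)
      obtain ⟨h3, h4⟩ := Finset.mem_erase.1 hq
      have h5 := Finset.HasAntidiagonal.mem_antidiagonal.1 h4
      rcases Nat.eq_zero_or_pos q.1 with h6 | h6
      · exact absurd (Prod.ext h6 (by simpa [h6] using h5)) h3
      · omega

end HomogeneousIdeals

section ScalarProduct

open MvPolynomial

/-- The ideal expressing that a square matrix is scalar. -/
def scalarIdeal {m R : Type*} [CommRing R] (M : Matrix m m R) : Ideal R :=
  Ideal.span ({x | ∃ i j, i ≠ j ∧ x = M i j} ∪ {x | ∃ i j, x = M i i - M j j})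

variable {n : ℕ} {k : Type*} [CommRing k]

lemma offDiag_mem_scalarIdeal {m R : Type*} [CommRing R] (M : Matrix m m R) {i j : m}
    (h : i ≠ j) : M i j ∈ scalarIdeal M := Ideal.subset_span (Or.inl ⟨i, j, h, rfl⟩)

lemma diag_sub_mem_scalarIdeal {m R : Type*} [CommRing R] (M : Matrix m m R) (i j : m) :
    M i i - M j j ∈ scalarIdeal M := Ideal.subset_span (Or.inr ⟨i, j, rfl⟩)

lemma scalarIdeal_le_iff {m R : Type*} [CommRing R] {M : Matrix m m R} {I : Ideal R} :
    scalarIdeal M ≤ I ↔ (∀ i j, i ≠ j → M i j ∈ I) ∧ ∀ i j, M i i - M j j ∈ I := by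
  rw [scalarIdeal, Ideal.span_le]
  constructor
  · exact fun h => ⟨fun i j hij => h (Or.inl ⟨i, j, hij, rfl⟩), fun i j => h (Or.inr ⟨i, j, rfl⟩)⟩
  · rintro ⟨h1, h2⟩ _ (⟨i, j, hij, rfl⟩ | ⟨i, j, rfl⟩)
    · exact h1 i j hij
    · exact h2 i j

lemma isScaled_genX_mul_genT (i j : Fin n) :
    IsScaled (fun _ => 1) 2 ((genX n k * genT n k) i j) := by
  rw [Matrix.mul_apply]
  refine IsScaled.sum fun l _ => ?_
  rw [genX, genT, symMat, symMat, of_apply, of_apply]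
  exact IsScaled.mul (e := 1) (e' := 1) (isScaled_X (w := fun _ => 1) (Sum.inr s(i, l)))
    (isScaled_X (w := fun _ => 1) (Sum.inl s(l, j)))

lemma isScaled_of_mem_scalarGens (a : MvPolynomial (PairVar n) k)
    (ha : a ∈ ({x | ∃ i j, i ≠ j ∧ x = (genX n k * genT n k) i j} ∪
      {x | ∃ i j, x = (genX n k * genT n k) i i - (genX n k * genT n k) j j} :
        Set (MvPolynomial (PairVar n) k))) : ∃ e, IsScaled (fun _ => 1) e a := by
  rcases ha with ⟨i, j, -, rfl⟩ | ⟨i, j, rfl⟩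
  · exact ⟨2, isScaled_genX_mul_genT _ _⟩
  · exact ⟨2, (isScaled_genX_mul_genT _ _).sub (isScaled_genX_mul_genT _ _)⟩

lemma entryIdeal_le_scalarIdeal_sup {m R : Type*} [CommRing R] (M : Matrix m m R) (i : m) :
    entryIdeal M ≤ scalarIdeal M ⊔ Ideal.span {M i i} := by
  refine Ideal.span_le.2 ?_
  rintro _ ⟨⟨a, b⟩, rfl⟩
  by_cases hab : a = b
  · subst hab
    have h := add_mem (Submodule.mem_sup_left (diag_sub_mem_scalarIdeal M a i))
      (Submodule.mem_sup_right (Ideal.mem_span_singleton_self (M i i)) :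
        M i i ∈ scalarIdeal M ⊔ Ideal.span {M i i})
    simpa using h
  · exact Submodule.mem_sup_left (offDiag_mem_scalarIdeal M hab)

/-- Vanishing at all pairs of symmetric matrices whose product is a nonzero scalar. -/
def VanishesOnInvertible (L : Type) [Field L] [Algebra k L] (f : MvPolynomial (PairVar n) k) :
    Prop := ∀ X T : Matrix (Fin n) (Fin n) L, Xᵀ = X → Tᵀ = T → ∀ z : L, z ≠ 0 →
      X * T = z • (1 : Matrix (Fin n) (Fin n) L) → aeval (pairPoint X T) f = 0

variable {L : Type} [Field L] [Algebra k L]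

lemma VanishesOnInvertible.vanishesOnDiagPairs [Infinite L] {f : MvPolynomial (PairVar n) k}
    (hf : VanishesOnInvertible L f) : VanishesOnDiagPairs L f := by
  classical
  rintro _ _ ⟨ι, _, _, P, Q, D, D', hPQ, hQP, hD, rfl, rfl⟩
  let d : ι → Polynomial L := fun i => if D i = 0 then (if D' i = 0 then Polynomial.X else
    Polynomial.C (D' i)⁻¹ * Polynomial.X ^ 2) else Polynomial.C (D i)
  let d' : ι → Polynomial L := fun i => if D i = 0 then (if D' i = 0 then Polynomial.X else
    Polynomial.C (D' i)) else Polynomial.C (D i)⁻¹ * Polynomial.X ^ 2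
  have hd0 : ∀ i, (d i).eval 0 = D i := fun i => by
    by_cases h : D i = 0
    · by_cases h' : D' i = 0 <;> simp [d, h, h']
    · simp [d, h]
  have hd0' : ∀ i, (d' i).eval 0 = D' i := fun i => by
    by_cases h : D i = 0
    · by_cases h' : D' i = 0 <;> simp [d', h, h']
    · have : D' i = 0 := (mul_eq_zero.1 (hD i)).resolve_left h
      simp [d', h, this]
  have hdd : ∀ i z, (d i).eval z * (d' i).eval z = z ^ 2 := fun i z => by
    by_cases h : D i = 0
    · by_cases h' : D' i = 0
      · simp [d, d', h, h', pow_two]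
      · simp [d, d', h, h']
        field_simp
    · simp [d, d', h]
  let X₀ : Matrix (Fin n) (Fin n) (Polynomial L) :=
    (P.map Polynomial.C)ᵀ * diagonal d * P.map Polynomial.C
  let T₀ : Matrix (Fin n) (Fin n) (Polynomial L) :=
    Q.map Polynomial.C * diagonal d' * (Q.map Polynomial.C)ᵀ
  have hX : ∀ z, X₀.map (Polynomial.eval z) = Pᵀ * diagonal (fun i => (d i).eval z) * P := by
    intro z
    ext i j
    simp [X₀, Matrix.mul_apply, Polynomial.eval_finsetSum, diagonal_apply]
  have hT : ∀ z, T₀.map (Polynomial.eval z) = Q * diagonal (fun i => (d' i).eval z) * Qᵀ := by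
    intro z
    ext i j
    simp [T₀, Matrix.mul_apply, Polynomial.eval_finsetSum, diagonal_apply]
  have key := Polynomial.eval_zero_of_eval_ne_zero (aeval (pairPoint X₀ T₀) f) fun z hz => by
    rw [eval_aeval_pairPoint, hX, hT]
    refine hf _ _ ?_ ?_ (z ^ 2) (pow_ne_zero 2 hz) ?_
    · simp [Matrix.mul_assoc]
    · simp [Matrix.mul_assoc]
    · have h1 : diagonal (fun i => (d i).eval z) * diagonal (fun i => (d' i).eval z) =
          (z ^ 2) • (1 : Matrix ι ι L) := by
        rw [diagonal_mul_diagonal, smul_one_eq_diagonal]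
        simp only [hdd]
      calc _ = Pᵀ * (diagonal (fun i => (d i).eval z) * (P * Q) *
              diagonal (fun i => (d' i).eval z)) * Qᵀ := by simp only [Matrix.mul_assoc]
        _ = _ := by
          rw [hPQ, Matrix.mul_one, h1, Matrix.mul_smul, Matrix.smul_mul, Matrix.mul_one,
            ← transpose_mul, hQP, transpose_one]
  rw [eval_aeval_pairPoint, hX, hT] at key
  simpa only [hd0, hd0'] using key

lemma aeval_eq_zero_of_mem_scalarIdeal {f : MvPolynomial (PairVar n) k}
    (hf : f ∈ scalarIdeal (genX n k * genT n k)) : VanishesOnInvertible L f := by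
  intro X T hX hT z hz hXT
  suffices scalarIdeal (genX n k * genT n k) ≤ RingHom.ker (aeval (R := k) (pairPoint X T)) from
    this hf
  rw [scalarIdeal_le_iff]
  refine ⟨fun i j hij => ?_, fun i j => ?_⟩
  · rw [RingHom.mem_ker, aeval_pairPoint_genX_mul_genT hX hT, hXT]
    simp [hij]
  · rw [RingHom.mem_ker, map_sub, aeval_pairPoint_genX_mul_genT hX hT,
      aeval_pairPoint_genX_mul_genT hX hT, hXT]
    simp

lemma aeval_det_genX {X T : Matrix (Fin n) (Fin n) L} (hX : Xᵀ = X) :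
    aeval (pairPoint X T) (genX n k).det = X.det := by
  rw [AlgHom.map_det]
  congr 1
  ext a b
  rcases le_total a b with h | h
  · simp [genX, symMat, pairPoint, h]
  · simp only [genX, symMat, pairPoint, AlgHom.mapMatrix_apply, map_apply, of_apply, aeval_X,
      Sum.elim_inr, Sym2.inf_mk, Sym2.sup_mk, inf_eq_right.2 h, sup_eq_left.2 h]
    exact congrFun (congrFun hX a) b

theorem mem_scalarIdeal_of_vanishes (p : ℕ) [Fact p.Prime] (i₀ : Fin n)
    {f : MvPolynomial (PairVar n) (ZMod p)}
    (hf : VanishesOnInvertible (AlgebraicClosure (ZMod p)) f) :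
    f ∈ scalarIdeal (genX n (ZMod p) * genT n (ZMod p)) := by
  have hle : ∀ f : MvPolynomial (PairVar n) (ZMod p),
      VanishesOnInvertible (AlgebraicClosure (ZMod p)) f → ∃ g,
        VanishesOnInvertible (AlgebraicClosure (ZMod p)) g ∧
        f - (genX n (ZMod p) * genT n (ZMod p)) i₀ i₀ * g ∈
          scalarIdeal (genX n (ZMod p) * genT n (ZMod p)) := by
    intro f hf
    obtain ⟨l, hl, y, hy, hly⟩ := Submodule.mem_sup.1 (entryIdeal_le_scalarIdeal_sup _ i₀
      (mem_entryIdeal_of_vanishesOnDiagPairs p hf.vanishesOnDiagPairs))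
    obtain ⟨g, rfl⟩ := Ideal.mem_span_singleton.1 hy
    refine ⟨g, ?_, by rw [← hly, add_sub_cancel_right]; exact hl⟩
    intro X T hX hT z hz hXT
    have h1 := hf X T hX hT z hz hXT
    rw [← hly, map_add, aeval_eq_zero_of_mem_scalarIdeal hl X T hX hT z hz hXT, zero_add, map_mul,
      aeval_pairPoint_genX_mul_genT hX hT, hXT] at h1
    simpa [hz] using h1
  refine mem_of_forall_mem_sup_span_pow (w := fun _ => 1) isScaled_of_mem_scalarGens
    (isScaled_genX_mul_genT i₀ i₀) two_pos fun N => ?_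
  suffices ∃ g, VanishesOnInvertible (AlgebraicClosure (ZMod p)) g ∧
      f - ((genX n (ZMod p) * genT n (ZMod p)) i₀ i₀) ^ N * g ∈
        scalarIdeal (genX n (ZMod p) * genT n (ZMod p)) from
    this.imp fun g hg => hg.2
  induction N with
  | zero => exact ⟨f, hf, by simp⟩
  | succ N ih =>
    obtain ⟨g, hg, hg'⟩ := ih
    obtain ⟨g', hg1, hg2⟩ := hle g hg
    refine ⟨g', hg1, ?_⟩
    have := add_mem hg' (Ideal.mul_mem_left _
      (((genX n (ZMod p) * genT n (ZMod p)) i₀ i₀) ^ N) hg2)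
    convert this using 1
    ring

theorem mem_scalarIdeal_of_det_mul_mem_zmod (p : ℕ) [Fact p.Prime] (i₀ : Fin n)
    {f : MvPolynomial (PairVar n) (ZMod p)}
    (hf : (genX n (ZMod p)).det * f ∈ scalarIdeal (genX n (ZMod p) * genT n (ZMod p))) :
    f ∈ scalarIdeal (genX n (ZMod p) * genT n (ZMod p)) := by
  refine mem_scalarIdeal_of_vanishes p i₀ fun X T hX hT z hz hXT => ?_
  have h := aeval_eq_zero_of_mem_scalarIdeal hf X T hX hT z hz hXT
  rw [map_mul, aeval_det_genX hX] at h
  refine (mul_eq_zero.1 h).resolve_left fun h0 => ?_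
  have h1 := congrArg det hXT
  rw [det_mul, h0, zero_mul, det_smul, det_one, mul_one] at h1
  exact pow_ne_zero _ hz h1.symm

end ScalarProduct

section CharZero

open MvPolynomial

lemma map_scalarIdeal {m R S : Type*} [CommRing R] [CommRing S] (φ : R →+* S)
    (M : Matrix m m R) : (scalarIdeal M).map φ = scalarIdeal (M.map φ) := by
  apply le_antisymm
  · rw [Ideal.map_le_iff_le_comap, scalarIdeal_le_iff]
    refine ⟨fun i j hij => ?_, fun i j => ?_⟩
    · exact offDiag_mem_scalarIdeal (M.map φ) hij
    · rw [Ideal.mem_comap, map_sub]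
      exact diag_sub_mem_scalarIdeal (M.map φ) i j
  · rw [scalarIdeal_le_iff]
    refine ⟨fun i j hij => ?_, fun i j => ?_⟩
    · exact Ideal.mem_map_of_mem φ (offDiag_mem_scalarIdeal M hij)
    · have := Ideal.mem_map_of_mem φ (diag_sub_mem_scalarIdeal M i j)
      rwa [map_sub] at this

variable {n : ℕ} {k k' : Type*} [CommRing k] [CommRing k']

lemma map_genX (φ : k →+* k') : (genX n k).map (MvPolynomial.map φ) = genX n k' := by
  ext1 i j
  simp [genX, symMat]

lemma map_genT (φ : k →+* k') : (genT n k).map (MvPolynomial.map φ) = genT n k' := by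
  ext1 i j
  simp [genT, symMat]

/-- The ideal expressing that the product of two generic symmetric matrices is scalar. -/
noncomputable def genScalarIdeal (n : ℕ) (k : Type*) [CommRing k] :
    Ideal (MvPolynomial (PairVar n) k) := scalarIdeal (genX n k * genT n k)

lemma map_genScalarIdeal (φ : k →+* k') :
    (genScalarIdeal n k).map (MvPolynomial.map φ) = genScalarIdeal n k' := by
  rw [genScalarIdeal, map_scalarIdeal, Matrix.map_mul, map_genX, map_genT, genScalarIdeal]

lemma map_det_genX (φ : k →+* k') : MvPolynomial.map φ (genX n k).det = (genX n k').det := by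
  rw [RingHom.map_det, RingHom.mapMatrix_apply, map_genX]

lemma weightScale_one_coeff_zero (f : MvPolynomial (PairVar n) k) :
    (weightScale (fun _ => 1) f).coeff 0 = C (constantCoeff f) := by
  ext m
  rw [coeff_coeff_weightScale, coeff_C, constantCoeff_eq]
  have : Finsupp.weight (fun _ : PairVar n => 1) m = 0 ↔ 0 = m := by
    have h1 : Finsupp.weight (fun _ : PairVar n => 1) m = m.degree :=
      (DFunLike.congr_fun (Finsupp.degree_eq_weight_one (σ := PairVar n) (R := ℕ)) m).symm
    rw [h1]
    exact (Finsupp.degree_eq_zero_iff m).trans eq_comm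
  by_cases h : 0 = m
  · subst h; simp
  · rw [if_neg h, if_neg (this.not.2 h)]

attribute [local instance] MvPolynomial.algebraMvPolynomial in
theorem mem_genScalarIdeal_of_det_mul_mem_rat (i₀ : Fin n) {f : MvPolynomial (PairVar n) ℚ}
    (hf : (genX n ℚ).det * f ∈ genScalarIdeal n ℚ) : f ∈ genScalarIdeal n ℚ := by
  let V : Ideal (MvPolynomial (PairVar n) ℤ) :=
    { carrier := {f | ∃ M : ℤ, M ≠ 0 ∧ C M * ((genX n ℤ).det * f) ∈ genScalarIdeal n ℤ}
      zero_mem' := ⟨1, one_ne_zero, by simp⟩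
      add_mem' := by
        rintro a b ⟨M, hM, ha⟩ ⟨N, hN, hb⟩
        refine ⟨M * N, mul_ne_zero hM hN, ?_⟩
        have := add_mem (Ideal.mul_mem_left _ (C N) ha) (Ideal.mul_mem_left _ (C M) hb)
        convert this using 1
        rw [map_mul]
        ring
      smul_mem' := by
        rintro c a ⟨M, hM, ha⟩
        refine ⟨M, hM, ?_⟩
        have := Ideal.mul_mem_left _ c ha
        convert this using 1
        rw [smul_eq_mul]
        ring }
  have hV : ∀ f, f ∈ V ↔ ∃ M : ℤ, M ≠ 0 ∧ C M * ((genX n ℤ).det * f) ∈ genScalarIdeal n ℤ :=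
    fun f => Iff.rfl
  have hle : genScalarIdeal n ℤ ≤ V := fun x hx =>
    ⟨1, one_ne_zero, Ideal.mul_mem_left _ _ (Ideal.mul_mem_left _ _ hx)⟩
  have hfg : V.FG := IsNoetherian.noetherian V
  obtain ⟨M, hM, hMV⟩ : ∃ M : ℤ, M ≠ 0 ∧ ∀ f ∈ V,
      C M * ((genX n ℤ).det * f) ∈ genScalarIdeal n ℤ := by
    obtain ⟨s, hs⟩ := hfg
    have hs' : ∀ a ∈ s, ∃ M : ℤ, M ≠ 0 ∧ C M * ((genX n ℤ).det * a) ∈ genScalarIdeal n ℤ :=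
      fun a ha => (hV a).1 (hs ▸ Ideal.subset_span ha)
    choose! N hN hN' using hs'
    refine ⟨∏ a ∈ s, N a, Finset.prod_ne_zero_iff.2 hN, fun f hf => ?_⟩
    rw [← hs] at hf
    induction hf using Submodule.span_induction with
    | mem a ha =>
      obtain ⟨c, hc⟩ := Finset.dvd_prod_of_mem N ha
      rw [hc, mul_comm (N a), map_mul, mul_assoc]
      exact Ideal.mul_mem_left _ _ (hN' a ha)
    | zero => simp
    | add x y _ _ hx hy =>
      rw [mul_add, mul_add]
      exact add_mem hx hy
    | smul c x _ hx =>
      have := Ideal.mul_mem_left _ c hx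
      convert this using 1
      rw [smul_eq_mul]
      ring
  obtain ⟨p, hp, hpp⟩ := Nat.exists_infinite_primes (M.natAbs + 1)
  have : Fact p.Prime := ⟨hpp⟩
  have hMp : (M : ZMod p) ≠ 0 := by
    rw [Ne, ZMod.intCast_zmod_eq_zero_iff_dvd]
    intro h
    have := Int.natAbs_dvd_natAbs.2 h
    have := Nat.le_of_dvd (Int.natAbs_pos.2 hM) this
    simp at this
    omega
  let φ : ℤ →+* ZMod p := Int.castRingHom (ZMod p)
  have hφ : Function.Surjective (MvPolynomial.map (σ := PairVar n) φ) :=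
    MvPolynomial.map_surjective _ (ZMod.ringHom_surjective φ)
  have hle : V ≤ genScalarIdeal n ℤ ⊔
      (Ideal.span {C (p : ℤ)} : Ideal (MvPolynomial (PairVar n) ℤ)) • V := by
    intro f hf
    have h1 := Ideal.mem_map_of_mem (MvPolynomial.map φ) (hMV f hf)
    rw [map_genScalarIdeal, map_mul, map_C] at h1
    have hu : IsUnit (C (φ M) : MvPolynomial (PairVar n) (ZMod p)) := by
      apply IsUnit.map
      exact isUnit_iff_ne_zero.2 hMp
    rw [Ideal.unit_mul_mem_iff_mem _ hu, map_mul, map_det_genX] at h1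
    have h2 := mem_scalarIdeal_of_det_mul_mem_zmod p i₀ h1
    rw [← genScalarIdeal, ← map_genScalarIdeal φ, Ideal.mem_map_iff_of_surjective _ hφ] at h2
    obtain ⟨l, hl, hlf⟩ := h2
    have h3 : C (p : ℤ) ∣ f - l := by
      rw [C_dvd_iff_map_hom_eq_zero φ (p : ℤ) (fun r => ZMod.intCast_zmod_eq_zero_iff_dvd r p),
        map_sub, hlf, sub_self]
    obtain ⟨g, hg⟩ := h3
    have hgV : g ∈ V := by
      obtain ⟨N, hN, hN'⟩ := (hV _).1 (hg ▸ sub_mem hf (hle hl))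
      refine ⟨N * p, mul_ne_zero hN (by exact_mod_cast hpp.ne_zero), ?_⟩
      convert hN' using 1
      rw [map_mul]
      ring
    rw [← sub_add_cancel f l, add_comm, hg]
    exact Submodule.add_mem_sup hl (Submodule.smul_mem_smul (Ideal.mem_span_singleton_self _) hgV)
  obtain ⟨r, hr, hrV⟩ :=
    Submodule.exists_sub_one_mem_and_smul_le_of_fg_of_le_sup hfg le_rfl hle
  have hrV' : ∀ g ∈ V, r * g ∈ genScalarIdeal n ℤ := fun g hg =>
    hrV (Submodule.smul_mem_pointwise_smul g r V hg)
  have hloc : IsLocalization ((nonZeroDivisors ℤ).map (C (σ := PairVar n)))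
    (MvPolynomial (PairVar n) ℚ) := inferInstance
  have hmap : algebraMap (MvPolynomial (PairVar n) ℤ) (MvPolynomial (PairVar n) ℚ) =
    MvPolynomial.map (Int.castRingHom ℚ) := rfl
  have hCu : ∀ N : ℤ, N ≠ 0 → IsUnit (C (N : ℚ) : MvPolynomial (PairVar n) ℚ) := fun N hN =>
    (isUnit_iff_ne_zero.2 (Int.cast_ne_zero.2 hN)).map C
  obtain ⟨⟨g, ⟨_, N, hN, rfl⟩⟩, hg⟩ := IsLocalization.surj
    ((nonZeroDivisors ℤ).map (C (σ := PairVar n))) f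
  rw [hmap] at hg
  replace hg : f * C (N : ℚ) = MvPolynomial.map (Int.castRingHom ℚ) g := by
    rw [← hg]
    exact congrArg (f * ·) (map_C (Int.castRingHom ℚ) N).symm
  have hgV : g ∈ V := by
    have h1 := Ideal.mul_mem_right (C (N : ℚ)) _ hf
    rw [mul_assoc, hg, ← map_det_genX (Int.castRingHom ℚ), ← map_mul,
      ← map_genScalarIdeal (Int.castRingHom ℚ), ← hmap,
      IsLocalization.mem_map_algebraMap_iff ((nonZeroDivisors ℤ).map (C (σ := PairVar n)))] at h1
    obtain ⟨⟨⟨l, hl⟩, ⟨_, N', hN', rfl⟩⟩, h2⟩ := h1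
    rw [← map_mul, hmap] at h2
    have h3 := MvPolynomial.map_injective _ Int.cast_injective h2
    refine ⟨N', nonZeroDivisors.ne_zero hN', ?_⟩
    rw [mul_comm]
    exact h3 ▸ hl
  have h4 := Ideal.mem_map_of_mem (MvPolynomial.map (Int.castRingHom ℚ)) (hrV' g hgV)
  rw [map_genScalarIdeal, map_mul, ← hg, ← mul_assoc, mul_comm,
    Ideal.unit_mul_mem_iff_mem _ (hCu N (nonZeroDivisors.ne_zero hN))] at h4
  refine mem_of_mul_mem_of_isUnit_coeff_zero (w := fun _ => 1) isScaled_of_mem_scalarGens ?_ h4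
  rw [weightScale_one_coeff_zero, constantCoeff_map]
  refine hCu _ fun h0 => ?_
  obtain ⟨c, hc⟩ := Ideal.mem_span_singleton.1 hr
  have h5 := congrArg constantCoeff hc
  rw [map_sub, h0, map_one, map_mul, constantCoeff_C, zero_sub] at h5
  have h6 : (p : ℤ) ∣ 1 := (dvd_neg).1 ⟨_, h5⟩
  exact hpp.one_lt.ne' (by exact_mod_cast Int.eq_one_of_dvd_one (by positivity) h6)

end CharZero

section Flatness

/-- The submodule of `Rˡ` generated by the images of the syzygies of `s` over `S`. -/
def syzygySpan {S R : Type*} [CommRing S] [CommRing R] (φ : S →+* R) {l : ℕ} (s : Fin l → S) :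
    Submodule R (Fin l → R) :=
  Submodule.span R {r | ∃ c : Fin l → S, ∑ i, s i * c i = 0 ∧ r = fun i => φ (c i)}

/-- The equational form of flatness of a ring homomorphism. -/
def HasLiftedSyzygies {S R : Type*} [CommRing S] [CommRing R] (φ : S →+* R) : Prop :=
  ∀ (l : ℕ) (s : Fin l → S) (r : Fin l → R), ∑ i, φ (s i) * r i = 0 → r ∈ syzygySpan φ s

variable {S R S' R' : Type*} [CommRing S] [CommRing R] [CommRing S'] [CommRing R']

lemma apply_mem_syzygySpan {φ : S →+* R} {l : ℕ} {s : Fin l → S} {c : Fin l → S}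
    (h : ∑ i, s i * c i = 0) : (fun i => φ (c i)) ∈ syzygySpan φ s :=
  Submodule.subset_span ⟨c, h, rfl⟩

lemma sum_mul_eq_zero_of_mem_syzygySpan {φ : S →+* R} {l : ℕ} {s : Fin l → S} {r : Fin l → R}
    (h : r ∈ syzygySpan φ s) : ∑ i, φ (s i) * r i = 0 := by
  induction h using Submodule.span_induction with
  | mem x hx =>
    obtain ⟨c, hc, rfl⟩ := hx
    simp only [← map_mul, ← map_sum, hc, map_zero]
  | zero => simp
  | add x y _ _ hx hy => simp [mul_add, Finset.sum_add_distrib, hx, hy]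
  | smul a x _ hx =>
    simp only [Pi.smul_apply, smul_eq_mul, mul_left_comm _ a, ← Finset.mul_sum, hx, mul_zero]

lemma flat_of_hasLiftedSyzygies [Algebra S R] (h : HasLiftedSyzygies (algebraMap S R)) :
    Module.Flat S R := by
  refine Module.Flat.of_forall_isTrivialRelation fun {l s r} hr => ?_
  simp only [Algebra.smul_def] at hr
  have := h l s r hr
  obtain ⟨n, y, g, hg⟩ := Submodule.mem_span_set'.1 this
  choose c hc hc' using fun j => (g j).2
  refine ⟨n, fun i j => c j i, y, fun i => ?_, hc⟩
  rw [← hg, Finset.sum_apply]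
  refine Finset.sum_congr rfl fun j _ => ?_
  rw [Pi.smul_apply, hc', smul_eq_mul, Algebra.smul_def, mul_comm]

lemma hasLiftedSyzygies_of_flat [Algebra S R] [Module.Flat S R] :
    HasLiftedSyzygies (algebraMap S R) := by
  intro l s r hr
  obtain ⟨k, a, y, h1, h2⟩ := Module.Flat.isTrivialRelation_of_sum_smul_eq_zero (R := S) (M := R)
    (f := s) (x := r) (by simpa only [Algebra.smul_def] using hr)
  have : r = ∑ j, y j • fun i => algebraMap S R (a i j) := by
    ext i
    rw [h1, Finset.sum_apply]
    refine Finset.sum_congr rfl fun j _ => ?_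
    rw [Pi.smul_apply, Algebra.smul_def, smul_eq_mul, mul_comm]
  rw [this]
  exact Submodule.sum_mem _ fun j _ => Submodule.smul_mem _ _ (apply_mem_syzygySpan (h2 j))

/-- Flatness may be checked modulo a regular element of the Jacobson radical. -/
theorem HasLiftedSyzygies.of_quotient [IsNoetherianRing S] [IsNoetherianRing R] {φ : S →+* R}
    {φ' : S' →+* R'} {π : S →+* S'} {ρ : R →+* R'} (hπ : Function.Surjective π)
    (hρ : Function.Surjective ρ) (hcomm : φ'.comp π = ρ.comp φ) {x : S}
    (hkπ : RingHom.ker π = Ideal.span {x}) (hkρ : RingHom.ker ρ = Ideal.span {φ x})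
    (hx : ∀ y, φ x * y = 0 → y = 0) (hxJ : φ x ∈ Ideal.jacobson (⊥ : Ideal R))
    (h : HasLiftedSyzygies φ') : HasLiftedSyzygies φ := by
  have hcomm' : ∀ a, φ' (π a) = ρ (φ a) := fun a => RingHom.congr_fun hcomm a
  have hmodx : ∀ (l : ℕ) (s : Fin l → S) (r : Fin l → R), ∑ i, φ (s i) * r i = 0 →
      ∃ u ∈ Submodule.span R {r | ∃ c : Fin l → S, (∃ d, ∑ i, s i * c i = x * d) ∧
        r = fun i => φ (c i)}, ∃ r', r = u + φ x • r' := by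
    intro l s r hr
    have h1 : (fun i => ρ (r i)) ∈ syzygySpan φ' (fun i => π (s i)) := by
      apply h
      simp only [hcomm', ← map_mul, ← map_sum, hr, map_zero]
    have h2 : ∀ q : Fin l → R', q ∈ syzygySpan φ' (fun i => π (s i)) →
        ∃ u ∈ Submodule.span R {r | ∃ c : Fin l → S, (∃ d, ∑ i, s i * c i = x * d) ∧
          r = fun i => φ (c i)}, ∀ i, ρ (u i) = q i := by
      intro q hq
      induction hq using Submodule.span_induction with
      | mem q hq =>
        obtain ⟨c', hc', rfl⟩ := hq
        choose c hc using fun i => hπ (c' i)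
        refine ⟨fun i => φ (c i), Submodule.subset_span ⟨c, ?_, rfl⟩, fun i => ?_⟩
        · have : ∑ i, s i * c i ∈ RingHom.ker π := by
            rw [RingHom.mem_ker, map_sum, ← hc']
            simp only [map_mul, hc]
          rw [hkπ] at this
          exact Ideal.mem_span_singleton.1 this
        · rw [← hcomm', hc]
      | zero => exact ⟨0, zero_mem _, by simp⟩
      | add a b _ _ ha hb =>
        obtain ⟨u, hu, hu'⟩ := ha
        obtain ⟨v, hv, hv'⟩ := hb
        exact ⟨u + v, add_mem hu hv, fun i => by simp [hu', hv']⟩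
      | smul a b _ hb =>
        obtain ⟨u, hu, hu'⟩ := hb
        obtain ⟨a, rfl⟩ := hρ a
        exact ⟨a • u, Submodule.smul_mem _ _ hu, fun i => by simp [hu']⟩
    obtain ⟨u, hu, hu'⟩ := h2 _ h1
    have h3 : ∀ i, ∃ y, r i - u i = φ x * y := fun i => by
      have : r i - u i ∈ RingHom.ker ρ := by rw [RingHom.mem_ker, map_sub, hu', sub_self]
      rw [hkρ] at this
      exact Ideal.mem_span_singleton.1 this
    choose r' hr' using h3
    exact ⟨u, hu, r', funext fun i => by simp [← hr']⟩
  suffices ∀ I : Ideal S, ∀ (l : ℕ) (s : Fin l → S), Ideal.span (Set.range s) = I →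
      ∀ r : Fin l → R, ∑ i, φ (s i) * r i = 0 → r ∈ syzygySpan φ s from
    fun l s r => this _ l s rfl r
  intro I
  induction I using WellFoundedGT.induction with
  | _ I ih =>
  intro l s hs
  by_cases hcase : ∀ d, x * d ∈ I → d ∈ I
  · let Z : Submodule R (Fin l → R) :=
      { carrier := {r | ∑ i, φ (s i) * r i = 0}
        zero_mem' := by simp
        add_mem' := fun {a b} ha hb => by
          rw [Set.mem_ofPred_eq] at ha hb ⊢
          simp only [Pi.add_apply, mul_add, Finset.sum_add_distrib, ha, hb, add_zero]
        smul_mem' := fun a b hb => by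
          rw [Set.mem_ofPred_eq] at hb ⊢
          simp only [Pi.smul_apply, smul_eq_mul, mul_left_comm _ a, ← Finset.mul_sum, hb,
            mul_zero] }
    have hZ : Z ≤ syzygySpan φ s := by
      refine Submodule.le_of_le_smul_of_le_jacobson_bot (I := Ideal.span {φ x})
        (IsNoetherian.noetherian Z) (by rwa [Ideal.span_singleton_le_iff_mem]) fun r hr => ?_
      obtain ⟨u, hu, r', rfl⟩ := hmodx l s r hr
      have h4 : ∃ v ∈ syzygySpan φ s, ∃ u', u = v + φ x • u' := by
        clear hr
        induction hu using Submodule.span_induction with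
        | mem a ha =>
          obtain ⟨c, ⟨d, hd⟩, rfl⟩ := ha
          have hdI : d ∈ I := hcase d (hd ▸ hs ▸ Ideal.sum_mem _ fun i _ =>
            Ideal.mul_mem_right _ _ (Ideal.subset_span ⟨i, rfl⟩))
          rw [← hs] at hdI
          obtain ⟨b, hb⟩ := Ideal.mem_span_range_iff_exists_fun.1 hdI
          refine ⟨fun i => φ (c i - x * b i), apply_mem_syzygySpan ?_, fun i => φ (b i), ?_⟩
          · simp only [mul_sub, Finset.sum_sub_distrib, hd, ← hb, Finset.mul_sum]
            rw [sub_eq_zero]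
            exact Finset.sum_congr rfl fun i _ => by ring
          · ext i
            simp
        | zero => exact ⟨0, zero_mem _, 0, by simp⟩
        | add a b _ _ ha hb =>
          obtain ⟨v, hv, u', rfl⟩ := ha
          obtain ⟨v', hv', u'', rfl⟩ := hb
          exact ⟨v + v', add_mem hv hv', u' + u'', by rw [smul_add]; abel⟩
        | smul a b _ hb =>
          obtain ⟨v, hv, u', rfl⟩ := hb
          exact ⟨a • v, Submodule.smul_mem _ _ hv, a • u', by rw [smul_add, smul_comm]⟩
      obtain ⟨v, hv, u', rfl⟩ := h4
      rw [add_assoc, ← smul_add] at hr ⊢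
      refine Submodule.add_mem_sup hv (Submodule.smul_mem_smul
        (Ideal.mem_span_singleton_self _) (hx _ ?_))
      have hr' : ∑ i, φ (s i) * (v + φ x • (u' + r')) i = 0 := hr
      simp only [Pi.add_apply (v), mul_add (φ (s _)) (v _), Finset.sum_add_distrib,
        sum_mul_eq_zero_of_mem_syzygySpan hv, zero_add, Pi.smul_apply, smul_eq_mul] at hr'
      rw [← hr', Finset.mul_sum]
      exact Finset.sum_congr rfl fun i _ => by ring
    exact fun r hr => hZ hr
  · push Not at hcase
    obtain ⟨d₀, hd₀, hd₀'⟩ := hcase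
    let I' : Ideal S :=
      { carrier := {d | x * d ∈ I}
        zero_mem' := by simp
        add_mem' := fun {a b} ha hb => by
          rw [Set.mem_ofPred_eq, mul_add]
          exact add_mem ha hb
        smul_mem' := fun a b hb => by
          rw [Set.mem_ofPred_eq, smul_eq_mul, mul_left_comm]
          exact Ideal.mul_mem_left _ _ hb }
    have hII' : I ≤ I' := fun d hd => Ideal.mul_mem_left _ x hd
    obtain ⟨m, D, hD⟩ := Submodule.fg_iff_exists_fin_generating_family.1
      (IsNoetherian.noetherian I')
    have hDI' : ∀ j, x * D j ∈ I := fun j => by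
      have : D j ∈ I' := hD ▸ Submodule.subset_span ⟨j, rfl⟩
      exact this
    have hc : ∀ j, ∃ c : Fin l → S, ∑ i, s i * c i = x * D j := fun j => by
      have := hDI' j
      rw [← hs] at this
      obtain ⟨c, hc⟩ := Ideal.mem_span_range_iff_exists_fun.1 this
      exact ⟨c, by rw [← hc]; exact Finset.sum_congr rfl fun i _ => mul_comm _ _⟩
    choose c hc using hc
    have hgen : ∀ d ∈ I', ∃ b : Fin m → S, ∑ j, b j * D j = d := fun d hd => by
      rw [← hD] at hd
      exact Ideal.mem_span_range_iff_exists_fun.1 hd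
    have hsI' : ∀ i, s i ∈ I' := fun i => hII' (hs ▸ Ideal.subset_span ⟨i, rfl⟩)
    choose e he using fun i => hgen (s i) (hsI' i)
    let θ : (Fin m → R) →ₗ[R] (Fin l → R) := Fintype.linearCombination R fun j i => φ (c j i)
    have hθ : ∀ y i, θ y i = ∑ j, y j * φ (c j i) := fun y i => by
      simp [θ, Fintype.linearCombination_apply]
    have hcomb : ∀ (b : Fin m → S) , ∑ i, s i * ∑ j, b j * c j i = x * ∑ j, b j * D j := by
      intro b
      simp only [Finset.mul_sum]
      rw [Finset.sum_comm]
      refine Finset.sum_congr rfl fun j _ => ?_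
      rw [mul_left_comm, ← hc, Finset.mul_sum]
      exact Finset.sum_congr rfl fun i _ => by ring
    have hθD : ∀ y ∈ syzygySpan φ D, θ y ∈ syzygySpan φ s := by
      intro y hy
      suffices syzygySpan φ D ≤ (syzygySpan φ s).comap θ from this hy
      refine Submodule.span_le.2 ?_
      rintro _ ⟨b, hb, rfl⟩
      rw [SetLike.mem_coe, Submodule.mem_comap]
      have : θ (fun j => φ (b j)) = fun i => φ (∑ j, b j * c j i) := by
        ext i
        rw [hθ, map_sum]
        simp only [map_mul]
      rw [this]
      refine apply_mem_syzygySpan ?_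
      rw [hcomb]
      simp only [mul_comm (b _), hb, mul_zero]
    intro r hr
    obtain ⟨u, hu, r', rfl⟩ := hmodx l s r hr
    have h4 : ∃ v ∈ syzygySpan φ s, ∃ y, u = v + θ y := by
      clear hr
      induction hu using Submodule.span_induction with
      | mem a ha =>
        obtain ⟨c', ⟨d, hd⟩, rfl⟩ := ha
        obtain ⟨b, hb⟩ := hgen d (show x * d ∈ I from hd ▸ hs ▸ Ideal.sum_mem _ fun i _ =>
          Ideal.mul_mem_right _ _ (Ideal.subset_span ⟨i, rfl⟩))
        refine ⟨fun i => φ (c' i - ∑ j, b j * c j i), apply_mem_syzygySpan ?_,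
          fun j => φ (b j), ?_⟩
        · simp only [mul_sub, Finset.sum_sub_distrib, hd]
          rw [hcomb, hb, sub_self]
        · ext i
          simp [hθ]
      | zero => exact ⟨0, zero_mem _, 0, by simp⟩
      | add a b _ _ ha hb =>
        obtain ⟨v, hv, u', rfl⟩ := ha
        obtain ⟨v', hv', u'', rfl⟩ := hb
        exact ⟨v + v', add_mem hv hv', u' + u'', by rw [map_add]; abel⟩
      | smul a b _ hb =>
        obtain ⟨v, hv, u', rfl⟩ := hb
        exact ⟨a • v, Submodule.smul_mem _ _ hv, a • u', by rw [smul_add, map_smul]⟩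
    obtain ⟨v, hv, y, rfl⟩ := h4
    have h5 : φ x • r' - θ (fun j => ∑ i, r' i * φ (e i j)) ∈ syzygySpan φ s := by
      have : φ x • r' - θ (fun j => ∑ i, r' i * φ (e i j)) =
          ∑ i, r' i • fun k => φ (Pi.single (M := fun _ => S) i x k - ∑ j, e i j * c j k) := by
        ext k
        simp only [Pi.sub_apply, Pi.smul_apply, hθ, Finset.sum_apply, map_sub, smul_eq_mul,
          mul_sub, Finset.sum_sub_distrib]
        congr 1
        · rw [Finset.sum_eq_single k]
          · simp [mul_comm]
          · intro i _ hik
            simp [Pi.single_eq_of_ne hik.symm]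
          · simp
        · simp only [Finset.sum_mul, map_sum, map_mul, Finset.mul_sum]
          rw [Finset.sum_comm]
          exact Finset.sum_congr rfl fun i _ => Finset.sum_congr rfl fun j _ => by ring
      rw [this]
      refine Submodule.sum_mem _ fun i _ => Submodule.smul_mem _ _ (apply_mem_syzygySpan ?_)
      simp only [mul_sub, Finset.sum_sub_distrib]
      rw [hcomb, he, Finset.sum_eq_single i]
      · simp [mul_comm]
      · intro k _ hki
        simp [Pi.single_eq_of_ne hki]
      · simp
    have h6 : v + θ y + φ x • r' = v + (φ x • r' - θ (fun j => ∑ i, r' i * φ (e i j))) +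
        θ (y + fun j => ∑ i, r' i * φ (e i j)) := by
      rw [map_add]
      abel
    rw [h6] at hr ⊢
    refine add_mem (add_mem hv h5) (hθD _ (ih I' (lt_of_le_of_ne hII' ?_) m D hD _ (hx _ ?_)))
    · intro hEq
      exact hd₀' (hEq ▸ (show d₀ ∈ I' from hd₀))
    · simp only [Pi.add_apply _ (θ _), mul_add (φ (s _)) _ (θ _ _), Finset.sum_add_distrib,
        sum_mul_eq_zero_of_mem_syzygySpan (add_mem hv h5), zero_add] at hr
      rw [← hr]
      simp only [hθ, Finset.mul_sum]
      rw [Finset.sum_comm]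
      refine Finset.sum_congr rfl fun j _ => ?_
      rw [← mul_assoc, ← map_mul, ← hc, map_sum, Finset.sum_mul]
      refine Finset.sum_congr rfl fun i _ => ?_
      rw [map_mul]
      ring

end Flatness

section RegularSequences

open MvPolynomial

variable {R : Type*} [CommRing R]

/-- Each member of the family is a nonzerodivisor modulo the preceding ones. -/
def IsRegSeq {N : ℕ} (a : Fin N → R) : Prop :=
  ∀ i y, a i * y ∈ Ideal.span (a '' {j | j < i}) → y ∈ Ideal.span (a '' {j | j < i})

lemma HasLiftedSyzygies.comp_equiv {S S'' : Type*} [CommRing S] [CommRing S''] {φ : S →+* R}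
    (h : HasLiftedSyzygies φ) (e : S'' ≃+* S) : HasLiftedSyzygies (φ.comp e.toRingHom) := by
  intro l s r hr
  refine Submodule.span_mono ?_ (h l (fun i => e (s i)) r hr)
  rintro _ ⟨c, hc, rfl⟩
  refine ⟨fun i => e.symm (c i), ?_, by ext i; simp⟩
  apply e.injective
  simp [map_sum, hc]

lemma ker_aeval_cons_zero {k : Type*} [CommRing k] (N : ℕ) :
    RingHom.ker (aeval (Fin.cons 0 X : Fin (N + 1) → MvPolynomial (Fin N) k)).toRingHom =
      Ideal.span {(X 0 : MvPolynomial (Fin (N + 1)) k)} := by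
  apply le_antisymm
  · intro f hf
    have h1 : ((Ideal.Quotient.mkₐ k (Ideal.span {(X 0 : MvPolynomial (Fin (N + 1)) k)})).comp
        (rename Fin.succ)).comp (aeval (Fin.cons 0 X : Fin (N + 1) → MvPolynomial (Fin N) k)) =
        Ideal.Quotient.mkₐ k _ := by
      apply MvPolynomial.algHom_ext
      intro i
      refine Fin.cases ?_ (fun i => ?_) i
      · simp only [AlgHom.comp_apply, aeval_X, Fin.cons_zero, map_zero]
        exact (Ideal.Quotient.eq_zero_iff_mem.2 (Ideal.mem_span_singleton_self _)).symm
      · simp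
    have h2 := DFunLike.congr_fun h1 f
    have hf' : aeval (Fin.cons 0 X : Fin (N + 1) → MvPolynomial (Fin N) k) f = 0 := hf
    rw [AlgHom.comp_apply, hf', map_zero] at h2
    exact Ideal.Quotient.eq_zero_iff_mem.1 h2.symm
  · rw [Ideal.span_singleton_le_iff_mem, RingHom.mem_ker]
    simp

lemma IsRegSeq.tail {N : ℕ} {a : Fin (N + 1) → R} (ha : IsRegSeq a) :
    IsRegSeq fun i : Fin N => Ideal.Quotient.mk (Ideal.span {a 0}) (a i.succ) := by
  intro i
  have himg : (fun i : Fin N => Ideal.Quotient.mk (Ideal.span {a 0}) (a i.succ)) '' {j | j < i} =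
      Ideal.Quotient.mk (Ideal.span {a 0}) '' ((fun j : Fin N => a j.succ) '' {j | j < i}) := by
    rw [Set.image_image]
  have hset : a '' {j | j < i.succ} =
      insert (a 0) ((fun j : Fin N => a j.succ) '' {j | j < i}) := by
    ext y
    constructor
    · rintro ⟨j, hj, rfl⟩
      revert hj
      refine Fin.cases (fun _ => Or.inl rfl) (fun j hj => Or.inr ⟨j, ?_, rfl⟩) j
      exact Fin.succ_lt_succ_iff.1 hj
    · rintro (rfl | ⟨j, hj, rfl⟩)
      · exact ⟨0, Fin.succ_pos i, rfl⟩
      · exact ⟨j.succ, Fin.succ_lt_succ_iff.2 hj, rfl⟩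
  have key : ∀ y, Ideal.Quotient.mk (Ideal.span {a 0}) y ∈ Ideal.span
      ((fun i : Fin N => Ideal.Quotient.mk (Ideal.span {a 0}) (a i.succ)) '' {j | j < i}) ↔
      y ∈ Ideal.span (a '' {j | j < i.succ}) := by
    intro y
    rw [himg, ← Ideal.map_span, ← Ideal.mem_comap, Ideal.comap_map_of_surjective' _
      Ideal.Quotient.mk_surjective, Ideal.mk_ker, hset, Ideal.span_insert, sup_comm]
  intro y hy
  obtain ⟨y, rfl⟩ := Ideal.Quotient.mk_surjective y
  rw [key]
  refine ha i.succ y ?_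
  rw [← key, map_mul]
  exact hy

theorem IsRegSeq.hasLiftedSyzygies {k : Type*} [Field k] [Algebra k R] [IsNoetherianRing R]
    [IsLocalRing R] {N : ℕ} {a : Fin N → R} (ha : IsRegSeq a)
    (ham : ∀ i, a i ∈ IsLocalRing.maximalIdeal R) :
    HasLiftedSyzygies (aeval a : MvPolynomial (Fin N) k →ₐ[k] R).toRingHom := by
  induction N generalizing R with
  | zero =>
    have h := (hasLiftedSyzygies_of_flat (S := k) (R := R)).comp_equiv
      (isEmptyRingEquiv k (Fin 0))
    convert h using 1
    refine RingHom.ext fun f => ?_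
    obtain ⟨c, rfl⟩ := C_surjective (Fin 0) f
    simp only [AlgHom.toRingHom_eq_coe, RingHom.coe_coe, algHom_C, RingHom.comp_apply]
    exact congrArg _ ((isEmptyRingEquiv k (Fin 0)).symm_apply_eq.1 rfl)
  | succ N ih =>
    have hne : Ideal.span {a 0} ≠ ⊤ := fun h => by
      rw [Ideal.span_singleton_eq_top] at h
      exact (IsLocalRing.mem_maximalIdeal _).1 (ham 0) h
    have : Nontrivial (R ⧸ Ideal.span {a 0}) := Ideal.Quotient.nontrivial_iff.2 hne
    have hloc : IsLocalRing (R ⧸ Ideal.span {a 0}) :=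
      IsLocalRing.of_surjective' _ Ideal.Quotient.mk_surjective
    refine HasLiftedSyzygies.of_quotient (x := X 0)
      (π := (aeval (Fin.cons 0 X : Fin (N + 1) → MvPolynomial (Fin N) k)).toRingHom)
      (ρ := Ideal.Quotient.mk (Ideal.span {a 0})) ?_ Ideal.Quotient.mk_surjective ?_
      (ker_aeval_cons_zero N) ?_ ?_ ?_
      (ih (R := R ⧸ Ideal.span {a 0}) ha.tail fun i => ?_)
    · intro f
      refine ⟨rename Fin.succ f, ?_⟩
      change aeval _ (rename Fin.succ f) = f
      rw [aeval_rename]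
      have : (Fin.cons 0 X : Fin (N + 1) → MvPolynomial (Fin N) k) ∘ Fin.succ = X := by
        ext1 i
        simp
      rw [this, aeval_X_left_apply]
    · apply MvPolynomial.ringHom_ext
      · intro c
        simp
      · intro i
        refine Fin.cases ?_ (fun i => ?_) i
        · simp
        · simp
    · rw [Ideal.mk_ker]
      simp
    · intro y hy
      have h0 : a 0 * y = 0 := by simpa using hy
      have := ha 0 y (by rw [h0]; exact zero_mem _)
      simpa using this
    · rw [IsLocalRing.jacobson_eq_maximalIdeal _ bot_ne_top]
      simpa using ham 0
    · rw [IsLocalRing.mem_maximalIdeal, mem_nonunits_iff]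
      intro hu
      have := IsLocalHom.of_surjective (Ideal.Quotient.mk (Ideal.span {a 0}))
        Ideal.Quotient.mk_surjective
      have := IsLocalHom.map_nonunit (f := Ideal.Quotient.mk (Ideal.span {a 0})) (a i.succ) hu
      exact (IsLocalRing.mem_maximalIdeal _).1 (ham _) this

end RegularSequences

section FlatTransfer

open MvPolynomial

/-- The ideal of `R[T]` expressing that the product of `A` with the generic symmetric matrix `T`
is scalar. -/
noncomputable def linIdeal {ι R : Type*} [Fintype ι] [CommRing R] (A : Matrix ι ι R) :
    Ideal (MvPolynomial (Sym2 ι) R) :=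
  scalarIdeal (A.map C * symMat X)

/-- The determinant of `A` is a nonzerodivisor modulo `linIdeal A`. -/
def DetRegular {ι R : Type*} [Fintype ι] [DecidableEq ι] [CommRing R] (A : Matrix ι ι R) : Prop :=
  ∀ f, C A.det * f ∈ linIdeal A → f ∈ linIdeal A

lemma mem_map_of_mul_mem_map_of_hasLiftedSyzygies {B B' : Type*} [CommRing B] [CommRing B']
    {φ : B →+* B'} (hφ : HasLiftedSyzygies φ) {L : Ideal B} (hL : L.FG) {x : B}
    (hx : ∀ f, x * f ∈ L → f ∈ L) {f : B'} (hf : φ x * f ∈ L.map φ) : f ∈ L.map φ := by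
  obtain ⟨l, g, rfl⟩ := Submodule.fg_iff_exists_fin_generating_family.1 hL
  change _ ∈ Ideal.map φ (Ideal.span _) at hf
  rw [Ideal.map_span, ← Set.range_comp, Ideal.mem_span_range_iff_exists_fun] at hf
  obtain ⟨c, hc⟩ := hf
  have h := hφ (l + 1) (Fin.cons x g) (Fin.cons f fun i => - c i) (by
    simp only [Fin.sum_univ_succ, Fin.cons_zero, Fin.cons_succ, mul_neg, Finset.sum_neg_distrib]
    rw [← hc, add_neg_eq_zero]
    exact Finset.sum_congr rfl fun i _ => mul_comm _ _)
  have key : ∀ r ∈ syzygySpan φ (Fin.cons x g : Fin (l + 1) → B),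
      r 0 ∈ Ideal.map φ (Submodule.span B (Set.range g)) := by
    intro r hr
    induction hr using Submodule.span_induction with
    | mem r hr =>
      obtain ⟨s, hs, rfl⟩ := hr
      refine Ideal.mem_map_of_mem φ (hx _ ?_)
      simp only [Fin.sum_univ_succ, Fin.cons_zero, Fin.cons_succ] at hs
      rw [eq_neg_of_add_eq_zero_left hs]
      refine neg_mem (sum_mem fun i _ => Ideal.mul_mem_right _ _ (Ideal.subset_span ⟨i, rfl⟩))
    | zero => exact zero_mem _
    | add r s _ _ hr hs => exact add_mem hr hs
    | smul b r _ hr => exact Ideal.mul_mem_left _ _ hr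
  exact key _ h

attribute [local instance] MvPolynomial.algebraMvPolynomial in
lemma hasLiftedSyzygies_map {S R σ : Type*} [CommRing S] [CommRing R] {φ : S →+* R}
    (hφ : HasLiftedSyzygies φ) :
    HasLiftedSyzygies (MvPolynomial.map φ : MvPolynomial σ S →+* MvPolynomial σ R) := by
  let := φ.toAlgebra
  have : Module.Flat S R := flat_of_hasLiftedSyzygies hφ
  have h : Algebra.IsPushout S (MvPolynomial σ S) R (MvPolynomial σ R) := inferInstance
  have : Module.Flat (MvPolynomial σ S) (MvPolynomial σ R) := Module.Flat.isBaseChange _ _ _ _ h.out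
  exact hasLiftedSyzygies_of_flat

lemma map_linIdeal {ι S R : Type*} [Fintype ι] [CommRing S] [CommRing R] (φ : S →+* R)
    (A : Matrix ι ι S) : (linIdeal A).map (MvPolynomial.map φ) = linIdeal (A.map φ) := by
  rw [linIdeal, map_scalarIdeal, Matrix.map_mul, linIdeal]
  congr 2
  · ext1 i j
    simp
  · ext1 i j
    simp [symMat]

lemma fg_scalarIdeal {m R : Type*} [Finite m] [CommRing R] (M : Matrix m m R) :
    (scalarIdeal M).FG := by
  refine Submodule.fg_span (Set.Finite.union ?_ ?_)
  · refine (Set.finite_range fun q : m × m => M q.1 q.2).subset ?_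
    rintro _ ⟨i, j, _, rfl⟩
    exact ⟨(i, j), rfl⟩
  · refine (Set.finite_range fun q : m × m => M q.1 q.1 - M q.2 q.2).subset ?_
    rintro _ ⟨i, j, rfl⟩
    exact ⟨(i, j), rfl⟩

theorem DetRegular.map {ι S R : Type*} [Fintype ι] [DecidableEq ι] [CommRing S] [CommRing R]
    {φ : S →+* R} (hφ : HasLiftedSyzygies φ) {A : Matrix ι ι S} (hA : DetRegular A) :
    DetRegular (A.map φ) := by
  intro f hf
  rw [← map_linIdeal] at hf ⊢
  refine mem_map_of_mul_mem_map_of_hasLiftedSyzygies (hasLiftedSyzygies_map hφ)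
    (fg_scalarIdeal _) hA ?_
  rwa [map_C, RingHom.map_det]

lemma detRegular_symMat_X {n : ℕ} {k : Type*} [CommRing k]
    (h : ∀ f, (genX n k).det * f ∈ genScalarIdeal n k → f ∈ genScalarIdeal n k) :
    DetRegular (symMat X : Matrix (Fin n) (Fin n) (MvPolynomial (Sym2 (Fin n)) k)) := by
  intro f hf
  let e := sumAlgEquiv k (Sym2 (Fin n)) (Sym2 (Fin n))
  have hX : (genX n k).map e = (symMat X : Matrix (Fin n) (Fin n) _).map C := by
    ext1 i j
    simp [genX, symMat, e]
  have hT : (genT n k).map e = symMat X := by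
    ext1 i j
    simp [genT, symMat, e]
  have hL : (genScalarIdeal n k).map e.toRingEquiv.toRingHom =
      linIdeal (symMat X : Matrix (Fin n) (Fin n) (MvPolynomial (Sym2 (Fin n)) k)) := by
    rw [genScalarIdeal, map_scalarIdeal, Matrix.map_mul]
    rw [linIdeal, ← hX, ← hT]
    rfl
  have hmem : ∀ g, e g ∈ linIdeal (symMat X : Matrix (Fin n) (Fin n) (MvPolynomial _ k)) ↔
      g ∈ genScalarIdeal n k := by
    intro g
    rw [← hL]
    constructor
    · intro hg
      obtain ⟨g', hg', h'⟩ := (Ideal.mem_map_iff_of_surjective _ e.surjective).1 hg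
      rwa [← e.injective h']
    · exact fun hg => Ideal.mem_map_of_mem e.toRingEquiv.toRingHom hg
  obtain ⟨g, rfl⟩ := e.surjective f
  rw [hmem]
  refine h g ?_
  rw [← hmem, map_mul]
  convert hf using 2
  have := RingHom.map_det e.toRingEquiv.toRingHom (genX n k)
  have h2 := RingHom.map_det (C : _ →+* MvPolynomial (Sym2 (Fin n)) _)
    (symMat X : Matrix (Fin n) (Fin n) (MvPolynomial (Sym2 (Fin n)) k))
  rw [h2]
  refine this.trans ?_
  congr 1

theorem detRegular_of_isRegSeq_of_generic {k R : Type*} [Field k] [CommRing R] [Algebra k R]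
    [IsNoetherianRing R] [IsLocalRing R] {m N : ℕ}
    (hk : ∀ f, (genX m k).det * f ∈ genScalarIdeal m k → f ∈ genScalarIdeal m k)
    (v : Sym2 (Fin m) → R) (e : Fin N ≃ Sym2 (Fin m)) (hv : IsRegSeq (v ∘ e))
    (hm : ∀ s, v s ∈ IsLocalRing.maximalIdeal R) : DetRegular (symMat v) := by
  have h := ((hv.hasLiftedSyzygies (k := k) fun i => hm _).comp_equiv
    (renameEquiv k e.symm).toRingEquiv)
  have := DetRegular.map h (detRegular_symMat_X hk)
  convert this using 1
  ext1 i j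
  simp [symMat]

theorem detRegular_of_isRegSeq (K : Type*) {R : Type*} [Field K] [CommRing R] [Algebra K R]
    [IsNoetherianRing R] [IsLocalRing R] {m N : ℕ} (i₀ : Fin m)
    (v : Sym2 (Fin m) → R) (e : Fin N ≃ Sym2 (Fin m)) (hv : IsRegSeq (v ∘ e))
    (hm : ∀ s, v s ∈ IsLocalRing.maximalIdeal R) : DetRegular (symMat v) := by
  obtain ⟨p, hp⟩ := CharP.exists K
  rcases CharP.char_is_prime_or_zero K p with h | rfl
  · have : Fact p.Prime := ⟨h⟩
    let : Algebra (ZMod p) R := ((algebraMap K R).comp (ZMod.castHom dvd_rfl K)).toAlgebra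
    exact detRegular_of_isRegSeq_of_generic (k := ZMod p)
      (fun f => mem_scalarIdeal_of_det_mul_mem_zmod p i₀) v e hv hm
  · have : CharZero K := CharP.charP_to_charZero K
    let : Algebra ℚ R := ((algebraMap K R).comp (algebraMap ℚ K)).toAlgebra
    exact detRegular_of_isRegSeq_of_generic (k := ℚ)
      (fun f => mem_genScalarIdeal_of_det_mul_mem_rat i₀) v e hv hm

end FlatTransfer

section Depth

variable {R : Type*} [CommRing R]

/-- `x` is a nonzerodivisor modulo `J`. -/
def IsRegularMod (J : Ideal R) (x : R) : Prop := ∀ y, x * y ∈ J → y ∈ J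

lemma exists_associatedPrime_of_notMem [IsNoetherianRing R] {J : Ideal R} {w : R} (hw : w ∉ J) :
    ∃ P ∈ associatedPrimes R (R ⧸ J), ∀ r, r * w ∈ J → r ∈ P := by
  obtain ⟨P, hP, hle⟩ := exists_le_isAssociatedPrime_of_isNoetherianRing R
    (Ideal.Quotient.mk J w) (by rwa [Ne, Ideal.Quotient.eq_zero_iff_mem])
  refine ⟨P, hP, fun r hr => hle ?_⟩
  rw [Submodule.mem_colon_singleton, Submodule.mem_bot]
  exact Ideal.Quotient.eq_zero_iff_mem.2 hr

lemma exists_of_mem_associatedPrimes [IsNoetherianRing R] {J P : Ideal R}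
    (hP : P ∈ associatedPrimes R (R ⧸ J)) : P.IsPrime ∧ ∃ w, w ∉ J ∧ ∀ r, r ∈ P ↔ r * w ∈ J := by
  obtain ⟨hp, x, hx⟩ := isAssociatedPrime_iff.1 (AssociatedPrimes.mem_iff.1 hP)
  obtain ⟨w, rfl⟩ := Ideal.Quotient.mk_surjective x
  have h : ∀ r, r ∈ P ↔ r * w ∈ J := fun r => by
    rw [hx, Submodule.mem_colon_singleton, Submodule.mem_bot]
    exact Ideal.Quotient.eq_zero_iff_mem
  refine ⟨hp, w, fun hw => hp.ne_top ?_, h⟩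
  rw [Ideal.eq_top_iff_one, h, one_mul]
  exact hw

lemma IsRegularMod.notMem_of_mem_associatedPrimes [IsNoetherianRing R] {J P : Ideal R} {x : R}
    (hx : IsRegularMod J x) (hP : P ∈ associatedPrimes R (R ⧸ J)) : x ∉ P := by
  obtain ⟨_, w, hw, h⟩ := exists_of_mem_associatedPrimes hP
  rw [h]
  exact fun h' => hw (hx _ h')

lemma IsRegularMod.sup_comm {J : Ideal R} {x z : R} (hx : IsRegularMod J x)
    (hz : IsRegularMod (J ⊔ Ideal.span {x}) z) : IsRegularMod (J ⊔ Ideal.span {z}) x := by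
  intro w hw
  obtain ⟨j, hj, b, hb, hjb⟩ := Submodule.mem_sup.1 hw
  obtain ⟨v, rfl⟩ := Ideal.mem_span_singleton.1 hb
  have h1 : v ∈ J ⊔ Ideal.span {x} := hz v (by
    rw [show z * v = -j + x * w by rw [← hjb]; ring]
    exact add_mem (Submodule.mem_sup_left (neg_mem hj)) (Submodule.mem_sup_right
      (Ideal.mul_mem_right _ _ (Ideal.mem_span_singleton_self x))))
  obtain ⟨j', hj', b, hb', rfl⟩ := Submodule.mem_sup.1 h1
  obtain ⟨u, rfl⟩ := Ideal.mem_span_singleton.1 hb'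
  have h2 : w - z * u ∈ J := hx _ (by
    rw [show x * (w - z * u) = j + z * j' by rw [mul_sub, ← hjb]; ring]
    exact add_mem hj (Ideal.mul_mem_left _ _ hj'))
  rw [← sub_add_cancel w (z * u)]
  exact add_mem (Submodule.mem_sup_left h2) (Submodule.mem_sup_right
      (Ideal.mul_mem_right _ _ (Ideal.mem_span_singleton_self z)))

variable [IsLocalRing R]

open IsLocalRing

/-- There is a regular sequence of length `t` on `R ⧸ J` inside the maximal ideal. -/
def DepthGE : ℕ → Ideal R → Prop
  | 0, _ => True
  | t + 1, J => ∃ x ∈ maximalIdeal R, IsRegularMod J x ∧ DepthGE t (J ⊔ Ideal.span {x})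

lemma maximalIdeal_notMem_associatedPrimes_sup [IsNoetherianRing R] {J : Ideal R} {x y z : R}
    (hy : IsRegularMod J y) (hx : IsRegularMod J x) (hzm : z ∈ maximalIdeal R)
    (hxm : x ∈ maximalIdeal R)
    (hz : IsRegularMod (J ⊔ Ideal.span {x}) z) :
    maximalIdeal R ∉ associatedPrimes R (R ⧸ (J ⊔ Ideal.span {y})) := by
  intro hP
  obtain ⟨_, w, hw, h⟩ := exists_of_mem_associatedPrimes hP
  obtain ⟨j, hj, b, hb, hjb⟩ := Submodule.mem_sup.1 ((h x).1 hxm)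
  obtain ⟨v, rfl⟩ := Ideal.mem_span_singleton.1 hb
  obtain ⟨j', hj', b, hb, hjb'⟩ := Submodule.mem_sup.1 ((h z).1 hzm)
  obtain ⟨u, rfl⟩ := Ideal.mem_span_singleton.1 hb
  have h1 : z * v - x * u ∈ J := hy _ (by
    rw [show y * (z * v - x * u) = x * j' - z * j by linear_combination z * hjb - x * hjb']
    exact sub_mem (Ideal.mul_mem_left _ _ hj') (Ideal.mul_mem_left _ _ hj))
  have h2 : v ∈ J ⊔ Ideal.span {x} := hz _ (by
    rw [← sub_add_cancel (z * v) (x * u)]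
    exact add_mem (Submodule.mem_sup_left h1) (Submodule.mem_sup_right
      (Ideal.mul_mem_right _ _ (Ideal.mem_span_singleton_self x))))
  obtain ⟨j2, hj2, b, hb2, rfl⟩ := Submodule.mem_sup.1 h2
  obtain ⟨u', rfl⟩ := Ideal.mem_span_singleton.1 hb2
  have h3 : w - y * u' ∈ J := hx _ (by
    rw [show x * (w - y * u') = j + y * j2 by linear_combination - hjb]
    exact add_mem hj (Ideal.mul_mem_left _ _ hj2))
  refine hw ?_
  rw [← sub_add_cancel w (y * u')]
  exact add_mem (Submodule.mem_sup_left h3) (Submodule.mem_sup_right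
      (Ideal.mul_mem_right _ _ (Ideal.mem_span_singleton_self y)))

lemma exists_isRegularMod_pair [IsNoetherianRing R] {J J' : Ideal R}
    (h : maximalIdeal R ∉ associatedPrimes R (R ⧸ J))
    (h' : maximalIdeal R ∉ associatedPrimes R (R ⧸ J')) :
    ∃ z ∈ maximalIdeal R, IsRegularMod J z ∧ IsRegularMod J' z := by
  classical
  let s : Finset (Ideal R) := (associatedPrimes.finite R (R ⧸ J)).toFinset ∪
    (associatedPrimes.finite R (R ⧸ J')).toFinset
  have hs : ∀ P ∈ s, P.IsPrime := by
    intro P hP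
    rcases Finset.mem_union.1 hP with hP | hP
    · exact ((Set.Finite.mem_toFinset _).1 hP).1
    · exact ((Set.Finite.mem_toFinset _).1 hP).1
  have hnot : ¬ ((maximalIdeal R : Set R) ⊆ ⋃ P ∈ (↑s : Set (Ideal R)), (P : Set R)) := by
    intro hsub
    obtain ⟨P, hP, hle⟩ := (Ideal.subset_union_prime (f := id) ⊤ ⊤ (fun P hP _ _ => hs P hP)).1 hsub
    have heq : maximalIdeal R = P :=
      (maximalIdeal.isMaximal R).eq_of_le (hs P hP).ne_top hle
    rcases Finset.mem_union.1 hP with hP | hP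
    · exact h (heq ▸ (Set.Finite.mem_toFinset _).1 hP)
    · exact h' (heq ▸ (Set.Finite.mem_toFinset _).1 hP)
  obtain ⟨z, hzm, hz⟩ := Set.not_subset.1 hnot
  simp only [Set.mem_iUnion, not_exists] at hz
  refine ⟨z, hzm, fun y hy => ?_, fun y hy => ?_⟩
  · by_contra hyJ
    obtain ⟨P, hP, hPy⟩ := exists_associatedPrime_of_notMem hyJ
    exact hz P (Finset.mem_union_left _ ((Set.Finite.mem_toFinset _).2 hP)) (hPy _ hy)
  · by_contra hyJ
    obtain ⟨P, hP, hPy⟩ := exists_associatedPrime_of_notMem hyJ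
    exact hz P (Finset.mem_union_right _ ((Set.Finite.mem_toFinset _).2 hP)) (hPy _ hy)

lemma DepthGE.sup_span_singleton [IsNoetherianRing R] {t : ℕ} {J : Ideal R} {y : R}
    (hJ : DepthGE (t + 1) J) (hym : y ∈ maximalIdeal R) (hy : IsRegularMod J y) :
    DepthGE t (J ⊔ Ideal.span {y}) := by
  induction t generalizing J y with
  | zero => trivial
  | succ s ih =>
    obtain ⟨x, hxm, hx, hJx⟩ := hJ
    obtain ⟨x', hxm', hx', -⟩ := id hJx
    obtain ⟨z, hzm, hzx, hzy⟩ := exists_isRegularMod_pair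
      (fun h => hx'.notMem_of_mem_associatedPrimes h hxm')
      (maximalIdeal_notMem_associatedPrimes_sup hy hx hxm' hxm hx')
    have h1 : DepthGE (s + 1) (J ⊔ Ideal.span {z}) :=
      ⟨x, hxm, hx.sup_comm hzx, by
        rw [sup_right_comm]
        exact ih hJx hzm hzx⟩
    refine ⟨z, hzm, hzy, ?_⟩
    rw [sup_right_comm]
    exact ih h1 hym (hy.sup_comm hzy)

lemma DepthGE.le_coheight [IsNoetherianRing R] {t : ℕ} {J : Ideal R} (hJ : DepthGE t J)
    (P : PrimeSpectrum R) (hP : P.asIdeal ∈ associatedPrimes R (R ⧸ J)) :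
    (t : ℕ∞) ≤ Order.coheight P := by
  induction t generalizing J P with
  | zero => simp
  | succ t ih =>
    obtain ⟨x, hxm, hx, hJx⟩ := hJ
    obtain ⟨_, w, hw, h⟩ := exists_of_mem_associatedPrimes hP
    let N : Ideal R := J.colon P.asIdeal
    have hN : ∀ v, v ∈ N ↔ ∀ r ∈ P.asIdeal, r * v ∈ J := by
      intro v
      rw [Submodule.mem_colon]
      simp only [smul_eq_mul, mul_comm v]
      rfl
    have hnot : ¬ N ≤ J ⊔ Ideal.span {x} := by
      intro hle
      have hle' : N ≤ J ⊔ maximalIdeal R • N := by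
        intro v hv
        obtain ⟨j, hj, b, hb, rfl⟩ := Submodule.mem_sup.1 (hle hv)
        obtain ⟨u, rfl⟩ := Ideal.mem_span_singleton.1 hb
        refine add_mem (Submodule.mem_sup_left hj) (Submodule.mem_sup_right
          (Submodule.smul_mem_smul hxm ?_))
        rw [hN] at hv ⊢
        intro r hr
        refine hx _ ?_
        rw [show x * (r * u) = r * (j + x * u) - r * j by ring]
        exact sub_mem (hv r hr) (Ideal.mul_mem_left _ _ hj)
      have hNJ : N ≤ J := Submodule.le_of_le_smul_of_le_jacobson_bot
        (IsNoetherian.noetherian N) (by rw [jacobson_eq_maximalIdeal _ bot_ne_top]) hle'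
      exact hw (hNJ ((hN w).2 fun r hr => (h r).1 hr))
    obtain ⟨v, hv, hvJ⟩ := SetLike.not_le_iff_exists.1 hnot
    obtain ⟨Q, hQ, hQv⟩ := exists_associatedPrime_of_notMem hvJ
    have hlt : P < ⟨Q, hQ.1⟩ := by
      refine lt_of_le_of_ne (fun r hr => hQv r (Submodule.mem_sup_left ((hN v).1 hv r hr))) ?_
      intro heq
      have hxQ : x ∈ Q := hQv x (Submodule.mem_sup_right
        (Ideal.mul_mem_right _ _ (Ideal.mem_span_singleton_self x)))
      refine hx.notMem_of_mem_associatedPrimes hP ?_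
      rw [heq]
      exact hxQ
    have := ih hJx ⟨Q, hQ.1⟩ hQ
    calc ((t + 1 : ℕ) : ℕ∞) = t + 1 := by push_cast; rfl
      _ ≤ Order.coheight (⟨Q, hQ.1⟩ : PrimeSpectrum R) + 1 := by gcongr
      _ ≤ _ := Order.coheight_add_one_le hlt

lemma IsRegSeq.depthGE {N : ℕ} {a : Fin N → R} (ha : IsRegSeq a)
    (ham : ∀ i, a i ∈ maximalIdeal R) {i : ℕ} (hi : i ≤ N) :
    DepthGE (N - i) (Ideal.span (a '' {j | (j : ℕ) < i})) := by
  induction h : N - i generalizing i with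
  | zero => trivial
  | succ t ih =>
    have hlt : i < N := by omega
    refine ⟨a ⟨i, hlt⟩, ham _, ha ⟨i, hlt⟩, ?_⟩
    have := ih (i := i + 1) (by omega) (by omega)
    rw [← Ideal.span_union, Set.union_singleton]
    convert this using 2
    rw [← Set.image_insert_eq]
    congr 1
    ext j
    simp only [Set.mem_insert_iff, Set.mem_ofPred_eq, Fin.ext_iff]
    omega

end Depth

section PolynomialRing

open MvPolynomial

lemma isRegularMod_map_C_of_monic {B : Type*} [CommRing B] (J : Ideal B) {h : Polynomial B}
    (hh : h.Monic) : IsRegularMod (J.map Polynomial.C) h := by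
  have key : ∀ y, y ∈ J.map Polynomial.C ↔ y.map (Ideal.Quotient.mk J) = 0 := by
    intro y
    rw [Ideal.mem_map_C_iff, Polynomial.ext_iff]
    simp [Polynomial.coeff_map, Ideal.Quotient.eq_zero_iff_mem]
  intro y hy
  rw [key] at hy ⊢
  rw [Polynomial.map_mul] at hy
  exact (hh.map _).mul_right_eq_zero_iff.1 hy

lemma isRegularMod_map_ringEquiv {B B' : Type*} [CommRing B] [CommRing B'] (e : B ≃+* B')
    {J : Ideal B} {x : B} (h : IsRegularMod (J.map e.toRingHom) (e x)) : IsRegularMod J x := by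
  intro y hy
  have h1 := h (e y) (by rw [← map_mul]; exact Ideal.mem_map_of_mem e.toRingHom hy)
  obtain ⟨y', hy', h'⟩ := (Ideal.mem_map_iff_of_surjective _ e.surjective).1 h1
  rwa [← e.injective h']

lemma isRegSeq_aeval_X_of_monic {K : Type*} [CommRing K] {d : ℕ} {g : Fin d → Polynomial K}
    (hg : ∀ i, (g i).Monic) :
    IsRegSeq fun i => Polynomial.aeval (X i : MvPolynomial (Fin d) K) (g i) := by
  intro i
  let e : MvPolynomial (Fin d) K ≃ₐ[K] Polynomial (MvPolynomial {j // j ≠ i} K) :=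
    (renameEquiv K (Equiv.optionSubtypeNe i).symm).trans (optionEquivLeft K _)
  have hei : e (X i) = Polynomial.X := by simp [e]
  have hej : ∀ j (hj : j ≠ i), e (X j) = Polynomial.C (X ⟨j, hj⟩) := by
    intro j hj
    simp [e, Equiv.optionSubtypeNe_symm_of_ne hj]
  refine isRegularMod_map_ringEquiv e.toRingEquiv ?_
  have h1 : (Ideal.span ((fun i => Polynomial.aeval (X i : MvPolynomial (Fin d) K) (g i)) ''
      {j | j < i})).map e.toRingEquiv.toRingHom =
      (Ideal.span ((fun j : {j // j ≠ i} => Polynomial.aeval (X j :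
        MvPolynomial {j // j ≠ i} K) (g j)) '' {j | j.1 < i})).map Polynomial.C := by
    rw [Ideal.map_span, Ideal.map_span, Set.image_image, Set.image_image]
    congr 1
    have hval : ∀ j (hj : j ≠ i), e (Polynomial.aeval (X j : MvPolynomial (Fin d) K) (g j)) =
        Polynomial.C (Polynomial.aeval (X ⟨j, hj⟩ : MvPolynomial {j // j ≠ i} K) (g j)) := by
      intro j hj
      rw [← Polynomial.aeval_algHom_apply, hej j hj]
      exact (Polynomial.aeval_algHom_apply Polynomial.CAlgHom _ _)
    ext y
    constructor
    · rintro ⟨j, hj, rfl⟩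
      exact ⟨⟨j, ne_of_lt hj⟩, hj, (hval j (ne_of_lt hj)).symm⟩
    · rintro ⟨j, hj, rfl⟩
      exact ⟨j, hj, hval j j.2⟩
  rw [h1]
  apply isRegularMod_map_C_of_monic
  have h2 : e (Polynomial.aeval (X i : MvPolynomial (Fin d) K) (g i)) = (g i).map C := by
    rw [← Polynomial.aeval_algHom_apply, hei, Polynomial.aeval_X_left_eq_map]
    rfl
  change (e _).Monic
  rw [h2]
  exact (hg i).map _

lemma exists_monic_aeval_X_mem {K : Type*} [Field K] {d : ℕ}
    (𝔭 : Ideal (MvPolynomial (Fin d) K)) [h𝔭 : 𝔭.IsMaximal] (i : Fin d) :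
    ∃ g : Polynomial K, g.Monic ∧ Polynomial.aeval (X i : MvPolynomial (Fin d) K) g ∈ 𝔭 := by
  let := Ideal.Quotient.field 𝔭
  have : Module.Finite K (MvPolynomial (Fin d) K ⧸ 𝔭) :=
    finite_of_finite_type_of_isJacobsonRing K _
  obtain ⟨g, hg, h⟩ := Algebra.IsIntegral.isIntegral (R := K) (Ideal.Quotient.mk 𝔭 (X i))
  refine ⟨g, hg, ?_⟩
  rw [← Ideal.Quotient.eq_zero_iff_mem, ← h]
  exact (Polynomial.aeval_algHom_apply (Ideal.Quotient.mkₐ K 𝔭) _ _).symm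

lemma IsRegSeq.localization {B B' : Type*} [CommRing B] [CommRing B'] [Algebra B B']
    (M : Submonoid B) [IsLocalization M B'] {N : ℕ} {a : Fin N → B} (ha : IsRegSeq a) :
    IsRegSeq fun i => algebraMap B B' (a i) := by
  intro i y hy
  have himg : (fun i => algebraMap B B' (a i)) '' {j | j < i} =
      (algebraMap B B') '' (a '' {j | j < i}) := by rw [Set.image_image]
  rw [himg, ← Ideal.map_span] at hy ⊢
  obtain ⟨⟨b, s⟩, hbs⟩ := IsLocalization.surj M y
  have h1 : algebraMap B B' (a i * b) ∈ (Ideal.span (a '' {j | j < i})).map (algebraMap B B') := by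
    rw [map_mul, ← hbs, ← mul_assoc]
    exact Ideal.mul_mem_right _ _ hy
  obtain ⟨t, ht, h2⟩ := (IsLocalization.algebraMap_mem_map_algebraMap_iff M B' _ _).1 h1
  have h3 := ha i (t * b) (by rwa [mul_left_comm])
  have h4 := Ideal.mem_map_of_mem (algebraMap B B') h3
  rw [map_mul, ← hbs, mul_comm y, ← mul_assoc, ← map_mul] at h4
  exact (Ideal.unit_mul_mem_iff_mem _ (IsLocalization.map_units B' (⟨t, ht⟩ * s))).1 h4

theorem depthGE_localization_mvPolynomial {K : Type*} [Field K] {d : ℕ}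
    (𝔭 : Ideal (MvPolynomial (Fin d) K)) [𝔭.IsMaximal] :
    DepthGE d (⊥ : Ideal (Localization.AtPrime 𝔭)) := by
  choose g hg h using exists_monic_aeval_X_mem 𝔭
  have hreg := (isRegSeq_aeval_X_of_monic hg).localization (B' := Localization.AtPrime 𝔭)
    𝔭.primeCompl
  have := hreg.depthGE (fun i => (IsLocalization.AtPrime.to_map_mem_maximal_iff
    (Localization.AtPrime 𝔭) 𝔭 _).2 (h i)) (i := 0) (Nat.zero_le _)
  simpa using this

end PolynomialRing

section RegularSequenceCriterion

variable {R : Type*} [CommRing R] [IsNoetherianRing R] [IsLocalRing R]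

open IsLocalRing

lemma exists_le_coheight_of_add_card_le {P : PrimeSpectrum R} {s : Finset R}
    (hs : ∀ x ∈ s, x ∈ maximalIdeal R) {c : ℕ} (h : ((c + s.card : ℕ) : ℕ∞) ≤ Order.coheight P) :
    ∃ Q : PrimeSpectrum R, P ≤ Q ∧ (∀ x ∈ s, x ∈ Q.asIdeal) ∧ (c : ℕ∞) ≤ Order.coheight Q := by
  classical
  have : Nontrivial (R ⧸ P.asIdeal) := Ideal.Quotient.nontrivial_iff.2 P.2.ne_top
  have hloc : IsLocalRing (R ⧸ P.asIdeal) :=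
    IsLocalRing.of_surjective' _ Ideal.Quotient.mk_surjective
  have hlh := IsLocalHom.of_surjective (Ideal.Quotient.mk P.asIdeal) Ideal.Quotient.mk_surjective
  let s' := s.image (Ideal.Quotient.mk P.asIdeal)
  have h1 : ((c + s.card : ℕ) : WithBot ℕ∞) ≤ ringKrullDim (R ⧸ P.asIdeal) := by
    have hz : PrimeSpectrum.zeroLocus (P.asIdeal : Set R) = Set.Ici P := by
      ext Q
      rfl
    rw [ringKrullDim_quotient, hz, ← Order.coheight_eq_krullDim_Ici]
    exact WithBot.coe_le_coe.2 h
  have h2 := ringKrullDim_le_ringKrullDim_quotient_add_card s' (by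
    rw [IsLocalRing.ringJacobson_eq_maximalIdeal]
    intro y hy
    obtain ⟨x, hx, rfl⟩ := Finset.mem_image.1 hy
    exact ((mem_maximalIdeal _).1 (hs x hx)) ∘ fun hu => hlh.map_nonunit x hu)
  have h3 : (c : WithBot ℕ∞) ≤
      ringKrullDim ((R ⧸ P.asIdeal) ⧸ Ideal.span (s' : Set (R ⧸ P.asIdeal))) := by
    have hcard : ((s'.card : ℕ) : WithBot ℕ∞) ≤ s.card := by
      exact_mod_cast Finset.card_image_le
    have h4 := (h1.trans h2).trans (add_le_add_right hcard _)
    push_cast at h4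
    exact (ENat.WithBot.add_le_add_natCast_right_iff).1 h4
  obtain ⟨l, hl⟩ := Order.le_krullDim_iff.1 h3
  let f := (Ideal.Quotient.mk (Ideal.span (s' : Set (R ⧸ P.asIdeal)))).comp
    (Ideal.Quotient.mk P.asIdeal)
  have hf : Function.Surjective f :=
    Ideal.Quotient.mk_surjective.comp Ideal.Quotient.mk_surjective
  have hmono : StrictMono (PrimeSpectrum.comap f) :=
    Monotone.strictMono_of_injective (fun Q Q' h => Ideal.comap_mono h)
      (PrimeSpectrum.comap_injective_of_surjective f hf)
  refine ⟨PrimeSpectrum.comap f l.head, ?_, ?_, ?_⟩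
  · intro x hx
    change f x ∈ l.head.asIdeal
    have : f x = 0 := by
      rw [RingHom.comp_apply, Ideal.Quotient.eq_zero_iff_mem.2 hx, map_zero]
    rw [this]
    exact zero_mem _
  · intro x hx
    change f x ∈ l.head.asIdeal
    have : f x = 0 := by
      rw [RingHom.comp_apply, Ideal.Quotient.eq_zero_iff_mem]
      exact Ideal.subset_span (Finset.mem_coe.2 (Finset.mem_image_of_mem _ hx))
    rw [this]
    exact zero_mem _
  · have := Order.length_le_coheight (x := PrimeSpectrum.comap f l.head)
      (p := l.map _ hmono) (by simp)
    simpa [hl] using this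

theorem isRegSeq_of_le_height {d : ℕ} (hdepth : DepthGE d (⊥ : Ideal R))
    (hdim : ringKrullDim R ≤ d) {N : ℕ} {a : Fin N → R} (ham : ∀ i, a i ∈ maximalIdeal R)
    (hht : ∀ Q : PrimeSpectrum R, (∀ i, a i ∈ Q.asIdeal) → (N : ℕ∞) ≤ Order.height Q) :
    IsRegSeq a := by
  classical
  have hsum : ∀ Q : PrimeSpectrum R, Order.height Q + Order.coheight Q ≤ d := by
    intro Q
    have h1 : ((⨆ a : PrimeSpectrum R, Order.height a + Order.coheight a : ℕ∞) : WithBot ℕ∞) ≤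
        ((d : ℕ∞) : WithBot ℕ∞) := by
      rw [← Order.krullDim_eq_iSup_height_add_coheight_of_nonempty]
      exact hdim
    exact (le_iSup (fun a : PrimeSpectrum R => Order.height a + Order.coheight a) Q).trans
      (WithBot.coe_le_coe.1 h1)
  have hNd : N ≤ d := by
    have h1 := hht (closedPoint R) ham
    have h2 := (le_self_add).trans (hsum (closedPoint R))
    exact_mod_cast h1.trans h2
  have hreg : ∀ i (hi : i < N), DepthGE (d - i) (Ideal.span (a '' {j | (j : ℕ) < i})) →
      IsRegularMod (Ideal.span (a '' {j | (j : ℕ) < i})) (a ⟨i, hi⟩) := by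
    intro i hi hD y hy
    by_contra hyJ
    obtain ⟨P, hP, hPy⟩ := exists_associatedPrime_of_notMem hyJ
    have hco := hD.le_coheight ⟨P, hP.1⟩ hP
    let s : Finset R := (Finset.univ.filter fun j : Fin N => i < j).image a
    have hcard : s.card ≤ N - i - 1 := by
      refine Finset.card_image_le.trans ?_
      have : (Finset.univ.filter fun j : Fin N => i < j) = Finset.Ioi (⟨i, hi⟩ : Fin N) := by
        ext j
        simp [Fin.lt_def]
      rw [this, Fin.card_Ioi]
      simp
      omega
    obtain ⟨Q, hPQ, hsQ, hQ⟩ := exists_le_coheight_of_add_card_le (P := ⟨P, hP.1⟩) (s := s)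
      (c := d - N + 1) (fun x hx => by
        obtain ⟨j, _, rfl⟩ := Finset.mem_image.1 hx
        exact ham j) (le_trans (by exact_mod_cast (by omega)) hco)
    have hNQ := hht Q (fun j => by
      rcases lt_trichotomy (j : ℕ) i with h | h | h
      · exact hPQ (hPy _ (Ideal.mul_mem_right _ _ (Ideal.subset_span ⟨j, h, rfl⟩)))
      · have : j = ⟨i, hi⟩ := Fin.ext h
        rw [this]
        exact hPQ (hPy _ hy)
      · exact hsQ _ (Finset.mem_image_of_mem _ (by simpa using h)))
    have h1 := (add_le_add hNQ hQ).trans (hsum Q)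
    have h2 : N + (d - N + 1) ≤ d := by exact_mod_cast h1
    omega
  have hD : ∀ i ≤ N, DepthGE (d - i) (Ideal.span (a '' {j | (j : ℕ) < i})) := by
    intro i
    induction i with
    | zero => simpa using hdepth
    | succ i ih =>
      intro hi
      have h0 := ih (by omega)
      have h1 := DepthGE.sup_span_singleton (t := d - (i + 1))
        (by rwa [show d - (i + 1) + 1 = d - i by omega]) (ham ⟨i, hi⟩) (hreg i hi h0)
      rw [← Ideal.span_union, Set.union_singleton, ← Set.image_insert_eq] at h1
      convert h1 using 3
      ext j
      simp only [Set.mem_insert_iff, Set.mem_ofPred_eq, Fin.ext_iff]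
      omega
  intro i
  exact hreg i i.2 (hD i i.2.le)

end RegularSequenceCriterion

section SchurComplement

open MvPolynomial

lemma exists_symMat_eq {ι R : Type*} {M : Matrix ι ι R} (hM : M.IsSymm) :
    ∃ v : Sym2 ι → R, symMat v = M :=
  ⟨Sym2.lift ⟨fun i j => M i j, fun i j => hM.apply j i⟩, by ext i j; simp [symMat]⟩

lemma symMat_isSymm {ι R : Type*} (v : Sym2 ι → R) : (symMat v).IsSymm := by
  ext i j
  simp [symMat, Sym2.eq_swap]

lemma symMat_injective {ι R : Type*} {v w : Sym2 ι → R} (h : symMat v = symMat w) : v = w := by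
  ext z
  induction z using Sym2.ind with
  | _ i j => exact congrFun (congrFun h i) j

lemma scalarIdeal_le_ker_iff {ι S Q : Type*} [DecidableEq ι] [CommRing S] [CommRing Q]
    {M : Matrix ι ι S} {φ : S →+* Q} :
    scalarIdeal M ≤ RingHom.ker φ ↔ ∃ s : Q, M.map φ = s • (1 : Matrix ι ι Q) := by
  rw [scalarIdeal_le_iff]
  simp only [RingHom.mem_ker, map_sub, sub_eq_zero]
  constructor
  · rintro ⟨h1, h2⟩
    rcases isEmpty_or_nonempty ι with h | ⟨⟨i₀⟩⟩
    · exact ⟨0, Subsingleton.elim _ _⟩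
    · refine ⟨φ (M i₀ i₀), ?_⟩
      ext i j
      by_cases hij : i = j
      · subst hij
        simp [h2 i i₀]
      · simp [h1 i j hij, hij]
  · rintro ⟨s, hs⟩
    have h : ∀ i j, φ (M i j) = (s • (1 : Matrix ι ι Q)) i j := fun i j =>
      congrFun (congrFun hs i) j
    refine ⟨fun i j hij => ?_, fun i j => ?_⟩
    · rw [h]
      simp [hij]
    · rw [h, h]
      simp

lemma linIdeal_le_ker_iff {ι R Q : Type*} [Fintype ι] [DecidableEq ι] [CommRing R] [CommRing Q]
    [Algebra R Q] {A : Matrix ι ι R} {φ : MvPolynomial (Sym2 ι) R →ₐ[R] Q} :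
    linIdeal A ≤ RingHom.ker φ.toRingHom ↔
      ∃ s : Q, A.map (algebraMap R Q) * symMat (fun z => φ (X z)) = s • (1 : Matrix ι ι Q) := by
  rw [linIdeal, scalarIdeal_le_ker_iff, Matrix.map_mul]
  have h1 : (A.map (C (σ := Sym2 ι))).map φ.toRingHom = A.map (algebraMap R Q) := by
    ext i j
    simp
  have h2 : (symMat (X (R := R) : Sym2 ι → _)).map φ.toRingHom = symMat fun z => φ (X z) := by
    ext i j
    simp [symMat]
  rw [h1, h2]

lemma exists_linIdeal_mk {ι R : Type*} [Fintype ι] [DecidableEq ι] [CommRing R]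
    (A : Matrix ι ι R) : ∃ s : MvPolynomial (Sym2 ι) R ⧸ linIdeal A,
      A.map (algebraMap R (MvPolynomial (Sym2 ι) R ⧸ linIdeal A)) *
      symMat (fun z => Ideal.Quotient.mkₐ R (linIdeal A) (X z)) =
        s • (1 : Matrix ι ι (MvPolynomial (Sym2 ι) R ⧸ linIdeal A)) := by
  rw [← linIdeal_le_ker_iff]
  intro f hf
  exact Ideal.Quotient.eq_zero_iff_mem.2 hf

lemma DetRegular.of_retract {ι κ R : Type*} [Fintype ι] [DecidableEq ι] [Fintype κ] [DecidableEq κ]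
    [CommRing R] {A : Matrix ι ι R} {A' : Matrix κ κ R} (h : DetRegular A')
    (Φ : MvPolynomial (Sym2 ι) R →ₐ[R] MvPolynomial (Sym2 κ) R)
    (Ψ : MvPolynomial (Sym2 κ) R →ₐ[R] MvPolynomial (Sym2 ι) R)
    {u : R} (hu : IsUnit u) (hdet : A.det = u * A'.det)
    (hΦ : linIdeal A ≤ RingHom.ker ((Ideal.Quotient.mkₐ R (linIdeal A')).comp Φ).toRingHom)
    (hΨ : linIdeal A' ≤ RingHom.ker ((Ideal.Quotient.mkₐ R (linIdeal A)).comp Ψ).toRingHom)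
    (hΨΦ : ∀ z, Ideal.Quotient.mkₐ R (linIdeal A) (Ψ (Φ (X z))) =
      Ideal.Quotient.mkₐ R (linIdeal A) (X z)) : DetRegular A := by
  intro f hf
  have h1 : Φ (C A.det * f) ∈ linIdeal A' := Ideal.Quotient.eq_zero_iff_mem.1 (hΦ hf)
  rw [map_mul, algHom_C, algebraMap_eq, hdet, map_mul, mul_assoc] at h1
  have h2 := h _ ((Ideal.unit_mul_mem_iff_mem _ (hu.map C)).1 h1)
  have h3 : Ideal.Quotient.mkₐ R (linIdeal A) (Ψ (Φ f)) = 0 := hΨ h2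
  have h4 : ((Ideal.Quotient.mkₐ R (linIdeal A)).comp Ψ).comp Φ =
      Ideal.Quotient.mkₐ R (linIdeal A) := by
    apply MvPolynomial.algHom_ext
    exact hΨΦ
  have h5 := DFunLike.congr_fun h4 f
  rw [← Ideal.Quotient.eq_zero_iff_mem]
  exact h5.symm.trans h3

theorem DetRegular.of_submatrix {ι κ R : Type*} [Fintype ι] [DecidableEq ι] [Fintype κ]
    [DecidableEq κ] [CommRing R] {A : Matrix κ κ R} (e : ι ≃ κ)
    (h : DetRegular (A.submatrix e e)) : DetRegular A := by
  refine h.of_retract (rename (Sym2.map e.symm)) (rename (Sym2.map e)) isUnit_one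
    (by rw [one_mul, det_submatrix_equiv_self]) ?_ ?_ ?_
  · rw [linIdeal_le_ker_iff]
    obtain ⟨s, hs⟩ := exists_linIdeal_mk (A.submatrix e e)
    refine ⟨s, ?_⟩
    have := congrArg (fun M => M.submatrix e.symm e.symm) hs
    beta_reduce at this
    rw [← submatrix_mul_equiv _ _ _ e.symm] at this
    convert this using 1
    · congr 1
      · ext i j
        simp
      · ext i j
        simp [symMat]
    · ext i j
      simp [Matrix.one_apply]
  · rw [linIdeal_le_ker_iff]
    obtain ⟨s, hs⟩ := exists_linIdeal_mk A
    refine ⟨s, ?_⟩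
    have := congrArg (fun M => M.submatrix e e) hs
    beta_reduce at this
    rw [← submatrix_mul_equiv _ _ _ e] at this
    convert this using 1
    · congr 1
      ext i j
      simp [symMat]
    · ext i j
      simp [Matrix.one_apply]
  · intro z
    rw [rename_X, rename_X, Sym2.map_map]
    simp

universe u

variable {α β : Type} [Fintype α] [DecidableEq α] [Fintype β] [DecidableEq β]

lemma fromBlocks_mul_eq_smul_one {Q : Type*} [CommRing Q] {B B' : Matrix α α Q} {E : Matrix α β Q}
    {D T : Matrix β β Q} {s : Q} (hB : B * B' = 1) (hBs : B.IsSymm)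
    (hT : (D - Eᵀ * B * E) * T = s • (1 : Matrix β β Q)) :
    fromBlocks B (B * E) (B * E)ᵀ D *
      fromBlocks (s • B' + E * T * Eᵀ) (-(E * T)) (-(T * Eᵀ)) T = s • 1 := by
  have hT' : D * T = s • (1 : Matrix β β Q) + Eᵀ * B * E * T := by
    rw [← hT, Matrix.sub_mul, sub_add_cancel]
  rw [fromBlocks_multiply, transpose_mul, hBs.eq, ← fromBlocks_one, fromBlocks_smul]
  congr 1
  · rw [Matrix.mul_add, Matrix.mul_smul, hB, Matrix.mul_neg]
    simp only [Matrix.mul_assoc]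
    rw [add_neg_cancel_right]
  · rw [Matrix.mul_neg]
    simp only [Matrix.mul_assoc, smul_zero]
    rw [neg_add_cancel]
  · rw [Matrix.mul_add, Matrix.mul_smul, Matrix.mul_assoc, hB, Matrix.mul_neg, ← Matrix.mul_assoc D,
      hT', Matrix.add_mul]
    simp [Matrix.mul_assoc]
  · rw [Matrix.mul_neg, hT', ← Matrix.mul_assoc, neg_add_cancel_comm_assoc]

lemma eq_of_fromBlocks_mul_eq_smul_one {Q : Type*} [CommRing Q] {B B' : Matrix α α Q}
    {E : Matrix α β Q} {D : Matrix β β Q} {T₁ : Matrix α α Q} {T₂ : Matrix α β Q} {T : Matrix β β Q}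
    {s : Q} (hB : B' * B = 1) (hBs : B.IsSymm) (hTs : T.IsSymm)
    (hT : fromBlocks B (B * E) (B * E)ᵀ D * fromBlocks T₁ T₂ T₂ᵀ T = s • 1) :
    (D - Eᵀ * B * E) * T = s • (1 : Matrix β β Q) ∧
      fromBlocks T₁ T₂ T₂ᵀ T = fromBlocks (s • B' + E * T * Eᵀ) (-(E * T)) (-(T * Eᵀ)) T := by
  rw [fromBlocks_multiply, transpose_mul, hBs.eq, ← fromBlocks_one, fromBlocks_smul,
    fromBlocks_inj] at hT
  obtain ⟨h11, h12, -, h22⟩ := hT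
  have h2 : T₂ = -(E * T) := by
    have := congrArg (fun M => B' * M) h12
    simp only [Matrix.mul_add, ← Matrix.mul_assoc, hB, Matrix.one_mul, smul_zero,
      Matrix.mul_zero] at this
    exact eq_neg_of_add_eq_zero_left this
  have h2' : T₂ᵀ = -(T * Eᵀ) := by
    rw [h2, transpose_neg, transpose_mul, hTs.eq]
  constructor
  · rw [← h22, h2, Matrix.sub_mul, Matrix.mul_neg]
    simp only [Matrix.mul_assoc]
    abel
  · rw [h2', ← h2]
    congr 1
    have := congrArg (fun M => B' * M) h11
    simp only [Matrix.mul_add, ← Matrix.mul_assoc, hB, Matrix.one_mul, h2', Matrix.mul_neg,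
      Matrix.mul_smul, Matrix.mul_one] at this
    rw [← this]
    abel

theorem DetRegular.of_schur {R : Type u} [CommRing R] [Nonempty β] {B B' : Matrix α α R}
    {E : Matrix α β R} {D : Matrix β β R} (hB : B * B' = 1) (hBs : B.IsSymm)
    (h : DetRegular (D - Eᵀ * B * E)) : DetRegular (fromBlocks B (B * E) (B * E)ᵀ D) := by
  have hB' : B' * B = 1 := mul_eq_one_comm.1 hB
  have hBs' : B'.IsSymm := by
    have h1 : B'ᵀ * B = 1 := by
      rw [← hBs.eq, ← transpose_mul, hB, transpose_one]
    calc B'ᵀ = B'ᵀ * (B * B') := by rw [hB, Matrix.mul_one]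
      _ = B' := by rw [← Matrix.mul_assoc, h1, Matrix.one_mul]
  obtain ⟨b₀⟩ := ‹Nonempty β›
  let A' := D - Eᵀ * B * E
  let T : Matrix β β (MvPolynomial (Sym2 β) R) := symMat X
  let A'C : Matrix β β (MvPolynomial (Sym2 β) R) := A'.map C
  let E' : Matrix α β (MvPolynomial (Sym2 β) R) := E.map C
  let B'' : Matrix α α (MvPolynomial (Sym2 β) R) := B'.map C
  let s : MvPolynomial (Sym2 β) R := (A'C * T) b₀ b₀
  let M : Matrix (α ⊕ β) (α ⊕ β) (MvPolynomial (Sym2 β) R) :=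
    fromBlocks (s • B'' + E' * T * E'ᵀ) (-(E' * T)) (-(T * E'ᵀ)) T
  have hTs : T.IsSymm := symMat_isSymm _
  have hM : M.IsSymm := by
    refine IsSymm.fromBlocks ?_ ?_ hTs
    · have h1 : B''ᵀ = B'' := by
        rw [← transpose_map, hBs'.eq]
      rw [IsSymm, transpose_add, transpose_smul, h1, transpose_mul, transpose_mul, hTs.eq,
        transpose_transpose, Matrix.mul_assoc]
    · rw [transpose_neg, transpose_mul, hTs.eq]
  obtain ⟨v, hv⟩ := exists_symMat_eq hM
  have hdet : (fromBlocks B (B * E) (B * E)ᵀ D).det = B.det * A'.det := by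
    let := invertibleOfRightInverse B B' hB
    rw [det_fromBlocks₁₁, transpose_mul, hBs.eq, invOf_eq_right_inv hB]
    congr 2
    rw [Matrix.mul_assoc Eᵀ B B', hB, Matrix.mul_one, ← Matrix.mul_assoc]
  have hmap : ∀ {Q : Type u} [CommRing Q] [Algebra R Q] (ψ : MvPolynomial (Sym2 β) R →ₐ[R] Q),
      symMat (fun z => ψ (aeval v (X z : MvPolynomial (Sym2 (α ⊕ β)) R))) = fromBlocks
        (ψ s • B'.map (algebraMap R Q) +
          E.map (algebraMap R Q) * T.map ψ * (E.map (algebraMap R Q))ᵀ)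
        (-(E.map (algebraMap R Q) * T.map ψ)) (-(T.map ψ * (E.map (algebraMap R Q))ᵀ))
        (T.map ψ) := by
    intro Q _ _ ψ
    have h1 : symMat (fun z => ψ (aeval v (X z : MvPolynomial (Sym2 (α ⊕ β)) R))) = M.map ψ := by
      rw [← hv]
      ext i j
      simp [symMat]
    have hE : E'.map ψ = E.map (algebraMap R Q) := by
      ext i j
      simp [E']
    have hB1 : B''.map ψ = B'.map (algebraMap R Q) := by
      ext i j
      simp [B'']
    rw [h1, fromBlocks_map, ← hE, ← hB1]
    congr 1
    · rw [Matrix.map_add _ (map_add ψ), Matrix.map_mul, Matrix.map_mul, transpose_map]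
      congr 1
      ext i j
      simp
    · have h2 : (E' * T).map ψ = E'.map ψ * T.map ψ := Matrix.map_mul
      rw [← h2, Matrix.map_neg _ (map_neg ψ)]
    · have h2 : (T * E'ᵀ).map ψ = T.map ψ * E'ᵀ.map ψ := Matrix.map_mul
      rw [← transpose_map (M := E'), ← h2, Matrix.map_neg _ (map_neg ψ)]
  have hblocks : ∀ {Q : Type u} [CommRing Q] [Algebra R Q],
      (fromBlocks B (B * E) (B * E)ᵀ D).map (algebraMap R Q) =
        fromBlocks (B.map (algebraMap R Q)) (B.map (algebraMap R Q) * E.map (algebraMap R Q))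
          (B.map (algebraMap R Q) * E.map (algebraMap R Q))ᵀ (D.map (algebraMap R Q)) := by
    intro Q _ _
    rw [fromBlocks_map, transpose_map, Matrix.map_mul]
  have hA' : ∀ {Q : Type u} [CommRing Q] [Algebra R Q], A'.map (algebraMap R Q) =
      D.map (algebraMap R Q) - (E.map (algebraMap R Q))ᵀ * B.map (algebraMap R Q) *
        E.map (algebraMap R Q) := by
    intro Q _ _
    rw [Matrix.map_sub _ (map_sub _), Matrix.map_mul, Matrix.map_mul, transpose_map]
  have hs : ∀ {Q : Type u} [CommRing Q] [Algebra R Q] (ψ : MvPolynomial (Sym2 β) R →ₐ[R] Q) (t : Q),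
      A'.map (algebraMap R Q) * T.map ψ = t • (1 : Matrix β β Q) → ψ s = t := by
    intro Q _ _ ψ t ht
    have h1 := congrFun (congrFun ht b₀) b₀
    have h2 : A'C.map ψ = A'.map (algebraMap R Q) := by
      ext i j
      simp [A'C]
    rw [← h2] at h1
    have h3 : ((A'C * T).map ψ : Matrix β β Q) = A'C.map ψ * T.map ψ := Matrix.map_mul
    rw [← h3] at h1
    simpa using h1
  have hBmap : ∀ {Q : Type u} [CommRing Q] [Algebra R Q],
      B.map (algebraMap R Q) * B'.map (algebraMap R Q) = 1 := by
    intro Q _ _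
    rw [← Matrix.map_mul, hB, Matrix.map_one _ (map_zero _) (map_one _)]
  have hBsmap : ∀ {Q : Type u} [CommRing Q] [Algebra R Q], (B.map (algebraMap R Q)).IsSymm := by
    intro Q _ _
    rw [IsSymm, ← transpose_map, hBs.eq]
  obtain ⟨t, ht⟩ := exists_linIdeal_mk (fromBlocks B (B * E) (B * E)ᵀ D)
  let q := Ideal.Quotient.mkₐ R (linIdeal (fromBlocks B (B * E) (B * E)ᵀ D))
  let ψ := q.comp (rename (Sym2.map Sum.inr) : MvPolynomial (Sym2 β) R →ₐ[R] _)
  let W := symMat (fun z => q (X z))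
  have hWb : W = fromBlocks W.toBlocks₁₁ W.toBlocks₁₂ W.toBlocks₁₂ᵀ (T.map ψ) := by
    conv_lhs => rw [← fromBlocks_toBlocks W]
    congr 1
    · ext i j
      simp [W, symMat, toBlocks₁₂, toBlocks₂₁, Sym2.eq_swap]
    · ext i j
      simp [W, symMat, toBlocks₂₂, T, ψ]
  have hTψs : (T.map ψ).IsSymm := by
    rw [IsSymm, ← transpose_map, hTs.eq]
  change (fromBlocks B (B * E) (B * E)ᵀ D).map (algebraMap R _) * W = _ at ht
  rw [hWb, hblocks] at ht
  obtain ⟨hW1, hW2⟩ := eq_of_fromBlocks_mul_eq_smul_one (mul_eq_one_comm.1 hBmap) hBsmap hTψs ht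
  rw [← hA'] at hW1
  have hTψ : symMat (fun z => ψ (X z)) = T.map ψ := by
    ext i j
    simp [symMat, T]
  refine h.of_retract (aeval v) (rename (Sym2.map Sum.inr)) (u := B.det)
    ((isUnit_iff_isUnit_det B).1 (IsUnit.of_mul_eq_one _ hB)) hdet ?_ ?_ ?_
  · rw [linIdeal_le_ker_iff]
    obtain ⟨t, ht⟩ := exists_linIdeal_mk A'
    let q := Ideal.Quotient.mkₐ R (linIdeal A')
    have hT : symMat (fun z => q (X z)) = T.map q := by
      ext i j
      simp [symMat, T]
    rw [hT] at ht
    refine ⟨t, ?_⟩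
    rw [hblocks]
    have h1 := hmap q
    rw [hs q t ht] at h1
    rw [hA'] at ht
    exact (congrArg _ h1).trans (fromBlocks_mul_eq_smul_one hBmap hBsmap ht)
  · rw [linIdeal_le_ker_iff]
    refine ⟨t, ?_⟩
    rw [← hW1, ← hTψ]
  · intro z
    have h1 := hmap ψ
    rw [hs ψ t hW1, ← hW2] at h1
    exact congrFun (symMat_injective (h1.trans hWb.symm)) z

end SchurComplement

section SchurSelection

open IsLocalRing

lemma exists_sum_equiv_of_injective {r n : ℕ} {f : Fin r → Fin n} (hf : Function.Injective f) :
    ∃ (m : ℕ) (e : Fin r ⊕ Fin m ≃ Fin n), ∀ i, e (Sum.inl i) = f i := by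
  classical
  refine ⟨_, ((Equiv.ofInjective f hf).sumCongr
    (Fintype.equivFin ((Set.range f)ᶜ : Set (Fin n))).symm).trans
    (Equiv.Set.sumCompl (Set.range f)), fun i => ?_⟩
  simp

lemma det_submatrix_sumMap_schur {R α β γ : Type*} [CommRing R] [Fintype α] [DecidableEq α]
    [Fintype β] [Fintype γ] [DecidableEq γ] {B B' : Matrix α α R} {E : Matrix α β R}
    {D : Matrix β β R} (hB : B * B' = 1) (hBs : B.IsSymm) (g : γ → β) :
    ((fromBlocks B (B * E) (B * E)ᵀ D).submatrix (Sum.map id g) (Sum.map id g)).det =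
      B.det * ((D - Eᵀ * B * E).submatrix g g).det := by
  have h : (fromBlocks B (B * E) (B * E)ᵀ D).submatrix (Sum.map id g) (Sum.map id g) =
      fromBlocks B ((B * E).submatrix id g) ((B * E)ᵀ.submatrix g id) (D.submatrix g g) := by
    ext (i | i) (j | j) <;> simp
  let := invertibleOfRightInverse B B' hB
  rw [h, det_fromBlocks₁₁, invOf_eq_right_inv hB]
  congr 2
  rw [submatrix_sub]
  congr 1
  have h2 : (B * E)ᵀ * B' * (B * E) = Eᵀ * B * E := by
    rw [transpose_mul, hBs.eq, Matrix.mul_assoc Eᵀ, hB, Matrix.mul_one, Matrix.mul_assoc]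
  rw [← h2]
  ext i j
  simp [Matrix.mul_apply]

lemma exists_schur_complement {R : Type*} [CommRing R] [IsLocalRing R] {n : ℕ}
    {A : Matrix (Fin n) (Fin n) R} (hA : A.IsSymm) :
    ∃ (r m : ℕ) (e : Fin r ⊕ Fin m ≃ Fin n) (B B' : Matrix (Fin r) (Fin r) R)
      (E : Matrix (Fin r) (Fin m) R) (D : Matrix (Fin m) (Fin m) R),
      A.submatrix e e = fromBlocks B (B * E) (B * E)ᵀ D ∧ B * B' = 1 ∧ B.IsSymm ∧ D.IsSymm ∧
        ∀ i j, (D - Eᵀ * B * E) i j ∈ maximalIdeal R := by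
  classical
  let P : ℕ → Prop := fun r =>
    ∃ f : Fin r → Fin n, Function.Injective f ∧ IsUnit (A.submatrix f f).det
  have hP0 : P 0 := ⟨fun i => i.elim0, fun i => i.elim0, by simp⟩
  obtain ⟨f, hf, hfu⟩ : P (Nat.findGreatest P n) := Nat.findGreatest_spec (Nat.zero_le n) hP0
  have hmax : ∀ k, Nat.findGreatest P n < k → k ≤ n → ¬ P k := fun k h1 h2 =>
    Nat.findGreatest_is_greatest h1 h2
  generalize Nat.findGreatest P n = r at f hf hfu hmax
  obtain ⟨m, e, he⟩ := exists_sum_equiv_of_injective hf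
  let N := A.submatrix e e
  have hN : N.IsSymm := hA.submatrix e
  let B := N.toBlocks₁₁
  have hBf : B = A.submatrix f f := by
    ext i j
    simp [B, N, toBlocks₁₁, he]
  have hBu : IsUnit B.det := by rwa [hBf]
  let E := B⁻¹ * N.toBlocks₁₂
  have hBE : B * E = N.toBlocks₁₂ := mul_nonsing_inv_cancel_left _ _ hBu
  have hBs : B.IsSymm := by
    ext i j
    exact hN.apply _ _
  have hNb : N = fromBlocks B (B * E) (B * E)ᵀ N.toBlocks₂₂ := by
    rw [hBE]
    conv_lhs => rw [← fromBlocks_toBlocks N]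
    congr 1
    ext i j
    exact hN.apply _ _
  have hDs : N.toBlocks₂₂.IsSymm := by
    ext i j
    exact hN.apply _ _
  have hB : B * B⁻¹ = 1 := mul_nonsing_inv _ hBu
  refine ⟨r, m, e, B, B⁻¹, E, N.toBlocks₂₂, hNb, hB, hBs, hDs, ?_⟩
  let S := N.toBlocks₂₂ - Eᵀ * B * E
  have hS : S.IsSymm := by
    rw [IsSymm, transpose_sub, hDs.eq, transpose_mul _ E, transpose_mul Eᵀ B,
      transpose_transpose, hBs.eq, ← Matrix.mul_assoc]
  have key : ∀ (k : ℕ) (g : Fin k → Fin m), 0 < k → Function.Injective g →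
      (S.submatrix g g).det ∈ maximalIdeal R := by
    intro k g hk hg
    rw [mem_maximalIdeal, mem_nonunits_iff]
    intro hu
    let f' : Fin (r + k) → Fin n := e ∘ Sum.map id g ∘ finSumFinEquiv.symm
    have hf' : Function.Injective f' :=
      e.injective.comp ((Function.injective_id.sumMap hg).comp finSumFinEquiv.symm.injective)
    refine hmax (r + k) (by omega) (by simpa using Fintype.card_le_of_injective f' hf')
      ⟨f', hf', ?_⟩
    have h1 : A.submatrix f' f' = (N.submatrix (Sum.map id g) (Sum.map id g)).submatrix
        finSumFinEquiv.symm finSumFinEquiv.symm := rfl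
    rw [h1, det_submatrix_equiv_self, hNb, det_submatrix_sumMap_schur hB hBs]
    exact hBu.mul hu
  have hdiag : ∀ i, S i i ∈ maximalIdeal R := by
    intro i
    have h1 := key 1 ![i] one_pos (Function.injective_of_subsingleton _)
    rwa [det_fin_one] at h1
  intro i j
  change S i j ∈ _
  by_cases hij : i = j
  · subst hij
    exact hdiag i
  · have h1 := key 2 ![i, j] two_pos (by
      intro a b
      fin_cases a <;> fin_cases b <;> simp [hij, Ne.symm hij])
    simp only [det_fin_two, submatrix_apply, cons_val_zero, cons_val_one, hS.apply i j] at h1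
    have h2 : S i j * S i j ∈ maximalIdeal R := by
      have := (maximalIdeal R).sub_mem ((maximalIdeal R).mul_mem_left (S i i) (hdiag j)) h1
      simpa using this
    exact ((maximalIdeal.isMaximal R).isPrime.mem_or_mem h2).elim id id

end SchurSelection

section Heights

open IsLocalRing

lemma idealHeight_le_height {R : Type*} [CommRing R] {I q : Ideal R} [q.IsPrime] (h : I ≤ q) :
    idealHeight I ≤ q.height := by
  exact (iInf₂_le (⟨q, ‹_›⟩ : PrimeSpectrum R) h).trans
    (PrimeSpectrum.height_eq_orderHeight ⟨q, ‹_›⟩).ge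

lemma exists_height_eq_idealHeight {R : Type*} [CommRing R] {I : Ideal R} {k : ℕ}
    (h : idealHeight I = k) : ∃ q : Ideal R, q.IsPrime ∧ I ≤ q ∧ q.height = k := by
  have h1 : ∃ q : PrimeSpectrum R, I ≤ q.asIdeal ∧ Order.height q < k + 1 := by
    by_contra! h2
    have h3 : (k : ℕ∞) + 1 ≤ idealHeight I := le_iInf₂ fun q hq => h2 q hq
    rw [h] at h3
    norm_cast at h3
    omega
  obtain ⟨q, hq, hqk⟩ := h1
  refine ⟨q.asIdeal, q.isPrime, hq, le_antisymm ?_ ?_⟩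
  · rw [PrimeSpectrum.height_eq_orderHeight]
    exact Order.le_of_lt_add_one hqk
  · rw [← h]
    exact idealHeight_le_height hq

lemma det_mul_eq_zero_of_lt {R : Type*} [CommRing R] {r : ℕ} (P : Matrix (Fin (r + 1)) (Fin r) R)
    (Q : Matrix (Fin r) (Fin (r + 1)) R) : (P * Q).det = 0 := by
  let P' : Matrix (Fin (r + 1)) (Fin (r + 1)) R := of fun i => Fin.snoc (P i) 0
  let Q' : Matrix (Fin (r + 1)) (Fin (r + 1)) R :=
    of fun i j => Fin.snoc (α := fun _ => R) (fun k => Q k j) 0 i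
  have h : P * Q = P' * Q' := by
    ext i j
    simp [Matrix.mul_apply, Fin.sum_univ_castSucc, P', Q']
  rw [h, det_mul, det_eq_zero_of_column_eq_zero (A := P') (Fin.last r) (by simp [P']), zero_mul]

lemma minorsIdeal_le_comap_of_schur {R S : Type*} [CommRing R] [CommRing S] (φ : R →+* S) {r : ℕ}
    {β κ : Type*} [Fintype β] {A : Matrix κ κ R} {e : Fin r ⊕ β ≃ κ} {B : Matrix (Fin r) (Fin r) S}
    {E : Matrix (Fin r) β S} {D : Matrix β β S} (hBs : B.IsSymm)
    (hA : (A.map φ).submatrix e e = fromBlocks B (B * E) (B * E)ᵀ D) {q : Ideal S}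
    (hq : ∀ i j, (D - Eᵀ * B * E) i j ∈ q) : minorsIdeal (r + 1) A ≤ q.comap φ := by
  rw [minorsIdeal, Ideal.span_le]
  rintro x ⟨f, g, -, -, rfl⟩
  let π := Ideal.Quotient.mk q
  let P : Matrix (Fin r ⊕ β) (Fin r) (S ⧸ q) := fromRows (B.map π) ((Eᵀ * B).map π)
  let Q : Matrix (Fin r) (Fin r ⊕ β) (S ⧸ q) := fromCols 1 (E.map π)
  have h1 : ((A.map φ).submatrix e e).map π = P * Q := by
    have hD : D.map π = (Eᵀ * B * E).map π := by
      ext i j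
      have := Ideal.Quotient.eq_zero_iff_mem.2 (hq i j)
      rw [Matrix.sub_apply, map_sub, sub_eq_zero] at this
      exact this
    rw [hA, fromBlocks_map, fromRows_mul_fromCols, hD, transpose_mul, hBs.eq]
    simp only [Matrix.map_mul, Matrix.mul_one]
  have h2 : ((A.submatrix f g).map φ).map π =
      (P.submatrix (e.symm ∘ f) id) * (Q.submatrix id (e.symm ∘ g)) := by
    rw [← submatrix_mul _ _ _ _ _ Function.bijective_id, ← h1]
    ext i j
    simp
  change φ (A.submatrix f g).det ∈ q
  rw [← Ideal.Quotient.eq_zero_iff_mem, RingHom.map_det, RingHom.map_det]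
  exact (congrArg det h2).trans (det_mul_eq_zero_of_lt _ _)

lemma choose_le_height_of_schur {R S : Type*} [CommRing R] [CommRing S] [Algebra R S]
    (M : Submonoid R) [IsLocalization M S] {r m n : ℕ} {A : Matrix (Fin n) (Fin n) R}
    {e : Fin r ⊕ Fin m ≃ Fin n} {B : Matrix (Fin r) (Fin r) S}
    {E : Matrix (Fin r) (Fin m) S} {D : Matrix (Fin m) (Fin m) S} (hBs : B.IsSymm)
    (hA : (A.map (algebraMap R S)).submatrix e e = fromBlocks B (B * E) (B * E)ᵀ D)
    (hj : ((n - (r + 1) + 2).choose 2 : ℕ∞) ≤ idealHeight (minorsIdeal (r + 1) A))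
    {q : Ideal S} [q.IsPrime]
    (hq : ∀ i j, (D - Eᵀ * B * E) i j ∈ q) : ((n - (r + 1) + 2).choose 2 : ℕ∞) ≤ q.height := by
  rw [← IsLocalization.height_under M]
  exact hj.trans (idealHeight_le_height (minorsIdeal_le_comap_of_schur _ hBs hA hq))

lemma det_ne_zero_of_idealHeight_eq_three {R : Type*} [CommRing R] [IsNoetherianRing R] {n : ℕ}
    (h2n : 2 ≤ n) {A : Matrix (Fin n) (Fin n) R} (hA : A.IsSymm)
    (hgen : idealHeight (minorsIdeal (n - 1) A) = (3 : ℕ∞))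
    (hj : ∀ j : ℕ, 1 ≤ j → j ≤ n - 2 →
      ((Nat.choose (n - j + 2) 2 : ℕ) : ℕ∞) ≤ idealHeight (minorsIdeal j A)) : A.det ≠ 0 := by
  obtain ⟨p, hp, hIp, hp3⟩ := exists_height_eq_idealHeight (k := 3) hgen
  let S := Localization.AtPrime p
  let φ := algebraMap R S
  have hAS : (A.map φ).IsSymm := by
    rw [IsSymm, ← transpose_map, hA.eq]
  obtain ⟨r, m, e, B, B', E, D, hAe, hB, hBs, hDs, hm⟩ := exists_schur_complement hAS
  have hrm : r + m = n := by simpa using Fintype.card_congr e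
  have hBu : IsUnit B.det := (isUnit_iff_isUnit_det B).1 (IsUnit.of_mul_eq_one _ hB)
  intro h0
  have hdet : B.det * (D - Eᵀ * B * E).det = 0 := by
    have h1 := det_submatrix_sumMap_schur (D := D) (E := E) hB hBs id
    rw [← hAe, Sum.map_id_id, submatrix_id_id, det_submatrix_equiv_self, submatrix_id_id] at h1
    rw [← h1]
    have h2 := RingHom.map_det φ A
    rw [h0, map_zero] at h2
    exact h2.symm
  have hdet0 : (D - Eᵀ * B * E).det = 0 := (hBu.mul_right_eq_zero).1 hdet
  have hr : n ≤ r + 2 := by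
    by_contra! hlt
    have h1 := choose_le_height_of_schur p.primeCompl hBs hAe (hj (r + 1) (by omega) (by omega)) hm
    rw [← IsLocalization.height_under p.primeCompl,
      IsLocalization.AtPrime.under_maximalIdeal S p, hp3] at h1
    have h2 : (4).choose 2 ≤ (n - (r + 1) + 2).choose 2 := Nat.choose_le_choose 2 (by omega)
    norm_cast at h1
    exact absurd (h2.trans h1) (by decide)
  obtain rfl | rfl | rfl : m = 0 ∨ m = 1 ∨ m = 2 := by omega
  · rw [det_isEmpty] at hdet0
    exact one_ne_zero hdet0
  · have hr1 : r = n - 1 := by omega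
    subst hr1
    have h1 : (A.submatrix (e ∘ Sum.inl) (e ∘ Sum.inl)).det ∈ p :=
      hIp (Ideal.subset_span ⟨_, _, e.injective.comp Sum.inl_injective,
        e.injective.comp Sum.inl_injective, rfl⟩)
    have h2 : B.det ∈ maximalIdeal S := by
      rw [← IsLocalization.AtPrime.to_map_mem_maximal_iff S p, RingHom.map_det] at h1
      convert h1 using 2
      ext i j
      exact (congrFun (congrFun hAe (Sum.inl i)) (Sum.inl j)).symm
    exact (mem_maximalIdeal _).1 h2 hBu
  · let A' := D - Eᵀ * B * E
    have hA's : A'.IsSymm := by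
      rw [IsSymm, transpose_sub, hDs.eq, transpose_mul _ E, transpose_mul Eᵀ B, transpose_transpose,
        hBs.eq, ← Matrix.mul_assoc]
    have hac : A' 0 0 * A' 1 1 = A' 0 1 * A' 0 1 := by
      have h1 : A'.det = 0 := hdet0
      rw [det_fin_two, hA's.apply 0 1] at h1
      exact sub_eq_zero.1 h1
    have hne : Ideal.span ({A' 0 0, A' 1 1} : Set S) ≠ ⊤ := by
      intro h1
      refine (maximalIdeal.isMaximal S).ne_top (top_le_iff.1 (h1 ▸ Ideal.span_le.2 ?_))
      rintro x (rfl | rfl)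
      exacts [hm 0 0, hm 1 1]
    obtain ⟨q, hq⟩ := Ideal.nonempty_minimalPrimes hne
    have := hq.isPrime
    have h2 : q.height ≤ 2 := by
      refine (Ideal.height_le_card_of_mem_minimalPrimes_span (Set.toFinite _) hq).trans ?_
      exact_mod_cast (Set.ncard_insert_le _ _).trans (by simp)
    have h00 : A' 0 0 ∈ q := hq.le (Ideal.subset_span (by simp))
    have h11 : A' 1 1 ∈ q := hq.le (Ideal.subset_span (by simp))
    have h01 : A' 0 1 ∈ q := by
      have h3 : A' 0 1 * A' 0 1 ∈ q := hac ▸ q.mul_mem_left _ h11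
      exact (hq.isPrime.mem_or_mem h3).elim id id
    have h10 : A' 1 0 ∈ q := by rwa [hA's.apply 0 1]
    have hr1 : n - 1 = r + 1 := by omega
    rw [hr1] at hgen
    have h3 := choose_le_height_of_schur (q := q) p.primeCompl hBs hAe
      (by rw [hgen, show n - (r + 1) + 2 = 3 by omega]; norm_num [Nat.choose]) (by
        intro i j
        fin_cases i <;> fin_cases j
        exacts [h00, h01, h10, h11])
    rw [show n - (r + 1) + 2 = 3 by omega] at h3
    have h4 := h3.trans h2
    norm_num [Nat.choose] at h4

end Heights

section LocalToGlobal

open IsLocalRing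

lemma DetRegular.of_isUnit {ι R : Type*} [Fintype ι] [DecidableEq ι] [CommRing R]
    {A : Matrix ι ι R} (h : IsUnit A.det) : DetRegular A := fun _ hf =>
  (Ideal.unit_mul_mem_iff_mem _ (h.map MvPolynomial.C)).1 hf

lemma choose_le_idealHeight_minorsIdeal {R : Type*} [CommRing R] [IsDomain R] {n : ℕ}
    {A : Matrix (Fin n) (Fin n) R} (hdet : A.det ≠ 0)
    (hgen : idealHeight (minorsIdeal (n - 1) A) = (3 : ℕ∞))
    (hj : ∀ j : ℕ, 1 ≤ j → j ≤ n - 2 →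
      ((Nat.choose (n - j + 2) 2 : ℕ) : ℕ∞) ≤ idealHeight (minorsIdeal j A)) {j : ℕ} (hj1 : 1 ≤ j)
    (hjn : j ≤ n) : ((n - j + 2).choose 2 : ℕ∞) ≤ idealHeight (minorsIdeal j A) := by
  obtain h | rfl | rfl : j ≤ n - 2 ∨ j = n - 1 ∨ j = n := by omega
  · exact hj j hj1 h
  · rw [hgen, show n - (n - 1) + 2 = 3 by omega]
    norm_num [Nat.choose]
  · rw [Nat.sub_self]
    refine le_iInf₂ fun q hq => ?_
    simp only [zero_add, Nat.choose_self, Nat.cast_one]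
    rw [Order.one_le_iff_ne_zero, Ne, Order.height_eq_zero]
    intro hmin
    have h1 : (⊥ : PrimeSpectrum R) = q := hmin.eq_of_le bot_le
    subst h1
    refine hdet ?_
    have h2 : A.det ∈ (⊥ : PrimeSpectrum R).asIdeal := hq (Ideal.subset_span
      ⟨id, id, Function.injective_id, Function.injective_id, by rw [submatrix_id_id]⟩)
    simpa using h2

theorem detRegular_map_localization {K : Type*} [Field K] {d n : ℕ}
    {A : Matrix (Fin n) (Fin n) (MvPolynomial (Fin d) K)} (hA : A.IsSymm)
    (hj : ∀ j : ℕ, 1 ≤ j → j ≤ n →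
      ((Nat.choose (n - j + 2) 2 : ℕ) : ℕ∞) ≤ idealHeight (minorsIdeal j A))
    (𝔭 : Ideal (MvPolynomial (Fin d) K)) [h𝔭 : 𝔭.IsMaximal] :
    DetRegular (A.map (algebraMap _ (Localization.AtPrime 𝔭))) := by
  have hAS : (A.map (algebraMap _ (Localization.AtPrime 𝔭))).IsSymm := by
    rw [IsSymm, ← transpose_map, hA.eq]
  obtain ⟨r, m, e, B, B', E, D, hAe, hB, hBs, hDs, hm⟩ := exists_schur_complement hAS
  have hrm : r + m = n := by simpa using Fintype.card_congr e
  refine DetRegular.of_submatrix e ?_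
  rw [hAe]
  rcases Nat.eq_zero_or_pos m with rfl | hm0
  · refine DetRegular.of_isUnit ?_
    have h1 := det_submatrix_sumMap_schur (D := D) (E := E) hB hBs id
    rw [Sum.map_id_id, submatrix_id_id, submatrix_id_id, det_isEmpty (A := D - _), mul_one] at h1
    rw [h1]
    exact (isUnit_iff_isUnit_det B).1 (IsUnit.of_mul_eq_one _ hB)
  · have : Nonempty (Fin m) := ⟨⟨0, hm0⟩⟩
    refine DetRegular.of_schur hB hBs ?_
    have hs : (D - Eᵀ * B * E).IsSymm := by
      rw [IsSymm, transpose_sub, hDs.eq, transpose_mul _ E, transpose_mul Eᵀ B, transpose_transpose,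
        hBs.eq, ← Matrix.mul_assoc]
    obtain ⟨v, hv⟩ := exists_symMat_eq hs
    have hvm : ∀ s, v s ∈ maximalIdeal (Localization.AtPrime 𝔭) := by
      intro s
      induction s using Sym2.ind with
      | _ i j =>
        have := hm i j
        rwa [← hv] at this
    have hdim : ringKrullDim (Localization.AtPrime 𝔭) ≤ d := by
      rw [IsLocalization.AtPrime.ringKrullDim_eq_height 𝔭]
      refine Ideal.height_le_ringKrullDim_of_isPrime.trans ?_
      rw [MvPolynomial.ringKrullDim_of_isNoetherianRing]
      simp
    let ε := (Fintype.equivFin (Sym2 (Fin m))).symm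
    rw [← hv]
    refine detRegular_of_isRegSeq K ⟨0, hm0⟩ v ε
      (isRegSeq_of_le_height (depthGE_localization_mvPolynomial 𝔭) hdim (fun i => hvm _) ?_) hvm
    intro Q hQ
    rw [Sym2.card, Fintype.card_fin, ← PrimeSpectrum.height_eq_orderHeight]
    have h1 := choose_le_height_of_schur (q := Q.asIdeal) 𝔭.primeCompl hBs hAe
      (hj (r + 1) (by omega) (by omega)) (by
        intro i j
        rw [← hv]
        have := hQ (ε.symm s(i, j))
        rwa [Function.comp_apply, Equiv.apply_symm_apply] at this)
    rwa [show n - (r + 1) + 2 = m + 1 by omega] at h1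

lemma exists_notMem_C_mul_mem_linIdeal {ι R : Type*} [Fintype ι] [DecidableEq ι] [CommRing R]
    {A : Matrix ι ι R} (𝔭 : Ideal R) [𝔭.IsPrime] {f : MvPolynomial (Sym2 ι) R}
    (h : MvPolynomial.map (algebraMap R (Localization.AtPrime 𝔭)) f ∈
      linIdeal (A.map (algebraMap R (Localization.AtPrime 𝔭)))) :
    ∃ t, t ∉ 𝔭 ∧ MvPolynomial.C t * f ∈ linIdeal A := by
  rw [← map_linIdeal] at h
  let := MvPolynomial.algebraMvPolynomial (σ := Sym2 ι) (R := R) (S := Localization.AtPrime 𝔭)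
  have := MvPolynomial.isLocalization (σ := Sym2 ι) 𝔭.primeCompl (Localization.AtPrime 𝔭)
  obtain ⟨_, ⟨t, ht, rfl⟩, h2⟩ := (IsLocalization.algebraMap_mem_map_algebraMap_iff
    (𝔭.primeCompl.map (MvPolynomial.C (σ := Sym2 ι)))
    (MvPolynomial (Sym2 ι) (Localization.AtPrime 𝔭)) _ _).1 h
  exact ⟨t, ht, h2⟩

theorem DetRegular.of_localization_maximal {ι R : Type*} [Fintype ι] [DecidableEq ι] [CommRing R]
    {A : Matrix ι ι R} (h : ∀ (𝔭 : Ideal R) [𝔭.IsMaximal],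
      DetRegular (A.map (algebraMap R (Localization.AtPrime 𝔭)))) : DetRegular A := by
  intro f hf
  let J : Ideal R := ((linIdeal A).colon {f}).comap MvPolynomial.C
  have hJ : ∀ t, t ∈ J ↔ MvPolynomial.C t * f ∈ linIdeal A := fun t => by
    rw [Ideal.mem_comap, Submodule.mem_colon_singleton, smul_eq_mul]
  by_cases hJt : J = ⊤
  · have h1 := (hJ 1).1 (by rw [hJt]; trivial)
    rwa [map_one, one_mul] at h1
  · obtain ⟨𝔭, h𝔭, hJ𝔭⟩ := Ideal.exists_le_maximal J hJt
    have h1 := Ideal.mem_map_of_mem (MvPolynomial.map (algebraMap R (Localization.AtPrime 𝔭))) hf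
    rw [map_linIdeal, map_mul, MvPolynomial.map_C, RingHom.map_det] at h1
    obtain ⟨t, ht, h2⟩ := exists_notMem_C_mul_mem_linIdeal 𝔭 (h 𝔭 _ h1)
    exact absurd (hJ𝔭 ((hJ t).2 h2)) ht

end LocalToGlobal

section LinearType

open MvPolynomial

lemma isLinearType_of_le {R ι : Type*} [CommRing R] {f : ι → R} (h : reesDefIdeal f ≤ Ideal.span
    {p : MvPolynomial ι R | p ∈ reesDefIdeal f ∧ p.IsHomogeneous 1}) : IsLinearType f :=
  le_antisymm h (Ideal.span_le.2 fun _ hp => hp.1)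

/-- Linear type is inherited by a family which differs from a family of linear type only by
repetitions and by multiplication by square roots of unity. -/
lemma IsLinearType.of_surjective {R ι σ : Type*} [CommRing R] {g : σ → R} (h : IsLinearType g)
    {f : ι → R} {π : ι → σ} (hπ : Function.Surjective π) {ε : ι → R} (hε : ∀ i, ε i * ε i = 1)
    (hf : ∀ i, f i = ε i * g (π i)) : IsLinearType f := by
  refine isLinearType_of_le ?_
  set L := Ideal.span {p : MvPolynomial ι R | p ∈ reesDefIdeal f ∧ p.IsHomogeneous 1} with hL
  obtain ⟨τ, hτ⟩ := hπ.hasRightInverse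
  let Φ : MvPolynomial ι R →ₐ[R] MvPolynomial σ R := aeval fun i => C (ε i) * X (π i)
  let Ψ : MvPolynomial σ R →ₐ[R] MvPolynomial ι R := aeval fun z => C (ε (τ z)) * X (τ z)
  let φf : MvPolynomial ι R →ₐ[R] Polynomial R := aeval fun i => Polynomial.C (f i) * Polynomial.X
  let φg : MvPolynomial σ R →ₐ[R] Polynomial R := aeval fun i => Polynomial.C (g i) * Polynomial.X
  have hΦ : φg.comp Φ = φf := by
    refine MvPolynomial.algHom_ext fun i => ?_
    simp [φg, Φ, φf, hf, mul_assoc]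
  have hΨ : φf.comp Ψ = φg := by
    refine MvPolynomial.algHom_ext fun z => ?_
    have h1 : ε (τ z) * f (τ z) = g z := by
      rw [hf, ← mul_assoc, hε, one_mul, hτ]
    simp [φg, Ψ, φf, ← mul_assoc, ← h1]
  have hΨL : ∀ p ∈ reesDefIdeal g, Ψ p ∈ L := by
    intro p hp
    rw [h] at hp
    have h1 : Ideal.span {p : MvPolynomial σ R | p ∈ reesDefIdeal g ∧ p.IsHomogeneous 1} ≤
        L.comap Ψ := by
      refine Ideal.span_le.2 fun p hp => Ideal.subset_span ⟨?_, ?_⟩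
      · have h2 : φg p = 0 := hp.1
        rw [← hΨ] at h2
        exact h2
      · have h2 := hp.2.aeval (fun z => C (ε (τ z)) * X (τ z) : σ → MvPolynomial ι R) (n := 1)
          fun z => by
            simpa using (isHomogeneous_C ι (ε (τ z))).mul (isHomogeneous_X R (τ z))
        rw [one_mul] at h2
        exact h2
    exact h1 hp
  intro p hp
  have h1 : φf p = 0 := hp
  rw [← hΦ] at h1
  have h2 : Ideal.Quotient.mkₐ R L (Ψ (Φ p)) = 0 := Ideal.Quotient.eq_zero_iff_mem.2 (hΨL _ h1)
  have h3 : ((Ideal.Quotient.mkₐ R L).comp Ψ).comp Φ = Ideal.Quotient.mkₐ R L := by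
    refine MvPolynomial.algHom_ext fun i => ?_
    refine Ideal.Quotient.eq.2 (Ideal.subset_span ⟨?_, ?_⟩)
    · change φf (Ψ (Φ (X i)) - X i) = 0
      rw [map_sub, sub_eq_zero]
      exact (DFunLike.congr_fun hΨ _).trans (DFunLike.congr_fun hΦ _)
    · refine IsHomogeneous.sub ?_ (isHomogeneous_X R i)
      have h4 : Ψ (Φ (X i)) = C (ε i * ε (τ (π i))) * X (τ (π i)) := by
        simp [Φ, Ψ, mul_assoc]
      change (Ψ (Φ (X i))).IsHomogeneous 1
      rw [h4]
      simpa using (isHomogeneous_C ι (ε i * ε (τ (π i)))).mul (isHomogeneous_X R (τ (π i)))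
  exact Ideal.Quotient.eq_zero_iff_mem.1 ((DFunLike.congr_fun h3 p).symm.trans h2)

lemma DetRegular.mem_of_pow_mul_mem {ι R : Type*} [Fintype ι] [DecidableEq ι] [CommRing R]
    {A : Matrix ι ι R} (h : DetRegular A) (k : ℕ) {f : MvPolynomial (Sym2 ι) R}
    (hf : C A.det ^ k * f ∈ linIdeal A) : f ∈ linIdeal A := by
  induction k with
  | zero => simpa using hf
  | succ k ih =>
    rw [pow_succ', mul_assoc] at hf
    exact ih (h _ hf)

lemma linIdeal_le_span {ι R : Type*} [Fintype ι] [DecidableEq ι] [CommRing R]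
    {A : Matrix ι ι R} {g : Sym2 ι → R} (hg : symMat g = A.adjugate) :
    linIdeal A ≤ Ideal.span
      {p : MvPolynomial (Sym2 ι) R | p ∈ reesDefIdeal g ∧ p.IsHomogeneous 1} := by
  have hker : linIdeal A ≤ reesDefIdeal g := by
    refine linIdeal_le_ker_iff.2 ⟨Polynomial.C A.det * Polynomial.X, ?_⟩
    have h1 : symMat (fun z => aeval (fun i => Polynomial.C (g i) * Polynomial.X)
        (X z : MvPolynomial (Sym2 ι) R)) =
        (Polynomial.X : Polynomial R) • A.adjugate.map (algebraMap R (Polynomial R)) := by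
      rw [← hg]
      ext1 i j
      change aeval (fun i => Polynomial.C (g i) * Polynomial.X) (X s(i, j)) =
        Polynomial.X * Polynomial.C (g s(i, j))
      rw [aeval_X, mul_comm]
    rw [h1, Matrix.mul_smul, ← Matrix.map_mul, mul_adjugate]
    ext1 i j
    rcases eq_or_ne i j with rfl | hij
    · simp [Polynomial.X_mul_C]
    · simp [hij]
  let M : Matrix ι ι (MvPolynomial (Sym2 ι) R) := A.map C * symMat X
  have hM : ∀ i j, (M i j).IsHomogeneous 1 := by
    intro i j
    refine IsHomogeneous.sum _ _ _ fun k _ => ?_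
    simpa [symMat] using (isHomogeneous_C (Sym2 ι) (A i k)).mul (isHomogeneous_X R s(k, j))
  refine scalarIdeal_le_iff.2 ⟨fun i j hij => Ideal.subset_span ⟨?_, hM i j⟩,
    fun i j => Ideal.subset_span ⟨?_, (hM i i).sub (hM j j)⟩⟩
  · exact hker (offDiag_mem_scalarIdeal M hij)
  · exact hker (diag_sub_mem_scalarIdeal M i j)

lemma exists_pow_mul_eq_zero_of_mem_reesDefIdeal {σ R Q : Type*} [CommRing R] [CommRing Q]
    [Algebra R Q] {g : σ → R} (q : MvPolynomial σ R →ₐ[R] Q) {δ s : Q}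
    (h : ∀ z, δ * q (X z) = s * algebraMap R Q (g z)) {f : MvPolynomial σ R}
    (hf : f ∈ reesDefIdeal g) : ∃ k : ℕ, δ ^ k * q f = 0 := by
  let Q' := Localization.Away δ
  let w : Q' := IsLocalization.Away.invSelf δ * algebraMap Q Q' s
  let ψ : MvPolynomial σ R →ₐ[R] Q' := (IsScalarTower.toAlgHom R Q Q').comp q
  let φ : MvPolynomial σ R →ₐ[R] Polynomial R :=
    aeval fun i => Polynomial.C (g i) * Polynomial.X
  have hψ : ψ = (Polynomial.aeval w).comp φ := by
    refine MvPolynomial.algHom_ext fun z => ?_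
    have h1 : algebraMap Q Q' δ * algebraMap Q Q' (q (X z)) =
        algebraMap Q Q' s * algebraMap R Q' (g z) := by
      rw [IsScalarTower.algebraMap_apply R Q Q', ← map_mul, ← map_mul, h]
    have h2 : algebraMap Q Q' (q (X z)) = w * algebraMap R Q' (g z) := by
      rw [mul_assoc, ← h1, ← mul_assoc, mul_comm (IsLocalization.Away.invSelf δ),
        IsLocalization.Away.mul_invSelf, one_mul]
    change algebraMap Q Q' (q (X z)) = Polynomial.aeval w (φ (X z))
    rw [h2, aeval_X, map_mul, Polynomial.aeval_C, Polynomial.aeval_X, mul_comm]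
  have h1 : algebraMap Q Q' (q f) = 0 := by
    have h2 : φ f = 0 := hf
    change ψ f = 0
    rw [hψ, AlgHom.comp_apply, h2, map_zero]
  obtain ⟨⟨_, k, rfl⟩, h2⟩ := (IsLocalization.map_eq_zero_iff (Submonoid.powers δ) Q' _).1 h1
  exact ⟨k, h2⟩

lemma det_mul_eq_of_mul_symMat_eq_smul_one {ι R Q : Type*} [Fintype ι] [DecidableEq ι] [CommRing R]
    [CommRing Q] (φ : R →+* Q) {A : Matrix ι ι R} {g : Sym2 ι → R} (hg : symMat g = A.adjugate)
    {t : Sym2 ι → Q} {s : Q} (h : A.map φ * symMat t = s • (1 : Matrix ι ι Q)) (z : Sym2 ι) :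
    φ A.det * t z = s * φ (g z) := by
  have h1 : φ A.det • symMat t = s • (symMat g).map φ := by
    have h2 : (A.map φ).adjugate = (symMat g).map φ := by
      rw [hg]
      exact (RingHom.map_adjugate φ A).symm
    have h3 : (A.map φ).det = φ A.det := (RingHom.map_det φ A).symm
    have h4 := congrArg (fun M => (A.map φ).adjugate * M) h
    beta_reduce at h4
    rwa [← Matrix.mul_assoc, adjugate_mul, Matrix.smul_mul, Matrix.one_mul, Matrix.mul_smul,
      Matrix.mul_one, h2, h3] at h4
  induction z using Sym2.ind with
  | _ i j => exact congrFun (congrFun h1 i) j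

theorem DetRegular.isLinearType {ι R : Type*} [Fintype ι] [DecidableEq ι] [CommRing R]
    {A : Matrix ι ι R} (h : DetRegular A) {g : Sym2 ι → R} (hg : symMat g = A.adjugate) :
    IsLinearType g := by
  refine isLinearType_of_le fun f hf => linIdeal_le_span hg ?_
  obtain ⟨s, hs⟩ := exists_linIdeal_mk A
  obtain ⟨k, hk⟩ := exists_pow_mul_eq_zero_of_mem_reesDefIdeal (Ideal.Quotient.mkₐ R (linIdeal A))
    (det_mul_eq_of_mul_symMat_eq_smul_one _ hg hs) hf
  refine h.mem_of_pow_mul_mem k (Ideal.Quotient.eq_zero_iff_mem.1 ?_)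
  rw [map_mul, map_pow]
  exact hk

lemma exists_eq_succAboveOrderEmb {k : ℕ} (f : Fin k ↪o Fin (k + 1)) :
    ∃ i, f = Fin.succAboveOrderEmb i := by
  have h1 : ∃ i, i ∉ Set.range f := by
    by_contra! h2
    have := Fintype.card_le_of_surjective f h2
    simp at this
  obtain ⟨i, hi⟩ := h1
  refine ⟨i, ?_⟩
  rw [← OrderEmbedding.range_inj]
  have h2 : Set.range f ⊆ Set.range (Fin.succAboveOrderEmb i) := by
    change _ ⊆ Set.range (Fin.succAbove i)
    rw [Fin.range_succAbove]
    intro x hx hxi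
    exact hi (hxi ▸ hx)
  refine Set.eq_of_subset_of_card_le h2 ?_
  rw [Set.card_range_of_injective f.injective,
    Set.card_range_of_injective (Fin.succAboveOrderEmb i).injective]

theorem DetRegular.isLinearType_minors {R : Type*} [CommRing R] {k : ℕ}
    {A : Matrix (Fin (k + 1)) (Fin (k + 1)) R} (hA : A.IsSymm) (h : DetRegular A) :
    IsLinearType (fun q : (Fin k ↪o Fin (k + 1)) × (Fin k ↪o Fin (k + 1)) =>
      (A.submatrix ⇑q.1 ⇑q.2).det) := by
  have hadj : A.adjugate.IsSymm := by
    rw [IsSymm, adjugate_transpose, hA.eq]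
  obtain ⟨g, hg⟩ := exists_symMat_eq hadj
  choose o ho using exists_eq_succAboveOrderEmb (k := k)
  have ho' : ∀ i, o (Fin.succAboveOrderEmb i) = i := fun i => by
    have h1 := congrArg (fun f : Fin k ↪o Fin (k + 1) => (f : Fin k → Fin (k + 1)))
      (ho (Fin.succAboveOrderEmb i))
    exact (Fin.succAbove_left_injective h1).symm
  refine (h.isLinearType hg).of_surjective (π := fun q => s(o q.1, o q.2))
    (ε := fun q => (-1) ^ (o q.1 + o q.2 : ℕ)) ?_ ?_ ?_
  · intro z
    induction z using Sym2.ind with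
    | _ i j => exact ⟨(Fin.succAboveOrderEmb i, Fin.succAboveOrderEmb j), by simp only [ho']⟩
  · intro q
    rw [← mul_pow, neg_one_mul, neg_neg, one_pow]
  · rintro ⟨f₁, f₂⟩
    have h1 : g s(o f₁, o f₂) = A.adjugate (o f₂) (o f₁) := by
      rw [hadj.apply, ← hg]
      rfl
    simp only [h1, adjugate_fin_succ_eq_det_submatrix]
    rw [← mul_assoc, ← mul_pow, neg_one_mul, neg_neg, one_pow, one_mul]
    conv_lhs => rw [ho f₁, ho f₂]
    rfl

end LinearType

theorem statement_18 (K : Type*) [Field K] (d : ℕ) (hd : 0 < d)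
    (n : ℕ) (h2n : 2 ≤ n)
    (A : Matrix (Fin n) (Fin n) (MvPolynomial (Fin d) K)) (hsymA : A.IsSymm)
    (hgen : idealHeight (minorsIdeal (n - 1) A) = (3 : ℕ∞))
    (hj : ∀ j : ℕ, 1 ≤ j → j ≤ n - 2 →
      ((Nat.choose (n - j + 2) 2 : ℕ) : ℕ∞) ≤ idealHeight (minorsIdeal j A)) :
    IsLinearType (fun q : (Fin (n - 1) ↪o Fin n) × (Fin (n - 1) ↪o Fin n) =>
      (A.submatrix ⇑q.1 ⇑q.2).det) := by
  have hdet := det_ne_zero_of_idealHeight_eq_three h2n hsymA hgen hj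
  have hreg : DetRegular A := DetRegular.of_localization_maximal fun 𝔭 _ =>
    detRegular_map_localization hsymA
      (fun _ h1 h2 => choose_le_idealHeight_minorsIdeal hdet hgen hj h1 h2) 𝔭
  obtain ⟨k, rfl⟩ := Nat.exists_eq_add_of_le' (one_le_two.trans h2n)
  exact hreg.isLinearType_minors hsymA
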